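/- Raynaud–Gruson–Mehlmann: Let f : Y → X be a flat map of affinoid varieties. Let Σ be the semianalytic subset of Y given by Σ = {y ∈ Y : |h_i(y)| < 1 and |g_j(y)| ≥ 1, for i ∈ I and j ∈ J}, where the h_i and g_j are finitely many functions in the affinoid algebra of Y each of whose supremum norm is at most one. Then f(Σ) is semianalytic in X. -/

import Mathlib

/-!  Prelude: rigid-analytic basics over a complete non-archimedean
algebraically closed field `K`. -/

open scoped BoundedContinuousFunction

noncomputable section

namespace RigidQE

variable (K : Type) [NormedField K] [CompleteSpace K] [IsAlgClosed K] [IsUltrametricDist K]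

/-- The valuation ring `R = {x : K | ‖x‖ ≤ 1}` of `K`. -/
def Ro : Subring K where
  carrier := {x | ‖x‖ ≤ 1}
  zero_mem' := by simp
  one_mem' := by simp
  add_mem' := fun {a b} ha hb => le_trans (IsUltrametricDist.norm_add_le_max a b) (max_le ha hb)
  neg_mem' := fun {a} ha => by simpa using ha
  mul_mem' := fun {a b} ha hb => le_trans (norm_mul_le a b)
    (by simpa using mul_le_one₀ ha (norm_nonneg b) hb)

/-- The maximal ideal `℘ = {x : K | ‖x‖ < 1}` of the valuation ring. -/
def RoMax : Ideal (Ro K) where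
  carrier := {x | ‖(x : K)‖ < 1}
  zero_mem' := by simp
  add_mem' := fun {a b} ha hb =>
    lt_of_le_of_lt (IsUltrametricDist.norm_add_le_max (a : K) (b : K)) (max_lt ha hb)
  smul_mem' := fun c x hx => by
    have h1 : ‖(c : K)‖ ≤ 1 := c.2
    have : ‖(c : K) * (x : K)‖ ≤ 1 * ‖(x : K)‖ := le_trans (norm_mul_le _ _) (by gcongr)
    simpa using lt_of_le_of_lt (by simpa using this) hx

/-- The closed unit polydisc `R^m ⊆ K^m`. -/
def UnitBall (m : ℕ) : Set (Fin m → K) := {x | ∀ i, ‖x i‖ ≤ 1}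

/-- The `i`-th coordinate function on the unit polydisc, as a bounded continuous function. -/
def coordFn (m : ℕ) (i : Fin m) : (UnitBall K m) →ᵇ K :=
  BoundedContinuousFunction.ofNormedAddCommGroup (fun x => x.1 i)
    ((continuous_apply i).comp continuous_subtype_val) 1 (fun x => x.2 i)

/-- The Tate algebra `K⟨S₁,…,Sₘ⟩` of strictly convergent power series, realised concretely
as the closure, with respect to the supremum norm, of the algebra of polynomial functions
on the unit polydisc. -/
def TateAlg (m : ℕ) : Subalgebra K ((UnitBall K m) →ᵇ K) :=
  (Algebra.adjoin K (Set.range (coordFn K m))).topologicalClosure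

end RigidQE

end

noncomputable section
namespace RigidQE

variable (K : Type) [NormedField K] [CompleteSpace K] [IsAlgClosed K] [IsUltrametricDist K]

/-- The projection `R^{m+N} → R^m` on the first `m` coordinates. -/
def ballProj (m N : ℕ) (z : UnitBall K (m + N)) : UnitBall K m :=
  ⟨fun i => z.1 (Fin.castAdd N i), fun i => z.2 _⟩

lemma ballProj_continuous (m N : ℕ) : Continuous (ballProj K m N) := by
  apply Continuous.subtype_mk
  exact continuous_pi fun i => (continuous_apply _).comp continuous_subtype_val

/-- Pullback of bounded functions along the projection of polydiscs. -/
def ballPull (m N : ℕ) : ((UnitBall K m) →ᵇ K) →ₐ[K] ((UnitBall K (m + N)) →ᵇ K) where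
  toFun f := f.compContinuous ⟨ballProj K m N, ballProj_continuous K m N⟩
  map_one' := by ext z; simp
  map_mul' f g := by ext z; simp
  map_zero' := by ext z; simp
  map_add' f g := by ext z; simp
  commutes' c := by ext z; simp

lemma ballPull_lipschitz (m N : ℕ) : LipschitzWith 1 (ballPull K m N) := by
  apply LipschitzWith.of_dist_le_mul
  intro f g
  simp only [NNReal.coe_one, one_mul]
  refine (BoundedContinuousFunction.dist_le (dist_nonneg (x := f) (y := g))).2 ?_
  intro z
  exact BoundedContinuousFunction.dist_coe_le_dist (f := f) (g := g) (ballProj K m N z)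

lemma ballPull_mem_TateAlg (m N : ℕ) {f : (UnitBall K m) →ᵇ K} (hf : f ∈ TateAlg K m) :
    ballPull K m N f ∈ TateAlg K (m + N) := by
  have hsub : (ballPull K m N) '' (Algebra.adjoin K (Set.range (coordFn K m)) : Set _)
      ⊆ (Algebra.adjoin K (Set.range (coordFn K (m + N))) : Set _) := by
    rintro g ⟨g', hg', rfl⟩
    have : ballPull K m N g' ∈ (Algebra.adjoin K (Set.range (coordFn K m))).map
        (ballPull K m N) := Subalgebra.mem_map.2 ⟨g', hg', rfl⟩
    rw [AlgHom.map_adjoin] at this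
    refine Algebra.adjoin_mono ?_ this
    rintro h ⟨h', ⟨i, rfl⟩, rfl⟩
    exact ⟨Fin.castAdd N i, by ext z; rfl⟩
  have := (image_closure_subset_closure_image (s := (Algebra.adjoin K (Set.range (coordFn K m)) :
      Set _)) (ballPull_lipschitz K m N).continuous) (Set.mem_image_of_mem _ hf)
  exact closure_mono hsub this

/-- An affinoid variety, realised concretely as the zero locus, inside a closed unit
polydisc, of a set of strictly convergent power series. -/
structure Affinoid where
  m : ℕ
  carrier : Set (UnitBall K m)
  isZeroLocus : ∃ S : Set ((UnitBall K m) →ᵇ K),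
    (∀ f ∈ S, f ∈ TateAlg K m) ∧ carrier = {x | ∀ f ∈ S, f x = 0}

variable {K}

/-- Restriction of (bounded continuous) functions on the polydisc to a subset, as plain
functions. -/
def resHom {m : ℕ} (Z : Set (UnitBall K m)) : ((UnitBall K m) →ᵇ K) →ₐ[K] (Z → K) where
  toFun f := fun z => f z.1
  map_one' := rfl
  map_mul' f g := rfl
  map_zero' := rfl
  map_add' f g := rfl
  commutes' c := rfl

/-- The affinoid algebra of `X`, realised concretely as the algebra of functions on `X`
which are restrictions of strictly convergent power series.  (Since `K` is algebraically
closed, this faithfully represents the reduced affinoid algebra.) -/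
def Affinoid.O (X : Affinoid K) : Subalgebra K (X.carrier → K) :=
  (TateAlg K X.m).map (resHom X.carrier)

/-- A basic semianalytic subset of an affinoid variety. -/
def IsBasicSemianalytic (X : Affinoid K) (S : Set X.carrier) : Prop :=
  ∃ (mm n : ℕ) (p q : Fin mm → X.O), n ≤ mm ∧
    S = {x | (∀ i : Fin mm, (i : ℕ) < n → ‖(p i : X.carrier → K) x‖ ≤ ‖(q i : X.carrier → K) x‖)
      ∧ (∀ i : Fin mm, n ≤ (i : ℕ) → ‖(p i : X.carrier → K) x‖ < ‖(q i : X.carrier → K) x‖)}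

/-- A semianalytic subset of an affinoid variety: a finite union of basic sets. -/
def IsSemianalytic (X : Affinoid K) (S : Set X.carrier) : Prop :=
  ∃ (k : ℕ) (B : Fin k → Set X.carrier),
    (∀ j, IsBasicSemianalytic X (B j)) ∧ S = ⋃ j, B j

variable (K)

/-- The product `X × R^N` of an affinoid variety with a closed unit polydisc. -/
def Affinoid.prod (X : Affinoid K) (N : ℕ) : Affinoid K where
  m := X.m + N
  carrier := {z | ballProj K X.m N z ∈ X.carrier}
  isZeroLocus := by
    obtain ⟨S, hS, hXS⟩ := X.isZeroLocus
    refine ⟨(ballPull K X.m N) '' S, ?_, ?_⟩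
    · rintro f ⟨f', hf', rfl⟩
      exact ballPull_mem_TateAlg K X.m N (hS f' hf')
    · ext z
      simp only [Set.mem_setOf_eq, hXS, Set.forall_mem_image]
      rfl

variable {K}

/-- The projection map `X × R^N → X` on points. -/
def Affinoid.projFun (X : Affinoid K) (N : ℕ) (z : (X.prod K N).carrier) : X.carrier :=
  ⟨ballProj K X.m N z.1, z.2⟩

/-- A subanalytic subset of an affinoid variety: the image of a semianalytic subset of
`X × R^N` under the projection `X × R^N → X`. -/
def IsSubanalytic (X : Affinoid K) (S : Set X.carrier) : Prop :=
  ∃ (N : ℕ) (T : Set (X.prod K N).carrier),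
    IsSemianalytic (X.prod K N) T ∧ S = (X.projFun N) '' T

end RigidQE
end

noncomputable section
namespace RigidQE

variable {K : Type} [NormedField K] [CompleteSpace K] [IsAlgClosed K] [IsUltrametricDist K]

/-- A map of affinoid varieties: a map on points which pulls analytic functions back to
analytic functions (equivalently, a map induced by a `K`-algebra morphism of the
corresponding affinoid algebras). -/
structure AffinoidMap (Y X : Affinoid K) where
  toFun : Y.carrier → X.carrier
  pullback : ∀ p : X.O, (fun y => (p : X.carrier → K) (toFun y)) ∈ Y.O

/-- The `K`-algebra morphism of affinoid algebras corresponding to a map of affinoid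
varieties. -/
def AffinoidMap.algHom {Y X : Affinoid K} (f : AffinoidMap Y X) : X.O →ₐ[K] Y.O where
  toFun p := ⟨fun y => (p : X.carrier → K) (f.toFun y), f.pullback p⟩
  map_one' := by ext y; simp
  map_mul' p q := by ext y; simp
  map_zero' := by ext y; simp
  map_add' p q := by ext y; simp
  commutes' c := by ext y; simp

/-- A map of affinoid varieties is flat if the corresponding morphism of affinoid algebras
is flat. -/
def AffinoidMap.Flat {Y X : Affinoid K} (f : AffinoidMap Y X) : Prop :=
  RingHom.Flat f.algHom.toRingHom

open Classical in
/-- The truncated division function `D` of Denef–van den Dries: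
`D (a, b) = a / b` if `‖a‖ ≤ ‖b‖ ≠ 0`, and `D (a, b) = 0` otherwise. -/
def Ddiv (a b : K) : K := if ‖a‖ ≤ ‖b‖ ∧ b ≠ 0 then a / b else 0

/-- The point `(x, t) ∈ X × R^N` determined by `x ∈ X` and `t ∈ R^N`. -/
def extendPt (X : Affinoid K) (N : ℕ) (x : X.carrier) (t : Fin N → K)
    (ht : ∀ i, ‖t i‖ ≤ 1) : (X.prod K N).carrier := by
  have hmem : Fin.append (fun i => x.1.1 i) t ∈ UnitBall K (X.m + N) := by
    intro j
    refine Fin.addCases (motive := fun j => ‖Fin.append (fun i => x.1.1 i) t j‖ ≤ 1)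
      (fun i => ?_) (fun i => ?_) j
    · simp only [Fin.append_left]; exact x.1.2 i
    · simp only [Fin.append_right]; exact ht i
  refine ⟨⟨Fin.append (fun i => x.1.1 i) t, hmem⟩, ?_⟩
  show ballProj K X.m N ⟨Fin.append (fun i => x.1.1 i) t, hmem⟩ ∈ X.carrier
  have h : ballProj K X.m N ⟨Fin.append (fun i => x.1.1 i) t, hmem⟩ = x.1 := by
    apply Subtype.ext; funext i
    show Fin.append (fun i => x.1.1 i) t (Fin.castAdd N i) = x.1.1 i
    rw [Fin.append_left]
  rw [h]; exact x.2

/-- The algebra `A^D` of `D`-functions on an affinoid variety `X = Sp A`: the smallest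
`K`-algebra of `K`-valued functions on `X` containing `A` and closed under truncated
division `D` and under composition with strictly convergent power series over `A`
(the latter being realised as analytic functions on `X × R^N`). -/
inductive IsDFun (X : Affinoid K) : (X.carrier → K) → Prop
  | base (p : X.O) : IsDFun X (p : X.carrier → K)
  | smul (c : K) {p : X.carrier → K} : IsDFun X p → IsDFun X (c • p)
  | add {p q : X.carrier → K} : IsDFun X p → IsDFun X q → IsDFun X (p + q)
  | mul {p q : X.carrier → K} : IsDFun X p → IsDFun X q → IsDFun X (p * q)
  | div {p q : X.carrier → K} : IsDFun X p → IsDFun X q →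
      IsDFun X (fun x => Ddiv (p x) (q x))
  | comp (N : ℕ) (p : (X.prod K N).O) (q : Fin N → (X.carrier → K))
      (hq : ∀ i, IsDFun X (q i)) (hq1 : ∀ i x, ‖q i x‖ ≤ 1) :
      IsDFun X (fun x =>
        (p : (X.prod K N).carrier → K) (extendPt X N x (fun i => q i x) (fun i => hq1 i x)))

/-- A basic `D`-semianalytic subset of an affinoid variety. -/
def IsBasicDSemianalytic (X : Affinoid K) (S : Set X.carrier) : Prop :=
  ∃ (mm n : ℕ) (p q : Fin mm → (X.carrier → K)), n ≤ mm ∧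
    (∀ i, IsDFun X (p i) ∧ IsDFun X (q i)) ∧
    S = {x | (∀ i : Fin mm, (i : ℕ) < n → ‖p i x‖ ≤ ‖q i x‖)
      ∧ (∀ i : Fin mm, n ≤ (i : ℕ) → ‖p i x‖ < ‖q i x‖)}

/-- A `D`-semianalytic subset of an affinoid variety: a finite union of basic
`D`-semianalytic sets. -/
def IsDSemianalytic (X : Affinoid K) (S : Set X.carrier) : Prop :=
  ∃ (k : ℕ) (B : Fin k → Set X.carrier),
    (∀ j, IsBasicDSemianalytic X (B j)) ∧ S = ⋃ j, B j

end RigidQE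
end

noncomputable section
namespace RigidQE

set_option linter.unusedSectionVars false

open Filter Topology

/-! ### Tate algebras over complete ultrametric rings -/

section TateDef

variable (A : Type) [NormedCommRing A] [IsUltrametricDist A] (τ : Type)

/-- Strictly convergent power series, as a subring of all power series. -/
def tateSubring : Subring (MvPowerSeries τ A) := MvPowerSeries.IsRestricted.subring (1 : τ → ℝ)

/-- The Tate algebra `A⟨τ⟩` of strictly convergent power series in the variables `τ`. -/
def Tate : Type := ↥(tateSubring A τ)

instance : CommRing (Tate A τ) := inferInstanceAs (CommRing ↥(tateSubring A τ))

variable {A τ}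

lemma mem_tateSubring {f : MvPowerSeries τ A} :
    f ∈ tateSubring A τ ↔ Tendsto (fun ν => ‖MvPowerSeries.coeff ν f‖) cofinite (𝓝 0) := by
  change MvPowerSeries.IsRestricted _ _ ↔ _
  simp [MvPowerSeries.IsRestricted, Finsupp.prod]

namespace Tate

/-- Coefficients of a strictly convergent power series. -/
def coeff (ν : τ →₀ ℕ) (f : Tate A τ) : A := MvPowerSeries.coeff ν f.1

lemma tendsto_coeff (f : Tate A τ) : Tendsto (fun ν => ‖f.coeff ν‖) cofinite (𝓝 0) :=
  mem_tateSubring.1 f.2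

/-- A strictly convergent power series from a null family of coefficients. -/
def mk (a : (τ →₀ ℕ) → A) (ha : Tendsto (fun ν => ‖a ν‖) cofinite (𝓝 0)) : Tate A τ :=
  ⟨a, mem_tateSubring.2 ha⟩

@[simp] lemma coeff_mk (a : (τ →₀ ℕ) → A) (ha) (ν : τ →₀ ℕ) : (mk a ha).coeff ν = a ν := rfl

@[ext] lemma ext {f g : Tate A τ} (h : ∀ ν, f.coeff ν = g.coeff ν) : f = g :=
  Subtype.ext (MvPowerSeries.ext h)

@[simp] lemma coeff_zero (ν : τ →₀ ℕ) : (0 : Tate A τ).coeff ν = 0 := rfl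
@[simp] lemma coeff_add (f g : Tate A τ) (ν : τ →₀ ℕ) :
    (f + g).coeff ν = f.coeff ν + g.coeff ν := rfl
@[simp] lemma coeff_neg (f : Tate A τ) (ν : τ →₀ ℕ) : (-f).coeff ν = -f.coeff ν := rfl
@[simp] lemma coeff_sub (f g : Tate A τ) (ν : τ →₀ ℕ) :
    (f - g).coeff ν = f.coeff ν - g.coeff ν := rfl

lemma coeff_mul (f g : Tate A τ) (ν : τ →₀ ℕ) [DecidableEq τ] :
    (f * g).coeff ν = ∑ p ∈ Finset.HasAntidiagonal.antidiagonal ν, f.coeff p.1 * g.coeff p.2 :=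
  MvPowerSeries.coeff_mul ν f.1 g.1

lemma coeff_one (ν : τ →₀ ℕ) [DecidableEq τ] :
    (1 : Tate A τ).coeff ν = if ν = 0 then 1 else 0 :=
  MvPowerSeries.coeff_one ν

/-- The `ν`-th coefficient as an additive map. -/
def coeffHom (ν : τ →₀ ℕ) : Tate A τ →+ A where
  toFun f := f.coeff ν
  map_zero' := rfl
  map_add' _ _ := rfl

lemma coeff_sum {ι : Type*} (s : Finset ι) (f : ι → Tate A τ) (ν : τ →₀ ℕ) :
    (∑ i ∈ s, f i).coeff ν = ∑ i ∈ s, (f i).coeff ν :=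
  map_sum (coeffHom ν) f s

lemma bddAbove_coeff (f : Tate A τ) : BddAbove (Set.range fun ν => ‖f.coeff ν‖) := by
  have h := f.tendsto_coeff.eventually (gt_mem_nhds zero_lt_one)
  rw [eventually_cofinite] at h
  obtain ⟨C, hC⟩ := (h.image fun ν => ‖f.coeff ν‖).bddAbove
  refine ⟨max C 1, ?_⟩
  rintro _ ⟨ν, rfl⟩
  by_cases hν : ‖f.coeff ν‖ < 1
  · exact (le_of_lt hν).trans (le_max_right _ _)
  · exact (hC ⟨ν, hν, rfl⟩).trans (le_max_left _ _)

instance instNorm : Norm (Tate A τ) := ⟨fun f => ⨆ ν, ‖f.coeff ν‖⟩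

lemma norm_coeff_le (f : Tate A τ) (ν : τ →₀ ℕ) : ‖f.coeff ν‖ ≤ ‖f‖ :=
  le_ciSup f.bddAbove_coeff ν

lemma norm_nonneg' (f : Tate A τ) : 0 ≤ ‖f‖ := (norm_nonneg _).trans (f.norm_coeff_le 0)

lemma norm_le_of {f : Tate A τ} {C : ℝ} (h : ∀ ν, ‖f.coeff ν‖ ≤ C) : ‖f‖ ≤ C := ciSup_le h

lemma norm_add_le_max' (f g : Tate A τ) : ‖f + g‖ ≤ max ‖f‖ ‖g‖ :=
  norm_le_of fun ν => (IsUltrametricDist.norm_add_le_max _ _).trans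
    (max_le_max (f.norm_coeff_le ν) (g.norm_coeff_le ν))

lemma norm_mul_le' (f g : Tate A τ) : ‖f * g‖ ≤ ‖f‖ * ‖g‖ := by
  classical
  refine norm_le_of fun ν => ?_
  rw [coeff_mul]
  refine IsUltrametricDist.norm_sum_le_of_forall_le_of_nonneg
    (mul_nonneg f.norm_nonneg' g.norm_nonneg') fun p _ => ?_
  exact (norm_mul_le _ _).trans
    (mul_le_mul (f.norm_coeff_le _) (g.norm_coeff_le _) (norm_nonneg _) f.norm_nonneg')

/-- The Gauss norm as a group norm. -/
def groupNorm : AddGroupNorm (Tate A τ) where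
  toFun f := ‖f‖
  map_zero' := le_antisymm (norm_le_of fun ν => by simp) (norm_nonneg' _)
  add_le' f g := (norm_add_le_max' f g).trans
    (max_le (le_add_of_nonneg_right g.norm_nonneg') (le_add_of_nonneg_left f.norm_nonneg'))
  neg' f := by
    change (⨆ ν, _) = (⨆ ν, _)
    simp
  eq_zero_of_map_eq_zero' f hf := by
    ext ν
    exact norm_le_zero_iff.1 ((f.norm_coeff_le ν).trans (le_of_eq hf))

instance : NormedCommRing (Tate A τ) :=
  { instNorm, (inferInstance : CommRing (Tate A τ)), groupNorm.toNormedAddCommGroup with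
    dist_eq := groupNorm.toNormedAddCommGroup.dist_eq
    norm_mul_le := norm_mul_le' }

instance : IsUltrametricDist (Tate A τ) :=
  IsUltrametricDist.isUltrametricDist_of_forall_norm_add_le_max_norm norm_add_le_max'

lemma exists_norm_eq (f : Tate A τ) : ∃ ν, ‖f.coeff ν‖ = ‖f‖ := by
  by_cases hf : ‖f‖ = 0
  · exact ⟨0, le_antisymm (norm_coeff_le _ _) (hf ▸ norm_nonneg _)⟩
  have hpos : 0 < ‖f‖ := lt_of_le_of_ne (norm_nonneg _) (Ne.symm hf)
  by_contra! hne
  have hlt : ∀ ν, ‖f.coeff ν‖ < ‖f‖ := fun ν => lt_of_le_of_ne (norm_coeff_le _ _) (hne ν)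
  have h := f.tendsto_coeff.eventually (gt_mem_nhds (half_pos hpos))
  rw [eventually_cofinite] at h
  obtain ⟨C, hC, hC'⟩ : ∃ C < ‖f‖, ∀ ν ∈ h.toFinset, ‖f.coeff ν‖ ≤ C := by
    rcases h.toFinset.eq_empty_or_nonempty with he | he
    · exact ⟨0, hpos, fun ν hν => absurd hν (he ▸ Finset.notMem_empty ν)⟩
    · obtain ⟨μ, _, hμ⟩ := h.toFinset.exists_max_image (fun ν => ‖f.coeff ν‖) he
      exact ⟨_, hlt μ, hμ⟩
  have : ‖f‖ ≤ max C (‖f‖ / 2) := norm_le_of fun ν => by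
    by_cases hν : ‖f.coeff ν‖ < ‖f‖ / 2
    · exact hν.le.trans (le_max_right _ _)
    · exact (hC' ν (by simpa using hν)).trans (le_max_left _ _)
  have h2 : max C (‖f‖ / 2) < ‖f‖ := max_lt hC (half_lt_self hpos)
  linarith

instance [CompleteSpace A] : CompleteSpace (Tate A τ) := by
  refine Metric.complete_of_cauchySeq_tendsto fun u hu => ?_
  have hc : ∀ ν, CauchySeq fun n => (u n).coeff ν := fun ν => by
    refine Metric.cauchySeq_iff.2 fun ε hε => ?_
    obtain ⟨N, hN⟩ := Metric.cauchySeq_iff.1 hu ε hε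
    refine ⟨N, fun m hm n hn => ?_⟩
    have := hN m hm n hn
    rw [dist_eq_norm] at this ⊢
    exact ((u m - u n).norm_coeff_le ν).trans_lt this
  choose a ha using fun ν => cauchySeq_tendsto_of_complete (hc ν)
  have key : ∀ ε > 0, ∃ N, ∀ n ≥ N, ∀ ν, ‖(u n).coeff ν - a ν‖ ≤ ε := by
    intro ε hε
    obtain ⟨N, hN⟩ := Metric.cauchySeq_iff.1 hu ε hε
    refine ⟨N, fun n hn ν => ?_⟩
    have ht : Tendsto (fun m => ‖(u n).coeff ν - (u m).coeff ν‖) atTop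
        (𝓝 ‖(u n).coeff ν - a ν‖) := (tendsto_const_nhds.sub (ha ν)).norm
    refine le_of_tendsto ht ?_
    filter_upwards [eventually_ge_atTop N] with m hm
    have := hN n hn m hm
    rw [dist_eq_norm] at this
    exact ((u n - u m).norm_coeff_le ν).trans this.le
  have ha0 : Tendsto (fun ν => ‖a ν‖) cofinite (𝓝 0) := by
    refine Metric.tendsto_nhds.2 fun ε hε => ?_
    obtain ⟨N, hN⟩ := key (ε / 2) (half_pos hε)
    filter_upwards [(Metric.tendsto_nhds.1 (u N).tendsto_coeff) (ε / 2) (half_pos hε)] with ν hν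
    simp only [dist_zero_right, norm_norm] at hν ⊢
    have := hN N le_rfl ν
    calc ‖a ν‖ = ‖(u N).coeff ν - ((u N).coeff ν - a ν)‖ := by congr 1; ring
      _ ≤ _ := norm_sub_le _ _
      _ < ε := by linarith
  refine ⟨mk a ha0, Metric.tendsto_atTop.2 fun ε hε => ?_⟩
  obtain ⟨N, hN⟩ := key (ε / 2) (half_pos hε)
  refine ⟨N, fun n hn => ?_⟩
  rw [dist_eq_norm]
  exact (norm_le_of (f := u n - mk a ha0) (hN n hn)).trans_lt (half_lt_self hε)

/-! #### Constants, variables, polynomials -/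

lemma tendsto_coeff_poly (p : MvPolynomial τ A) :
    Tendsto (fun ν => ‖p.coeff ν‖) cofinite (𝓝 0) := by
  refine tendsto_nhds_of_eventually_eq ?_
  rw [eventually_cofinite]
  refine p.support.finite_toSet.subset fun ν hν => ?_
  simpa using hν

variable (A τ) in
/-- Polynomials as strictly convergent power series. -/
def ofPoly : MvPolynomial τ A →+* Tate A τ :=
  (MvPolynomial.coeToMvPowerSeries.ringHom (R := A) (σ := τ)).codRestrict (tateSubring A τ)
    fun p => mem_tateSubring.2 (by simpa using tendsto_coeff_poly p)

@[simp] lemma coeff_ofPoly (p : MvPolynomial τ A) (ν : τ →₀ ℕ) :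
    (ofPoly A τ p).coeff ν = p.coeff ν := MvPolynomial.coeff_coe p ν

/-- Constants. -/
def C : A →+* Tate A τ := (ofPoly A τ).comp MvPolynomial.C

/-- Variables. -/
def X (i : τ) : Tate A τ := ofPoly A τ (MvPolynomial.X i)

/-- Monomials. -/
def mono (ν : τ →₀ ℕ) : Tate A τ := ofPoly A τ (MvPolynomial.monomial ν 1)

lemma coeff_C [DecidableEq τ] (a : A) (ν : τ →₀ ℕ) :
    (C a : Tate A τ).coeff ν = if ν = 0 then a else 0 := by
  simp [C, MvPolynomial.coeff_C, eq_comm]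

lemma coeff_mono [DecidableEq τ] (μ ν : τ →₀ ℕ) :
    (mono μ : Tate A τ).coeff ν = if μ = ν then 1 else 0 := by
  simp [mono, MvPolynomial.coeff_monomial]

@[simp] lemma coeff_C_mul (a : A) (f : Tate A τ) (ν : τ →₀ ℕ) :
    (C a * f).coeff ν = a * f.coeff ν := by
  refine Eq.trans ?_ (MvPowerSeries.coeff_C_mul ν f.1 a)
  change MvPowerSeries.coeff ν (((MvPolynomial.C a : MvPolynomial τ A) : MvPowerSeries τ A) * f.1) = _
  rw [MvPolynomial.coe_C]

lemma norm_C_mul_le (a : A) (f : Tate A τ) : ‖C a * f‖ ≤ ‖a‖ * ‖f‖ :=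
  norm_le_of fun ν => by
    rw [coeff_C_mul]
    exact (norm_mul_le _ _).trans (by gcongr; exact f.norm_coeff_le ν)

@[simp] lemma norm_C (a : A) : ‖(C a : Tate A τ)‖ = ‖a‖ := by
  classical
  refine le_antisymm (norm_le_of fun ν => ?_) ?_
  · rw [coeff_C]; split_ifs <;> simp
  · simpa [coeff_C] using (C a : Tate A τ).norm_coeff_le 0

lemma norm_mono_le [NormOneClass A] (ν : τ →₀ ℕ) : ‖(mono ν : Tate A τ)‖ ≤ 1 := by
  classical
  refine norm_le_of fun μ => ?_
  rw [coeff_mono]; split_ifs <;> simp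

lemma mono_single (i : τ) : (mono (Finsupp.single i 1) : Tate A τ) = X i := rfl

lemma norm_X_le [NormOneClass A] (i : τ) : ‖(X i : Tate A τ)‖ ≤ 1 := norm_mono_le _

instance [NormOneClass A] : NormOneClass (Tate A τ) :=
  ⟨by rw [← map_one (C : A →+* Tate A τ), norm_C, norm_one]⟩

lemma norm_ofPoly_le {p : MvPolynomial τ A} {c : ℝ} (h : ∀ ν, ‖p.coeff ν‖ ≤ c) :
    ‖ofPoly A τ p‖ ≤ c := norm_le_of fun ν => by simpa using h ν

lemma exists_poly_norm_sub_lt (f : Tate A τ) {ε : ℝ} (hε : 0 < ε) :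
    ∃ p : MvPolynomial τ A, ‖f - ofPoly A τ p‖ < ε ∧
      ∀ ν, p.coeff ν = f.coeff ν ∨ (p.coeff ν = 0 ∧ ‖f.coeff ν‖ < ε) := by
  classical
  have h := f.tendsto_coeff.eventually (gt_mem_nhds (half_pos hε))
  rw [eventually_cofinite] at h
  let p : MvPolynomial τ A := ∑ ν ∈ h.toFinset, MvPolynomial.monomial ν (f.coeff ν)
  have hp : ∀ ν, p.coeff ν = if ν ∈ h.toFinset then f.coeff ν else 0 := fun ν => by
    simp only [p, MvPolynomial.coeff_sum, MvPolynomial.coeff_monomial]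
    simp
  refine ⟨p, lt_of_le_of_lt (norm_le_of fun ν => ?_) (half_lt_self hε), fun ν => ?_⟩
  · rw [coeff_sub, coeff_ofPoly, hp]
    split_ifs with hν
    · simpa using (half_pos hε).le
    · simp only [Set.Finite.mem_toFinset, Set.mem_ofPred_eq, not_not] at hν
      simpa using hν.le
  · rw [hp]
    split_ifs with hν
    · exact Or.inl rfl
    · simp only [Set.Finite.mem_toFinset, Set.mem_ofPred_eq, not_not] at hν
      exact Or.inr ⟨rfl, hν.trans (half_lt_self hε)⟩

lemma denseRange_ofPoly : DenseRange (ofPoly A τ) := fun f => by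
  refine Metric.mem_closure_range_iff.2 fun ε hε => ?_
  obtain ⟨p, hp, -⟩ := exists_poly_norm_sub_lt f hε
  exact ⟨p, by rwa [dist_eq_norm]⟩

lemma ringHom_ext {B : Type*} [CommRing B] [TopologicalSpace B] [T2Space B]
    {φ ψ : Tate A τ →+* B}
    (hφ : Continuous φ) (hψ : Continuous ψ) (hC : ∀ a, φ (C a) = ψ (C a))
    (hX : ∀ i, φ (X i) = ψ (X i)) : φ = ψ := by
  have h : φ.comp (ofPoly A τ) = ψ.comp (ofPoly A τ) :=
    MvPolynomial.ringHom_ext hC hX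
  have h2 := denseRange_ofPoly.equalizer hφ hψ (funext fun p => RingHom.congr_fun h p)
  exact RingHom.ext fun f => congr_fun h2 f

end Tate
end TateDef

end RigidQE
end

noncomputable section
namespace RigidQE

set_option linter.unusedSectionVars false

open Filter Topology

/-- Norm-nonincreasing ring homomorphisms. -/
structure CHom (A B : Type) [NormedCommRing A] [NormedCommRing B] extends A →+* B where
  bound' : ∀ a, ‖toRingHom a‖ ≤ ‖a‖

namespace CHom

variable {A B D : Type} [NormedCommRing A] [NormedCommRing B] [NormedCommRing D]

instance : FunLike (CHom A B) A B where
  coe φ := φ.toRingHom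
  coe_injective φ ψ h := by
    cases φ; cases ψ
    congr
    exact DFunLike.coe_injective h

instance : RingHomClass (CHom A B) A B where
  map_mul φ := φ.toRingHom.map_mul
  map_one φ := φ.toRingHom.map_one
  map_add φ := φ.toRingHom.map_add
  map_zero φ := φ.toRingHom.map_zero

lemma bound (φ : CHom A B) (a : A) : ‖φ a‖ ≤ ‖a‖ := φ.bound' a

@[ext] lemma ext {φ ψ : CHom A B} (h : ∀ a, φ a = ψ a) : φ = ψ := DFunLike.ext _ _ h

lemma continuous (φ : CHom A B) : Continuous φ :=
  AddMonoidHomClass.continuous_of_bound φ 1 (by simpa using φ.bound)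

variable (A) in
/-- The identity. -/
def id : CHom A A := ⟨RingHom.id A, fun _ => le_rfl⟩

@[simp] lemma id_apply (a : A) : id A a = a := rfl

/-- Composition. -/
def comp (ψ : CHom B D) (φ : CHom A B) : CHom A D :=
  ⟨ψ.toRingHom.comp φ.toRingHom, fun a => (ψ.bound _).trans (φ.bound a)⟩

@[simp] lemma comp_apply (ψ : CHom B D) (φ : CHom A B) (a : A) : ψ.comp φ a = ψ (φ a) := rfl

@[simp] lemma coe_toRingHom (φ : CHom A B) (a : A) : φ.toRingHom a = φ a := rfl

end CHom

/-- Families of elements of norm at most one. -/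
def Bl (B : Type) [NormedCommRing B] (τ : Type) : Type := {b : τ → B // ∀ i, ‖b i‖ ≤ 1}

instance (B : Type) [NormedCommRing B] (τ : Type) : CoeFun (Bl B τ) fun _ => τ → B :=
  ⟨Subtype.val⟩

/-- The image of a family under a norm-nonincreasing homomorphism. -/
def CHom.mapBl {A B τ : Type} [NormedCommRing A] [NormedCommRing B] (φ : CHom A B) (b : Bl A τ) :
    Bl B τ := ⟨fun i => φ (b i), fun i => (φ.bound _).trans (b.2 i)⟩

@[simp] lemma CHom.mapBl_apply {A B τ : Type} [NormedCommRing A] [NormedCommRing B]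
    (φ : CHom A B) (b : Bl A τ) (i : τ) : φ.mapBl b i = φ (b i) := rfl

section Sums

variable {B : Type*} [NormedCommRing B] [IsUltrametricDist B] [CompleteSpace B] {ι : Type*}

lemma summable_of_norm_tendsto {a : ι → B} (h : Tendsto (fun i => ‖a i‖) cofinite (𝓝 0)) :
    Summable a :=
  NonarchimedeanAddGroup.summable_of_tendsto_cofinite_zero (tendsto_zero_iff_norm_tendsto_zero.2 h)

lemma norm_tsum_le_of {a : ι → B} {c : ℝ} (hc : 0 ≤ c) (h : ∀ i, ‖a i‖ ≤ c) :
    ‖∑' i, a i‖ ≤ c := by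
  by_cases ha : Summable a
  · refine le_of_tendsto ha.hasSum.norm (Eventually.of_forall fun s => ?_)
    exact IsUltrametricDist.norm_sum_le_of_forall_le_of_nonneg hc fun i _ => h i
  · rw [tsum_eq_zero_of_not_summable ha]; simpa using hc

end Sums

namespace Tate

section Eval

variable {A B D : Type} [NormedCommRing A] [IsUltrametricDist A]
  [NormedCommRing B] [IsUltrametricDist B] [CompleteSpace B] [NormOneClass B]
  [NormedCommRing D] [IsUltrametricDist D] [CompleteSpace D] [NormOneClass D] {τ : Type}

/-- The monomial `b ^ ν`. -/
def bpow (b : τ → B) (ν : τ →₀ ℕ) : B := ν.prod fun i n => b i ^ n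

lemma norm_bpow_le (b : Bl B τ) (ν : τ →₀ ℕ) : ‖bpow b.1 ν‖ ≤ 1 := by
  unfold bpow Finsupp.prod
  refine (Finset.norm_prod_le _ _).trans (Finset.prod_le_one (fun _ _ => norm_nonneg _) ?_)
  intro i _
  exact (norm_pow_le _ _).trans (pow_le_one₀ (norm_nonneg _) (b.2 i))

lemma norm_term_le (φ : CHom A B) (b : Bl B τ) (f : Tate A τ) (ν : τ →₀ ℕ) :
    ‖φ (f.coeff ν) * bpow b.1 ν‖ ≤ ‖f.coeff ν‖ :=
  (norm_mul_le _ _).trans ((mul_le_mul (φ.bound _) (norm_bpow_le b ν) (norm_nonneg _)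
    (norm_nonneg _)).trans (by simp))

lemma summable_term (φ : CHom A B) (b : Bl B τ) (f : Tate A τ) :
    Summable fun ν => φ (f.coeff ν) * bpow b.1 ν :=
  summable_of_norm_tendsto (squeeze_zero (fun _ => norm_nonneg _)
    (norm_term_le φ b f) f.tendsto_coeff)

/-- Evaluation, as an additive map. -/
def evalAdd (φ : CHom A B) (b : Bl B τ) : Tate A τ →+ B where
  toFun f := ∑' ν, φ (f.coeff ν) * bpow b.1 ν
  map_zero' := by simp
  map_add' f g := by
    rw [← (summable_term φ b f).tsum_add (summable_term φ b g)]
    simp [add_mul]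

lemma evalAdd_bound (φ : CHom A B) (b : Bl B τ) (f : Tate A τ) : ‖evalAdd φ b f‖ ≤ ‖f‖ :=
  norm_tsum_le_of (norm_nonneg _) fun ν => (norm_term_le φ b f ν).trans (f.norm_coeff_le ν)

lemma evalAdd_continuous (φ : CHom A B) (b : Bl B τ) : Continuous (evalAdd φ b) :=
  AddMonoidHomClass.continuous_of_bound (evalAdd φ b) 1 (by simpa using evalAdd_bound φ b)

lemma evalAdd_ofPoly (φ : CHom A B) (b : Bl B τ) (p : MvPolynomial τ A) :
    evalAdd φ b (ofPoly A τ p) = MvPolynomial.eval₂ φ.toRingHom b.1 p := by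
  rw [MvPolynomial.eval₂_eq]
  change ∑' ν, φ ((ofPoly A τ p).coeff ν) * bpow b.1 ν = _
  rw [tsum_eq_sum (s := p.support)]
  · simp [bpow, Finsupp.prod]
  · intro ν hν
    simp [MvPolynomial.notMem_support_iff.1 hν]

/-- Evaluation of strictly convergent power series at a family of elements of norm at most
one. -/
def eval (φ : CHom A B) (b : Bl B τ) : CHom (Tate A τ) B where
  toFun := evalAdd φ b
  map_zero' := map_zero _
  map_add' := map_add _
  map_one' := by
    rw [← map_one (ofPoly A τ), evalAdd_ofPoly]; simp
  map_mul' f g := by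
    refine denseRange_ofPoly.induction_on₂ (p := fun f g => evalAdd φ b (f * g) =
      evalAdd φ b f * evalAdd φ b g) ?_ (fun p q => ?_) f g
    · exact isClosed_eq ((evalAdd_continuous φ b).comp continuous_mul)
        (((evalAdd_continuous φ b).comp continuous_fst).mul
          ((evalAdd_continuous φ b).comp continuous_snd))
    · rw [← map_mul, evalAdd_ofPoly, evalAdd_ofPoly, evalAdd_ofPoly]
      exact MvPolynomial.eval₂_mul _ _
  bound' := evalAdd_bound φ b

lemma eval_apply (φ : CHom A B) (b : Bl B τ) (f : Tate A τ) :
    eval φ b f = ∑' ν, φ (f.coeff ν) * bpow b.1 ν := rfl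

lemma eval_ofPoly (φ : CHom A B) (b : Bl B τ) (p : MvPolynomial τ A) :
    eval φ b (ofPoly A τ p) = MvPolynomial.eval₂ φ.toRingHom b.1 p := evalAdd_ofPoly φ b p

@[simp] lemma eval_C (φ : CHom A B) (b : Bl B τ) (a : A) : eval φ b (C a) = φ a := by
  change eval φ b (ofPoly A τ (MvPolynomial.C a)) = _
  rw [eval_ofPoly]; simp

@[simp] lemma eval_X (φ : CHom A B) (b : Bl B τ) (i : τ) : eval φ b (X i) = b i := by
  change eval φ b (ofPoly A τ (MvPolynomial.X i)) = _
  rw [eval_ofPoly]; simp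

lemma eval_mono (φ : CHom A B) (b : Bl B τ) (ν : τ →₀ ℕ) :
    eval φ b (mono ν) = bpow b.1 ν := by
  change eval φ b (ofPoly A τ (MvPolynomial.monomial ν 1)) = _
  rw [eval_ofPoly]; simp [bpow]

lemma norm_eval_le_of (φ : CHom A B) (b : Bl B τ) (f : Tate A τ) {c : ℝ} (hc : 0 ≤ c)
    (h : ∀ ν, ‖f.coeff ν‖ * ‖bpow b.1 ν‖ ≤ c) : ‖eval φ b f‖ ≤ c :=
  norm_tsum_le_of hc fun ν => (norm_mul_le _ _).trans
    (le_trans (mul_le_mul_of_nonneg_right (φ.bound _) (norm_nonneg _)) (h ν))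

lemma chom_ext {φ ψ : CHom (Tate A τ) B} (hC : ∀ a, φ (C a) = ψ (C a))
    (hX : ∀ i, φ (X i) = ψ (X i)) : φ = ψ := by
  have := ringHom_ext (φ := φ.toRingHom) (ψ := ψ.toRingHom) φ.continuous ψ.continuous hC hX
  exact CHom.ext fun a => RingHom.congr_fun this a

/-- Constants, as a norm-nonincreasing homomorphism. -/
def CC : CHom B (Tate B τ) := ⟨C, fun a => (norm_C a).le⟩

@[simp] lemma CC_apply (a : B) : (CC a : Tate B τ) = C a := rfl

variable (B τ) in
/-- The variables, as a family. -/
def XX : Bl (Tate B τ) τ := ⟨X, norm_X_le⟩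

@[simp] lemma XX_apply (i : τ) : XX B τ i = X i := rfl

/-- Change of coefficients. -/
def map (φ : CHom A B) : CHom (Tate A τ) (Tate B τ) where
  toFun f := mk (fun ν => φ (f.coeff ν))
    (squeeze_zero (fun _ => norm_nonneg _) (fun _ => φ.bound _) f.tendsto_coeff)
  map_zero' := by ext; simp
  map_add' f g := by ext; simp
  map_one' := by classical ext ν; simp [coeff_one, apply_ite φ]
  map_mul' f g := by classical ext ν; simp [coeff_mul]
  bound' f := norm_le_of fun ν => (φ.bound _).trans (f.norm_coeff_le ν)

@[simp] lemma coeff_map (φ : CHom A B) (f : Tate A τ) (ν : τ →₀ ℕ) :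
    (map φ f).coeff ν = φ (f.coeff ν) := rfl

@[simp] lemma map_C (φ : CHom A B) (a : A) : map φ (C a : Tate A τ) = C (φ a) := by
  classical ext ν; simp [coeff_C, apply_ite φ]

@[simp] lemma map_mono (φ : CHom A B) (ν : τ →₀ ℕ) :
    map φ (mono ν : Tate A τ) = mono ν := by
  classical ext μ; simp [coeff_mono, apply_ite φ]

@[simp] lemma map_X (φ : CHom A B) (i : τ) : map φ (X i : Tate A τ) = X i := map_mono φ _

/-- Additive bounded change of coefficients. -/
def mapAdd (L : A →+ B) (c : ℝ) (hL : ∀ a, ‖L a‖ ≤ c * ‖a‖) : Tate A τ →+ Tate B τ where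
  toFun f := mk (fun ν => L (f.coeff ν))
    (squeeze_zero (fun _ => norm_nonneg _) (fun _ => hL _)
      (by simpa using f.tendsto_coeff.const_mul c))
  map_zero' := by ext; simp
  map_add' f g := by ext; simp

@[simp] lemma coeff_mapAdd (L : A →+ B) (c : ℝ) (hL) (f : Tate A τ) (ν : τ →₀ ℕ) :
    (mapAdd L c hL f).coeff ν = L (f.coeff ν) := rfl

/-- Substitution of power series for the variables. -/
def sub (b : Bl (Tate B τ) τ) : CHom (Tate B τ) (Tate B τ) := eval CC b

@[simp] lemma sub_C (b : Bl (Tate B τ) τ) (a : B) : sub b (C a) = C a := by simp [sub]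
@[simp] lemma sub_X (b : Bl (Tate B τ) τ) (i : τ) : sub b (X i) = b i := by simp [sub]

end Eval

end Tate

end RigidQE
end

noncomputable section
namespace RigidQE

set_option linter.unusedSectionVars false

open Filter Topology

namespace Tate

section Translate

variable {A : Type} [NormedCommRing A] [IsUltrametricDist A] {σ τ : Type}

lemma coeff_mono_mul (μ ν : σ →₀ ℕ) (f : Tate A σ) [Decidable (μ ≤ ν)] :
    (mono μ * f).coeff ν = if μ ≤ ν then f.coeff (ν - μ) else 0 := by
  have h := MvPowerSeries.coeff_monomial_mul (R := A) ν μ f.1 1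
  rw [one_mul] at h
  refine Eq.trans ?_ (h.trans ?_)
  · change MvPowerSeries.coeff ν
      (((MvPolynomial.monomial μ (1 : A) : MvPolynomial σ A) : MvPowerSeries σ A) * f.1) = _
    rw [MvPolynomial.coe_monomial]
  · congr

/-- A variable occurring in a given monomial. -/
def someVar (μ : σ →₀ ℕ) : Option σ := by
  classical exact if h : μ = 0 then none else some (Finsupp.support_nonempty_iff.2 h).choose

lemma someVar_mem {μ : σ →₀ ℕ} {i : σ} (h : someVar μ = some i) : μ i ≠ 0 := by
  classical
  unfold someVar at h
  split_ifs at h with h0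
  have := (Finsupp.support_nonempty_iff.2 h0).choose_spec
  rw [Option.some.inj h] at this
  exact Finsupp.mem_support_iff.1 this

lemma exists_someVar {μ : σ →₀ ℕ} (h : μ ≠ 0) : ∃ i, someVar μ = some i :=
  ⟨_, dif_neg h⟩

/-- The quotient by the variable `i` of the part of `f` consisting of the monomials with
distinguished variable `i`. -/
def partQuot (i : σ) : Tate A σ →+ Tate A σ := by
  classical exact
  { toFun := fun f => mk (fun ν => if someVar (ν + Finsupp.single i 1) = some i then
        f.coeff (ν + Finsupp.single i 1) else 0) (by
      refine squeeze_zero (fun _ => norm_nonneg _) (fun ν => ?_)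
        (f.tendsto_coeff.comp (add_left_injective (Finsupp.single i 1)).tendsto_cofinite)
      simp only [Function.comp]
      split_ifs <;> simp)
    map_zero' := by ext; simp
    map_add' := fun f g => by ext; simp; split_ifs <;> simp }

lemma norm_partQuot_le (i : σ) (f : Tate A σ) : ‖partQuot i f‖ ≤ ‖f‖ :=
  norm_le_of fun ν => by
    simp only [partQuot, AddMonoidHom.coe_mk, ZeroHom.coe_mk, coeff_mk]
    split_ifs
    · exact norm_coeff_le _ _
    · simp

lemma sub_coeff_zero_eq_sum [Fintype σ] (f : Tate A σ) :
    f - C (f.coeff 0) = ∑ i, X i * partQuot i f := by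
  classical
  ext ν
  rw [coeff_sum, coeff_sub, coeff_C]
  have hterm : ∀ i, (X i * partQuot i f).coeff ν =
      if someVar ν = some i then f.coeff ν else 0 := fun i => by
    rw [← mono_single, coeff_mono_mul]
    simp only [partQuot, AddMonoidHom.coe_mk, ZeroHom.coe_mk, coeff_mk]
    by_cases h : Finsupp.single i 1 ≤ ν
    · rw [if_pos h, tsub_add_cancel_of_le h]
    · rw [if_neg h, if_neg]
      intro h2
      exact h (Finsupp.single_le_iff.2 (Nat.one_le_iff_ne_zero.2 (someVar_mem h2)))
  simp_rw [hterm]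
  by_cases hν : ν = 0
  · subst hν
    have : someVar (0 : σ →₀ ℕ) = none := dif_pos rfl
    simp [this]
  · obtain ⟨j, hj⟩ := exists_someVar hν
    simp [hj, hν]

variable [CompleteSpace A] [NormOneClass A]

/-- Evaluation at a point. -/
def pt (x : Bl A σ) : CHom (Tate A σ) A := eval (CHom.id A) x

@[simp] lemma pt_C (x : Bl A σ) (a : A) : pt x (C a) = a := by simp [pt]
@[simp] lemma pt_X (x : Bl A σ) (i : σ) : pt x (X i) = x i := by simp [pt]

/-- The variables translated by constants. -/
def shiftBl (x : Bl A σ) : Bl (Tate A σ) σ :=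
  ⟨fun i => X i + C (x i), fun i => (norm_add_le_max' _ _).trans
    (max_le (norm_X_le i) ((norm_C _).trans_le (x.2 i)))⟩

@[simp] lemma shiftBl_apply (x : Bl A σ) (i : σ) : shiftBl x i = X i + C (x i) := rfl

/-- The opposite point. -/
def negBl (x : Bl A σ) : Bl A σ := ⟨fun i => - x i, fun i => (norm_neg _).trans_le (x.2 i)⟩

@[simp] lemma negBl_apply (x : Bl A σ) (i : σ) : negBl x i = - x i := rfl

lemma sub_shift_neg (x : Bl A σ) (f : Tate A σ) :
    sub (shiftBl (negBl x)) (sub (shiftBl x) f) = f := by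
  have : (sub (shiftBl (negBl x))).comp (sub (shiftBl x)) = CHom.id _ :=
    chom_ext (by simp) (by simp)
  exact DFunLike.congr_fun this f

/-- The origin. -/
def zeroBl : Bl A σ := ⟨fun _ => 0, fun _ => by simp⟩

@[simp] lemma zeroBl_apply (i : σ) : (zeroBl : Bl A σ) i = 0 := rfl

lemma pt_zero (f : Tate A σ) : pt zeroBl f = f.coeff 0 := by
  rw [pt, eval_apply, tsum_eq_single 0]
  · simp [bpow]
  · intro ν hν
    obtain ⟨i, hi⟩ := exists_someVar hν
    have := someVar_mem hi
    rw [bpow, Finsupp.prod, Finset.prod_eq_zero (Finsupp.mem_support_iff.2 this), mul_zero]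
    simp [this]

lemma coeff_zero_shift (x : Bl A σ) (f : Tate A σ) : (sub (shiftBl x) f).coeff 0 = pt x f := by
  have : (pt zeroBl).comp (sub (shiftBl x)) = pt x := chom_ext (by simp) (by simp)
  rw [← pt_zero, ← this]; rfl

/-- The coefficients of a Taylor expansion of order one. -/
def taylorQuot (x : Bl A σ) (i : σ) : Tate A σ →+ Tate A σ :=
  ((sub (shiftBl (negBl x))).toRingHom.toAddMonoidHom.comp (partQuot i)).comp
    (sub (shiftBl x)).toRingHom.toAddMonoidHom

lemma norm_taylorQuot_le (x : Bl A σ) (i : σ) (f : Tate A σ) : ‖taylorQuot x i f‖ ≤ ‖f‖ :=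
  ((CHom.bound (sub (shiftBl (negBl x))) _).trans (norm_partQuot_le _ _)).trans
    (CHom.bound (sub (shiftBl x)) _)

lemma sub_pt_eq_sum [Fintype σ] (x : Bl A σ) (f : Tate A σ) :
    f - C (pt x f) = ∑ i, (X i - C (x i)) * taylorQuot x i f := by
  have h := congr_arg (sub (shiftBl (negBl x))) (sub_coeff_zero_eq_sum (sub (shiftBl x) f))
  rw [map_sub, sub_shift_neg, sub_C, coeff_zero_shift, map_sum] at h
  rw [h]
  refine Finset.sum_congr rfl fun i _ => ?_
  rw [map_mul, sub_X, shiftBl_apply, negBl_apply, map_neg, sub_eq_add_neg]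
  rfl

/-- The ideal generated by the coordinates centred at a point. -/
def mI (x : Bl A σ) : Ideal (Tate A σ) := Ideal.span (Set.range fun i => X i - C (x i))

lemma pt_eq_zero_of_mem_mI {x : Bl A σ} {f : Tate A σ} (hf : f ∈ mI x) : pt x f = 0 := by
  have : mI x ≤ RingHom.ker (pt x) := Ideal.span_le.2 (by rintro _ ⟨i, rfl⟩; simp)
  exact this hf

lemma sub_pt_mem_mI [Finite σ] (x : Bl A σ) (f : Tate A σ) : f - C (pt x f) ∈ mI x := by
  have := Fintype.ofFinite σ
  rw [sub_pt_eq_sum]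
  exact Ideal.sum_mem _ fun i _ => Ideal.mul_mem_right _ _ (Ideal.subset_span ⟨i, rfl⟩)

lemma mem_mI_iff [Finite σ] {x : Bl A σ} {f : Tate A σ} : f ∈ mI x ↔ pt x f = 0 :=
  ⟨pt_eq_zero_of_mem_mI, fun h => by simpa [h] using sub_pt_mem_mI x f⟩

/-- Specialisation of the coefficients at a point. -/
def spec (τ : Type) (x : Bl A σ) : CHom (Tate (Tate A σ) τ) (Tate A τ) := map (pt x)

@[simp] lemma coeff_spec (x : Bl A σ) (f : Tate (Tate A σ) τ) (ν : τ →₀ ℕ) :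
    (spec τ x f).coeff ν = pt x (f.coeff ν) := rfl

@[simp] lemma spec_C (x : Bl A σ) (a : Tate A σ) : spec τ x (C a) = C (pt x a) := map_C _ _
@[simp] lemma spec_X (x : Bl A σ) (i : τ) : spec τ x (X i) = X i := map_X _ _

lemma coeff_mem_of_mem_map {B : Type} [NormedCommRing B] [IsUltrametricDist B] {I : Ideal B}
    {f : Tate B τ} (hf : f ∈ I.map (C : B →+* Tate B τ)) (ν : τ →₀ ℕ) : f.coeff ν ∈ I := by
  classical
  induction hf using Submodule.span_induction generalizing ν with
  | mem f hf =>
    obtain ⟨a, ha, rfl⟩ := hf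
    rw [coeff_C]; split_ifs
    exacts [ha, I.zero_mem]
  | zero => simp
  | add f g _ _ hf hg => exact I.add_mem (hf ν) (hg ν)
  | smul a f _ hf =>
    rw [smul_eq_mul, coeff_mul]
    exact I.sum_mem fun p _ => I.mul_mem_left _ (hf _)

lemma mem_map_mI_of_spec [Finite σ] {x : Bl A σ} {f : Tate (Tate A σ) τ} (h : spec τ x f = 0) :
    f ∈ (mI x).map (C : Tate A σ →+* Tate (Tate A σ) τ) := by
  have := Fintype.ofFinite σ
  have key : f = ∑ i, C (X i - C (x i)) *
      mapAdd (taylorQuot x i) 1 (by simpa using norm_taylorQuot_le x i) f := by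
    ext ν : 1
    rw [coeff_sum]
    simp only [coeff_C_mul, coeff_mapAdd]
    rw [← sub_pt_eq_sum, ← coeff_spec, h]
    simp
  rw [key]
  exact Ideal.sum_mem _ fun i _ => Ideal.mul_mem_right _ _
    (Ideal.mem_map_of_mem _ (Ideal.subset_span ⟨i, rfl⟩))

lemma spec_eq_zero_of_coeff {x : Bl A σ} {f : Tate (Tate A σ) τ}
    (h : ∀ ν, f.coeff ν ∈ mI x) : spec τ x f = 0 := by
  ext ν; simpa using pt_eq_zero_of_mem_mI (h ν)

lemma spec_eq_zero_of_mem_map {x : Bl A σ} {I : Ideal (Tate A σ)} (hI : I ≤ mI x)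
    {f : Tate (Tate A σ) τ} (hf : f ∈ I.map (C : Tate A σ →+* Tate (Tate A σ) τ)) :
    spec τ x f = 0 :=
  spec_eq_zero_of_coeff fun ν => hI (coeff_mem_of_mem_map hf ν)

end Translate

section Equivs

variable {B D : Type} [NormedCommRing B] [IsUltrametricDist B] [CompleteSpace B] [NormOneClass B]
  {σ τ : Type}

/-- Inverse norm-nonincreasing homomorphisms. -/
structure _root_.RigidQE.CEquiv (A B : Type) [NormedCommRing A] [NormedCommRing B] where
  hom : CHom A B
  inv : CHom B A
  inv_hom : ∀ a, inv (hom a) = a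
  hom_inv : ∀ b, hom (inv b) = b

lemma _root_.RigidQE.CEquiv.norm_hom {A B : Type} [NormedCommRing A] [NormedCommRing B]
    (e : CEquiv A B) (a : A) : ‖e.hom a‖ = ‖a‖ :=
  le_antisymm (e.hom.bound a) (by simpa [e.inv_hom] using e.inv.bound (e.hom a))

/-- The underlying ring isomorphism. -/
def _root_.RigidQE.CEquiv.toRingEquiv {A B : Type} [NormedCommRing A] [NormedCommRing B]
    (e : CEquiv A B) : A ≃+* B :=
  { e.hom.toRingHom with
    invFun := e.inv
    left_inv := e.inv_hom
    right_inv := e.hom_inv }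

/-- Composition. -/
def _root_.RigidQE.CEquiv.trans {A B D : Type} [NormedCommRing A] [NormedCommRing B]
    [NormedCommRing D] (e : CEquiv A B) (e' : CEquiv B D) : CEquiv A D :=
  ⟨e'.hom.comp e.hom, e.inv.comp e'.inv, by simp [e.inv_hom, e'.inv_hom],
    by simp [e.hom_inv, e'.hom_inv]⟩

/-- The variables, renamed. -/
def renBl (e : σ → τ) : Bl (Tate B τ) σ := ⟨fun i => X (e i), fun i => norm_X_le _⟩

@[simp] lemma renBl_apply (e : σ → τ) (i : σ) : (renBl e : Bl (Tate B τ) σ) i = X (e i) := rfl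

lemma ren_ren (e : σ → τ) (e' : τ → σ) (h : ∀ i, e' (e i) = i) (f : Tate B σ) :
    eval CC (renBl e') (eval CC (renBl e) f) = f := by
  have : (eval CC (renBl e')).comp (eval CC (renBl e)) = CHom.id (Tate B σ) :=
    chom_ext (fun a => by simp) (fun i => by simp [h])
  exact DFunLike.congr_fun this f

variable (B) in
/-- Renaming of variables. -/
def rename (e : σ ≃ τ) : CEquiv (Tate B σ) (Tate B τ) where
  hom := eval CC (renBl e)
  inv := eval CC (renBl e.symm)
  inv_hom := ren_ren _ _ e.symm_apply_apply
  hom_inv := ren_ren _ _ e.apply_symm_apply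

/-- The variables of a Tate algebra over a Tate algebra. -/
def sumBl : Bl (Tate (Tate B σ) τ) (σ ⊕ τ) :=
  ⟨Sum.elim (fun i => C (X i)) X, by
    rintro (i | i)
    · exact (norm_C _).trans_le (norm_X_le i)
    · exact norm_X_le i⟩

@[simp] lemma sumBl_inl (i : σ) : (sumBl : Bl (Tate (Tate B σ) τ) _) (Sum.inl i) = C (X i) := rfl
@[simp] lemma sumBl_inr (i : τ) : (sumBl : Bl (Tate (Tate B σ) τ) _) (Sum.inr i) = X i := rfl

variable (B σ τ) in
/-- Separating the variables of a power series into two groups. -/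
def sumEquiv : CEquiv (Tate B (σ ⊕ τ)) (Tate (Tate B σ) τ) where
  hom := eval (CC.comp CC) sumBl
  inv := eval (eval CC (renBl Sum.inl)) (renBl Sum.inr)
  inv_hom f := by
    have : (eval (eval CC (renBl Sum.inl)) (renBl Sum.inr)).comp (eval (CC.comp CC) sumBl) =
        CHom.id (Tate B (σ ⊕ τ)) :=
      chom_ext (fun a => by simp) (by rintro (i | i) <;> simp)
    exact DFunLike.congr_fun this f
  hom_inv f := by
    have h1 : (eval (CC.comp CC) sumBl).comp (eval CC (renBl Sum.inl)) =
        (CC : CHom (Tate B σ) (Tate (Tate B σ) τ)) :=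
      chom_ext (fun a => by simp) (fun i => by simp)
    have : (eval (CC.comp CC) sumBl).comp (eval (eval CC (renBl Sum.inl)) (renBl Sum.inr)) =
        CHom.id (Tate (Tate B σ) τ) :=
      chom_ext (fun a => by simpa using DFunLike.congr_fun h1 a) (fun i => by simp)
    exact DFunLike.congr_fun this f

@[simp] lemma sumEquiv_C (b : B) : (sumEquiv B σ τ).hom (C b) = C (C b) := by simp [sumEquiv]
@[simp] lemma sumEquiv_inl (i : σ) : (sumEquiv B σ τ).hom (X (Sum.inl i)) = C (X i) := by
  simp [sumEquiv]
@[simp] lemma sumEquiv_inr (i : τ) : (sumEquiv B σ τ).hom (X (Sum.inr i)) = X i := by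
  simp [sumEquiv]
@[simp] lemma rename_C (e : σ ≃ τ) (b : B) : (rename B e).hom (C b) = C b := by simp [rename]
@[simp] lemma rename_X (e : σ ≃ τ) (i : σ) : (rename B e).hom (X i) = X (e i) := by simp [rename]

end Equivs

end Tate

end RigidQE
end

noncomputable section
namespace RigidQE

set_option linter.unusedSectionVars false

open Filter Topology

section Residue

variable {K : Type} [NormedField K] [CompleteSpace K] [IsAlgClosed K] [IsUltrametricDist K]

lemma norm_le_one_of_root {p : Polynomial K} (hm : p.Monic) (hc : ∀ i, ‖p.coeff i‖ ≤ 1) {x : K}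
    (hx : p.eval x = 0) : ‖x‖ ≤ 1 := by
  by_contra! h1
  rw [Polynomial.eval_eq_sum_range, Finset.sum_range_succ, hm.coeff_natDegree, one_mul] at hx
  have h2 : x ^ p.natDegree = -∑ i ∈ Finset.range p.natDegree, p.coeff i * x ^ i :=
    eq_neg_of_add_eq_zero_right hx
  have h3 : ‖x ^ p.natDegree‖ < ‖x‖ ^ p.natDegree := by
    rw [h2, norm_neg]
    rcases Nat.eq_zero_or_pos p.natDegree with h0 | h0
    · simp [h0]
    · refine lt_of_le_of_lt (IsUltrametricDist.norm_sum_le_of_forall_le_of_nonneg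
        (C := ‖x‖ ^ (p.natDegree - 1)) (by positivity) fun i hi => ?_)
        (pow_lt_pow_right₀ h1 (by omega))
      rw [norm_mul, norm_pow]
      refine (mul_le_of_le_one_left (by positivity) (hc i)).trans
        (pow_le_pow_right₀ h1.le ?_)
      have := Finset.mem_range.1 hi
      omega
  rw [norm_pow] at h3
  exact lt_irrefl _ h3

lemma exists_root_Ro {p : Polynomial (Ro K)} (hm : p.Monic) (hd : p.natDegree ≠ 0) :
    ∃ x : Ro K, p.eval x = 0 := by
  have hm' := hm.map (Ro K).subtype
  obtain ⟨x, hx⟩ := IsAlgClosed.exists_root (p.map (Ro K).subtype) (by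
    rw [hm.degree_map, Polynomial.degree_eq_natDegree hm.ne_zero]
    exact_mod_cast hd)
  have hx1 : ‖x‖ ≤ 1 := norm_le_one_of_root hm' (fun i => by
    rw [Polynomial.coeff_map]; exact (p.coeff i).2) hx
  refine ⟨⟨x, hx1⟩, Subtype.ext ?_⟩
  have := Polynomial.eval_map_apply (p := p) (Ro K).subtype ⟨x, hx1⟩
  exact this.symm.trans hx

lemma mem_RoMax {x : Ro K} : x ∈ RoMax K ↔ ‖(x : K)‖ < 1 := Iff.rfl

instance : (RoMax K).IsPrime where
  ne_top' := by
    rw [Ne, Ideal.eq_top_iff_one, mem_RoMax]; simp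
  mem_or_mem' := by
    intro x y h
    rw [mem_RoMax] at *
    by_contra! hc
    have hx : ‖(x : K)‖ = 1 := le_antisymm x.2 hc.1
    have hy : ‖(y : K)‖ = 1 := le_antisymm y.2 (not_lt.1 hc.2)
    simp [hx, hy] at h

instance : Infinite (Ro K ⧸ RoMax K) := by
  refine ⟨fun hfin => ?_⟩
  have := Fintype.ofFinite (Ro K ⧸ RoMax K)
  let r : Ro K ⧸ RoMax K → Ro K := Quotient.out
  have hr : ∀ a, Ideal.Quotient.mk (RoMax K) (r a) = a := fun a => Quotient.out_eq a
  let q : Polynomial (Ro K) := ∏ a, (Polynomial.X - Polynomial.C (r a))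
  have hq : q.Monic := Polynomial.monic_prod_of_monic _ _ fun a _ => Polynomial.monic_X_sub_C _
  have hqd : q.natDegree = Fintype.card (Ro K ⧸ RoMax K) := by
    rw [Polynomial.natDegree_prod_of_monic _ _ fun a _ => Polynomial.monic_X_sub_C _]
    simp
  have hq0 : 0 < q.natDegree := hqd ▸ Fintype.card_pos
  have hdeg : (1 : Polynomial (Ro K)).degree < q.degree := by
    rw [Polynomial.degree_one, Polynomial.degree_eq_natDegree hq.ne_zero]
    exact_mod_cast hq0
  obtain ⟨x, hx⟩ := exists_root_Ro (p := q + 1) (hq.add_of_left hdeg) (by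
    rw [Polynomial.natDegree_add_eq_left_of_degree_lt hdeg]; exact hq0.ne')
  have hx2 : ∏ a, (x - r a) + 1 = 0 := by
    simpa [q, Polynomial.eval_prod] using hx
  have hx3 := congr_arg (Ideal.Quotient.mk (RoMax K)) hx2
  rw [map_add, map_prod, Finset.prod_eq_zero (Finset.mem_univ (Ideal.Quotient.mk (RoMax K) x))]
    at hx3
  · simp at hx3
  · rw [map_sub, hr, sub_self]

end Residue

namespace Tate

variable {K : Type} [NormedField K] [CompleteSpace K] [IsAlgClosed K] [IsUltrametricDist K]
  {τ : Type}

lemma exists_residue_poly (f : Tate K τ) (hf : ‖f‖ = 1) : ∃ p : MvPolynomial τ (Ro K),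
    ‖f - ofPoly K τ (p.map (Ro K).subtype)‖ < 1 ∧
    p.map (Ideal.Quotient.mk (RoMax K)) ≠ 0 := by
  obtain ⟨p, hp, hp2⟩ := exists_poly_norm_sub_lt f one_pos
  have hp1 : ∀ ν, ‖p.coeff ν‖ ≤ 1 := fun ν => by
    rcases hp2 ν with h | h
    · rw [h, ← hf]; exact norm_coeff_le _ _
    · simp [h.1]
  have hmem : p ∈ (MvPolynomial.map (σ := τ) (Ro K).subtype).range := by
    rw [← SetLike.mem_coe, RingHom.coe_range, MvPolynomial.mem_range_map_iff_coeffs_subset]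
    intro a ha
    obtain ⟨ν, -, rfl⟩ := MvPolynomial.mem_coeffs_iff.1 ha
    exact ⟨⟨_, hp1 ν⟩, rfl⟩
  obtain ⟨P, hP⟩ := hmem
  have hP : P.map (Ro K).subtype = p := hP
  refine ⟨P, by rwa [hP], fun h0 => ?_⟩
  obtain ⟨ν, hν⟩ := f.exists_norm_eq
  have h1 : MvPolynomial.coeff ν (P.map (Ideal.Quotient.mk (RoMax K))) = 0 := by rw [h0]; simp
  rw [MvPolynomial.coeff_map, Ideal.Quotient.eq_zero_iff_mem, mem_RoMax] at h1
  have h2 : ((P.coeff ν : Ro K) : K) = p.coeff ν := by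
    rw [← hP, MvPolynomial.coeff_map]; rfl
  rw [h2] at h1
  rcases hp2 ν with h | h
  · rw [h, hν, hf] at h1; exact lt_irrefl _ h1
  · rw [hν, hf] at h; exact lt_irrefl _ h.2

lemma norm_pt_eq_one {f : Tate K τ} {p : MvPolynomial τ (Ro K)}
    (h : ‖f - ofPoly K τ (p.map (Ro K).subtype)‖ < 1) (z : τ → Ro K)
    (hz : MvPolynomial.eval (fun i => Ideal.Quotient.mk (RoMax K) (z i))
      (p.map (Ideal.Quotient.mk (RoMax K))) ≠ 0) :
    ‖pt (⟨fun i => z i, fun i => (z i).2⟩ : Bl K τ) f‖ = 1 := by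
  set z' : Bl K τ := ⟨fun i => z i, fun i => (z i).2⟩
  have h1 : pt z' (ofPoly K τ (p.map (Ro K).subtype)) = (MvPolynomial.eval z p : Ro K) := by
    rw [pt, eval_ofPoly, MvPolynomial.eval₂_map]
    have := MvPolynomial.eval₂_comp_left (Ro K).subtype (RingHom.id _) z p
    rw [MvPolynomial.eval, MvPolynomial.coe_eval₂Hom]
    exact this.symm
  have h2 : ‖((MvPolynomial.eval z p : Ro K) : K)‖ = 1 := by
    refine le_antisymm (MvPolynomial.eval z p).2 (not_lt.1 fun hlt => hz ?_)
    rw [← mem_RoMax, ← Ideal.Quotient.eq_zero_iff_mem] at hlt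
    rw [MvPolynomial.eval_map, ← hlt]
    have := MvPolynomial.eval₂_comp_left (Ideal.Quotient.mk (RoMax K)) (RingHom.id _) z p
    rw [MvPolynomial.eval, MvPolynomial.coe_eval₂Hom]
    exact this.symm
  have h3 : ‖pt z' (f - ofPoly K τ (p.map (Ro K).subtype))‖ < 1 := (CHom.bound _ _).trans_lt h
  rw [map_sub, h1] at h3
  have h4 := IsUltrametricDist.norm_add_eq_max_of_norm_ne_norm (x := pt z' f -
    (MvPolynomial.eval z p : Ro K)) (y := ((MvPolynomial.eval z p : Ro K) : K))
    (by rw [h2]; exact h3.ne)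
  rw [sub_add_cancel, h2, max_eq_right h3.le] at h4
  exact h4

lemma exists_pt_norm_eq_one (f g : Tate K τ) (hf : ‖f‖ = 1) (hg : ‖g‖ = 1) :
    ∃ z : Bl K τ, ‖pt z f‖ = 1 ∧ ‖pt z g‖ = 1 := by
  obtain ⟨p, hp, hp0⟩ := exists_residue_poly f hf
  obtain ⟨q, hq, hq0⟩ := exists_residue_poly g hg
  have h := mul_ne_zero hp0 hq0
  have : ∃ z, MvPolynomial.eval z (p.map (Ideal.Quotient.mk (RoMax K)) *
      q.map (Ideal.Quotient.mk (RoMax K))) ≠ 0 := by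
    by_contra! hz
    exact h (MvPolynomial.funext fun z => by simpa using hz z)
  obtain ⟨z, hz⟩ := this
  choose w hw using fun i => Ideal.Quotient.mk_surjective (z i)
  obtain rfl : (fun i => Ideal.Quotient.mk (RoMax K) (w i)) = z := funext hw
  rw [map_mul] at hz
  exact ⟨_, norm_pt_eq_one hp w (left_ne_zero_of_mul hz), norm_pt_eq_one hq w
    (right_ne_zero_of_mul hz)⟩

lemma exists_scale {f : Tate K τ} (hf : f ≠ 0) : ∃ c : K, c ≠ 0 ∧ ‖C c * f‖ = 1 ∧ ‖f‖ = ‖c‖⁻¹ := by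
  obtain ⟨ν, hν⟩ := f.exists_norm_eq
  have h0 : ‖f‖ ≠ 0 := norm_ne_zero_iff.2 hf
  have h1 : f.coeff ν ≠ 0 := by rw [← norm_ne_zero_iff, hν]; exact h0
  refine ⟨(f.coeff ν)⁻¹, inv_ne_zero h1, le_antisymm ?_ ?_, by simp [hν]⟩
  · refine (norm_C_mul_le _ _).trans ?_
    rw [norm_inv, hν, inv_mul_cancel₀ h0]
  · have := norm_coeff_le (C (f.coeff ν)⁻¹ * f) ν
    rwa [coeff_C_mul, inv_mul_cancel₀ h1, norm_one] at this

lemma exists_norm_pt_eq (f : Tate K τ) : ∃ z : Bl K τ, ‖pt z f‖ = ‖f‖ := by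
  by_cases hf : f = 0
  · exact ⟨zeroBl, by simp [hf]⟩
  obtain ⟨c, hc, h1, h2⟩ := exists_scale hf
  obtain ⟨z, hz, -⟩ := exists_pt_norm_eq_one _ _ h1 h1
  refine ⟨z, ?_⟩
  rw [map_mul, pt_C, norm_mul] at hz
  rw [h2]
  exact eq_inv_of_mul_eq_one_right hz

instance : IsDomain (Tate K τ) := by
  have : Nontrivial (Tate K τ) := ⟨0, 1, fun h => by simpa using congr_arg norm h⟩
  have : NoZeroDivisors (Tate K τ) := ⟨fun {f g} h => by
    by_contra! hc
    obtain ⟨c, hc0, hc1, -⟩ := exists_scale hc.1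
    obtain ⟨d, hd0, hd1, -⟩ := exists_scale hc.2
    obtain ⟨z, hz1, hz2⟩ := exists_pt_norm_eq_one _ _ hc1 hd1
    have h3 : pt z (C c * f) * pt z (C d * g) = 0 := by
      rw [← map_mul, mul_mul_mul_comm, h]; simp
    have := congr_arg norm h3
    rw [norm_mul, hz1, hz2] at this
    simp at this⟩
  exact NoZeroDivisors.to_isDomain _

end Tate

end RigidQE
end

noncomputable section
namespace RigidQE

set_option linter.unusedSectionVars false

open Filter Topology

/-- Unique division with remainder by `ω`, with respect to powers of `y`, with control of norms. -/
def NWD {A B : Type} [NormedCommRing A] [NormedCommRing B] (φ : CHom A B) (y ω : B) (d : ℕ) :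
    Prop :=
  (∀ b, ∃ (q : B) (r : Fin d → A), b = q * ω + ∑ j, φ (r j) * y ^ (j : ℕ)) ∧
  ∀ (q : B) (r : Fin d → A), ‖q‖ ≤ ‖q * ω + ∑ j, φ (r j) * y ^ (j : ℕ)‖ ∧
    ∀ i, ‖r i‖ ≤ ‖q * ω + ∑ j, φ (r j) * y ^ (j : ℕ)‖

lemma NWD.transfer {A B D : Type} [NormedCommRing A] [NormedCommRing B] [NormedCommRing D]
    {φ : CHom A B} {y ω : B} {d : ℕ} (h : NWD φ y ω d) (e : CEquiv D B) :
    NWD (e.inv.comp φ) (e.inv y) (e.inv ω) d := by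
  have key : ∀ (q : D) (r : Fin d → A), q * e.inv ω + ∑ j, (e.inv.comp φ) (r j) * e.inv y ^ (j : ℕ)
      = e.inv (e.hom q * ω + ∑ j, φ (r j) * y ^ (j : ℕ)) := fun q r => by
    simp [e.inv_hom]
  refine ⟨fun b => ?_, fun q r => ?_⟩
  · obtain ⟨q, r, hqr⟩ := h.1 (e.hom b)
    refine ⟨e.inv q, r, ?_⟩
    rw [key, e.hom_inv, ← hqr, e.inv_hom]
  · have hinv : ∀ b, ‖e.inv b‖ = ‖b‖ := fun b => by rw [← e.norm_hom, e.hom_inv]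
    rw [key, hinv, ← e.norm_hom q]
    exact h.2 _ r

namespace Tate

section OneVar

variable {B : Type} [NormedCommRing B] [IsUltrametricDist B]

/-- The coefficients of a power series in one variable. -/
def co (n : ℕ) (f : Tate B Unit) : B := f.coeff (Finsupp.single () n)

lemma single_eta (ν : Unit →₀ ℕ) : Finsupp.single () (ν ()) = ν := by
  ext; simp

lemma co_mul (n : ℕ) (f g : Tate B Unit) :
    co n (f * g) = ∑ p ∈ Finset.HasAntidiagonal.antidiagonal n, co p.1 f * co p.2 g := by
  classical
  rw [co, coeff_mul, Finsupp.antidiagonal_single, Finset.sum_map]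
  rfl

lemma norm_co_le (n : ℕ) (f : Tate B Unit) : ‖co n f‖ ≤ ‖f‖ := norm_coeff_le _ _

lemma exists_last_norm_eq {f : Tate B Unit} (hf : f ≠ 0) :
    ∃ n, ‖co n f‖ = ‖f‖ ∧ ∀ m, n < m → ‖co m f‖ < ‖f‖ := by
  have hpos : 0 < ‖f‖ := norm_pos_iff.2 hf
  have hfin : {ν | ¬ ‖f.coeff ν‖ < ‖f‖}.Finite :=
    eventually_cofinite.1 (f.tendsto_coeff.eventually (gt_mem_nhds hpos))
  obtain ⟨ν, hν⟩ := f.exists_norm_eq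
  obtain ⟨μ, hμ, hmax⟩ := Set.exists_max_image _ (fun ν : Unit →₀ ℕ => ν ()) hfin
    ⟨ν, by simp [hν]⟩
  refine ⟨μ (), le_antisymm (norm_co_le _ _) ?_, fun m hm => ?_⟩
  · rw [co, single_eta]; exact not_lt.1 hμ
  · by_contra hcon
    have := hmax (Finsupp.single () m) hcon
    simp at this
    omega

/-- Polynomials in one variable as power series. -/
def ofP : Polynomial B →+* Tate B Unit := Polynomial.eval₂RingHom C (X ())

lemma mono_single_pow (n : ℕ) : (mono (Finsupp.single () n) : Tate B Unit) = X () ^ n := by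
  rw [mono, X, ← map_pow, MvPolynomial.X_pow_eq_monomial]

lemma ofP_apply (p : Polynomial B) :
    ofP p = ∑ i ∈ Finset.range (p.natDegree + 1), C (p.coeff i) * X () ^ i :=
  Polynomial.eval₂_eq_sum_range _ _

lemma co_C_mul_X_pow (a : B) (n m : ℕ) :
    co m (C a * X () ^ n : Tate B Unit) = if n = m then a else 0 := by
  classical
  rw [co, coeff_C_mul, ← mono_single_pow, coeff_mono]
  have : Finsupp.single () n = Finsupp.single () m ↔ n = m := (Finsupp.single_injective ()).eq_iff
  by_cases h : n = m <;> simp [h, this]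

lemma co_sum {ι : Type*} (s : Finset ι) (f : ι → Tate B Unit) (n : ℕ) :
    co n (∑ i ∈ s, f i) = ∑ i ∈ s, co n (f i) := coeff_sum _ _ _

@[simp] lemma co_ofP (p : Polynomial B) (n : ℕ) : co n (ofP p) = p.coeff n := by
  rw [ofP_apply, co_sum]
  simp only [co_C_mul_X_pow]
  rw [Finset.sum_ite_eq']
  split_ifs with h
  · rfl
  · rw [Polynomial.coeff_eq_zero_of_natDegree_lt]
    simpa using h

lemma norm_le_of_co {f : Tate B Unit} {c : ℝ} (h : ∀ n, ‖co n f‖ ≤ c) : ‖f‖ ≤ c :=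
  norm_le_of fun ν => by rw [← single_eta ν]; exact h _

lemma co_rem (d : ℕ) (r : Fin d → B) (n : ℕ) :
    co n (∑ j, C (r j) * X () ^ (j : ℕ) : Tate B Unit) = if h : n < d then r ⟨n, h⟩ else 0 := by
  rw [co_sum]
  simp only [co_C_mul_X_pow]
  split_ifs with h
  · rw [Finset.sum_eq_single ⟨n, h⟩]
    · simp
    · intro j _ hj
      rw [if_neg]
      rintro rfl
      exact hj rfl
    · simp
  · refine Finset.sum_eq_zero fun j _ => if_neg ?_
    have := j.2
    omega

variable [CompleteSpace B] [NormOneClass B] {g : Polynomial B} {G : Tate B Unit}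

lemma norm_quot_le (hg : g.Monic) (hg1 : ∀ i, ‖g.coeff i‖ ≤ 1) (hG : ‖G - ofP g‖ < 1)
    (q : Tate B Unit) (r : Fin g.natDegree → B) :
    ‖q‖ ≤ ‖q * G + ∑ j, C (r j) * X () ^ (j : ℕ)‖ := by
  by_cases hq : q = 0
  · rw [hq, norm_zero]; exact norm_nonneg _
  have hpos : 0 < ‖q‖ := norm_pos_iff.2 hq
  obtain ⟨n, hn, hlast⟩ := exists_last_norm_eq hq
  refine le_trans (le_of_eq ?_) (norm_co_le (n + g.natDegree) _)
  have h1 : q * G + ∑ j, C (r j) * X () ^ (j : ℕ) =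
      (q * ofP g + q * (G - ofP g)) + ∑ j, C (r j) * X () ^ (j : ℕ) := by ring
  have h2 : co (n + g.natDegree) (∑ j, C (r j) * X () ^ (j : ℕ) : Tate B Unit) = 0 := by
    rw [co_rem, dif_neg (by omega)]
  have h3 : ‖co (n + g.natDegree) (q * (G - ofP g))‖ < ‖q‖ :=
    (norm_co_le _ _).trans_lt ((norm_mul_le _ _).trans_lt (by nlinarith))
  have h4 : ‖co (n + g.natDegree) (q * ofP g) - co n q‖ < ‖q‖ := by
    rw [co_mul, ← Finset.add_sum_erase _ _ (a := (n, g.natDegree))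
      (Finset.HasAntidiagonal.mem_antidiagonal.2 rfl), co_ofP, hg.coeff_natDegree, mul_one,
      add_sub_cancel_left]
    rcases ((Finset.HasAntidiagonal.antidiagonal (n + g.natDegree)).erase
      (n, g.natDegree)).eq_empty_or_nonempty with hne | hne
    · rw [hne, Finset.sum_empty, norm_zero]; exact hpos
    obtain ⟨i, hi, hi2⟩ := IsUltrametricDist.exists_norm_finsetSum_le
      ((Finset.HasAntidiagonal.antidiagonal (n + g.natDegree)).erase (n, g.natDegree))
      (fun p => co p.1 q * co p.2 (ofP g))
    refine hi2.trans_lt ?_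
    have hi := Finset.mem_erase.1 (hi hne)
    have hsum := Finset.HasAntidiagonal.mem_antidiagonal.1 hi.2
    refine (norm_mul_le _ _).trans_lt ?_
    rw [co_ofP]
    rcases lt_or_ge n i.1 with h | h
    · refine (mul_le_of_le_one_right (norm_nonneg _) (hg1 _)).trans_lt (hlast _ h)
    · have : g.natDegree < i.2 := by
        by_contra hcon
        exact hi.1 (Prod.ext (by simp; omega) (by simp; omega))
      rw [Polynomial.coeff_eq_zero_of_natDegree_lt this]
      simpa using hpos
  have hadd : ∀ f h : Tate B Unit, co (n + g.natDegree) (f + h) = co (n + g.natDegree) f +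
    co (n + g.natDegree) h := fun _ _ => rfl
  rw [h1, hadd, h2, add_zero, hadd]
  have h5 : co (n + g.natDegree) (q * ofP g) + co (n + g.natDegree) (q * (G - ofP g)) =
      co n q + ((co (n + g.natDegree) (q * ofP g) - co n q) +
        co (n + g.natDegree) (q * (G - ofP g))) := by ring
  have h6 := (IsUltrametricDist.norm_add_le_max (co (n + g.natDegree) (q * ofP g) - co n q)
    (co (n + g.natDegree) (q * (G - ofP g)))).trans_lt (max_lt h4 h3)
  rw [h5, IsUltrametricDist.norm_add_eq_max_of_norm_ne_norm (by rw [hn]; exact h6.ne'), hn,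
    max_eq_left h6.le]

lemma norm_G_le (hg1 : ∀ i, ‖g.coeff i‖ ≤ 1) (hG : ‖G - ofP g‖ < 1) : ‖G‖ ≤ 1 := by
  have := norm_add_le_max' (G - ofP g) (ofP g)
  rw [sub_add_cancel] at this
  exact this.trans (max_le hG.le (norm_le_of_co fun n => by simpa using hg1 n))

lemma norm_rem_eq (d : ℕ) (r : Fin d → B) :
    ‖(∑ j, C (r j) * X () ^ (j : ℕ) : Tate B Unit)‖ = ‖r‖ := by
  refine le_antisymm (norm_le_of_co fun n => ?_) ((pi_norm_le_iff_of_nonneg (norm_nonneg _)).2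
    fun i => ?_)
  · rw [co_rem]
    split_ifs with h
    · exact norm_le_pi_norm r _
    · simp
  · have := norm_co_le i (∑ j, C (r j) * X () ^ (j : ℕ) : Tate B Unit)
    rwa [co_rem, dif_pos i.2] at this

lemma norm_rem_le (hg : g.Monic) (hg1 : ∀ i, ‖g.coeff i‖ ≤ 1) (hG : ‖G - ofP g‖ < 1)
    (q : Tate B Unit) (r : Fin g.natDegree → B) :
    ‖r‖ ≤ ‖q * G + ∑ j, C (r j) * X () ^ (j : ℕ)‖ := by
  rw [← norm_rem_eq]
  set R : Tate B Unit := ∑ j, C (r j) * X () ^ (j : ℕ) with hR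
  have h1 := norm_quot_le hg hg1 hG q r
  rw [← hR] at h1
  have h2 := norm_add_le_max' (q * G + R) (-(q * G))
  rw [norm_neg, add_neg_cancel_comm] at h2
  refine h2.trans (max_le le_rfl ((norm_mul_le _ _).trans ?_))
  exact (mul_le_of_le_one_right (norm_nonneg _) (norm_G_le hg1 hG)).trans h1

/-- Linear combinations of a distinguished series and of a remainder. -/
def divMap (G : Tate B Unit) (d : ℕ) : Tate B Unit × (Fin d → B) →+ Tate B Unit where
  toFun p := p.1 * G + ∑ j, C (p.2 j) * X () ^ (j : ℕ)
  map_zero' := by simp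
  map_add' p q := by simp [add_mul, Finset.sum_add_distrib]; ring

lemma norm_divMap (hg : g.Monic) (hg1 : ∀ i, ‖g.coeff i‖ ≤ 1) (hG : ‖G - ofP g‖ < 1)
    (p : Tate B Unit × (Fin g.natDegree → B)) : ‖divMap G g.natDegree p‖ = ‖p‖ := by
  refine le_antisymm ?_ (max_le (norm_quot_le hg hg1 hG p.1 p.2) (norm_rem_le hg hg1 hG p.1 p.2))
  refine (norm_add_le_max' _ _).trans (max_le ?_ ?_)
  · exact (norm_mul_le _ _).trans ((mul_le_of_le_one_right (norm_nonneg _)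
      (norm_G_le hg1 hG)).trans (le_max_left _ _))
  · rw [norm_rem_eq]; exact le_max_right _ _

lemma exists_ofP_near (b : Tate B Unit) {ε : ℝ} (hε : 0 < ε) :
    ∃ p : Polynomial B, ‖b - ofP p‖ < ε := by
  obtain ⟨p, hp, -⟩ := exists_poly_norm_sub_lt b hε
  refine ⟨MvPolynomial.eval₂ Polynomial.C (fun _ => Polynomial.X) p, ?_⟩
  have key : ofP (MvPolynomial.eval₂ Polynomial.C (fun _ => Polynomial.X) p) = ofPoly B Unit p := ?_
  · rw [key]; exact hp
  refine RingHom.congr_fun (?_ : (ofP.comp (MvPolynomial.eval₂Hom Polynomial.C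
    (fun _ : Unit => Polynomial.X)) : MvPolynomial Unit B →+* Tate B Unit) = ofPoly B Unit) p
  refine MvPolynomial.ringHom_ext (fun a => ?_) (fun i => ?_)
  · simp [ofP]; rfl
  · simp [ofP]; rfl

lemma exists_divMap_near (hg : g.Monic) (hg1 : ∀ i, ‖g.coeff i‖ ≤ 1) (hG : ‖G - ofP g‖ < 1)
    (b : Tate B Unit) :
    ∃ p, ‖b - divMap G g.natDegree p‖ ≤ max ‖G - ofP g‖ 2⁻¹ * ‖b‖ := by
  by_cases hb : b = 0
  · exact ⟨0, by simp [hb]⟩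
  have hpos : 0 < ‖b‖ := norm_pos_iff.2 hb
  obtain ⟨P, hP⟩ := exists_ofP_near b (ε := 2⁻¹ * ‖b‖) (by positivity)
  have hdiv : ofP P = divMap (ofP g) g.natDegree
      (ofP (P /ₘ g), fun j => (P %ₘ g).coeff j) := by
    conv_lhs => rw [← Polynomial.modByMonic_add_div P g, add_comm, map_add, map_mul, mul_comm]
    change ofP (P /ₘ g) * ofP g + ofP (P %ₘ g) = ofP (P /ₘ g) * ofP g + _
    congr 1
    have : Nontrivial B := NormOneClass.nontrivial
    by_cases h1 : g = 1
    · subst h1; simp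
    · rw [ofP, Polynomial.coe_eval₂RingHom, Polynomial.eval₂_eq_sum_range'
        (hn := Polynomial.natDegree_modByMonic_lt P hg h1), Finset.sum_range]
  have hnormP : ‖ofP P‖ ≤ ‖b‖ := by
    have := norm_add_le_max' b (-(b - ofP P))
    rw [norm_neg, neg_sub, add_sub_cancel] at this
    exact this.trans (max_le le_rfl (hP.le.trans (by linarith)))
  have hq : ‖ofP (P /ₘ g)‖ ≤ ‖b‖ := by
    have := norm_quot_le hg hg1 (G := ofP g) (by simp) (ofP (P /ₘ g)) fun j => (P %ₘ g).coeff j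
    exact this.trans ((le_of_eq (congrArg norm hdiv.symm)).trans hnormP)
  refine ⟨(ofP (P /ₘ g), fun j => (P %ₘ g).coeff j), ?_⟩
  have hsplit : b - divMap G g.natDegree (ofP (P /ₘ g), fun j => (P %ₘ g).coeff j) =
      (b - ofP P) + -(ofP (P /ₘ g) * (G - ofP g)) := by
    rw [hdiv]
    change b - (_ + _) = (b - (_ + _)) + _
    ring
  rw [hsplit]
  refine (norm_add_le_max' _ _).trans (max_le ?_ ?_)
  · exact hP.le.trans (mul_le_mul_of_nonneg_right (le_max_right _ _) hpos.le)
  · rw [norm_neg]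
    refine (norm_mul_le _ _).trans ?_
    rw [mul_comm]
    exact mul_le_mul (le_max_left _ _) hq (norm_nonneg _) (by positivity)

lemma divMap_surjective (hg : g.Monic) (hg1 : ∀ i, ‖g.coeff i‖ ≤ 1) (hG : ‖G - ofP g‖ < 1) :
    Function.Surjective (divMap G g.natDegree) := by
  have hiso : Isometry (divMap G g.natDegree) :=
    AddMonoidHomClass.isometry_of_norm _ (norm_divMap hg hg1 hG)
  have hcl : IsClosed (Set.range (divMap G g.natDegree)) := hiso.isClosedEmbedding.isClosed_range
  intro b
  change b ∈ Set.range _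
  rw [← hcl.closure_eq, Metric.mem_closure_iff_infDist_zero (Set.range_nonempty _)]
  by_contra hD
  set D := Metric.infDist b (Set.range (divMap G g.natDegree)) with hDdef
  have hDpos : 0 < D := lt_of_le_of_ne Metric.infDist_nonneg (Ne.symm hD)
  set ε := max ‖G - ofP g‖ 2⁻¹
  have hε0 : 0 < ε := lt_max_of_lt_right (by norm_num)
  have hε1 : ε < 1 := max_lt hG (by norm_num)
  have hlt : D < D / ε := (lt_div_iff₀ hε0).2 (by nlinarith)
  obtain ⟨_, ⟨p, rfl⟩, hp⟩ := (Metric.infDist_lt_iff (Set.range_nonempty _)).1 hlt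
  obtain ⟨p', hp'⟩ := exists_divMap_near hg hg1 hG (b - divMap G g.natDegree p)
  have h1 : D ≤ ‖b - divMap G g.natDegree p - divMap G g.natDegree p'‖ := by
    rw [sub_sub, ← map_add, ← dist_eq_norm]
    exact Metric.infDist_le_dist_of_mem ⟨_, rfl⟩
  rw [dist_eq_norm, lt_div_iff₀ hε0, mul_comm] at hp
  exact absurd hp (not_lt.2 (h1.trans hp'))

lemma nwd_unit (hg : g.Monic) (hg1 : ∀ i, ‖g.coeff i‖ ≤ 1) (hG : ‖G - ofP g‖ < 1) :
    NWD (CC : CHom B (Tate B Unit)) (X ()) G g.natDegree :=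
  ⟨fun b => by
    obtain ⟨p, hp⟩ := divMap_surjective hg hg1 hG b
    exact ⟨p.1, p.2, hp.symm⟩,
  fun q r => ⟨norm_quot_le hg hg1 hG q r, fun i =>
    (norm_le_pi_norm r i).trans (norm_rem_le hg hg1 hG q r)⟩⟩

end OneVar

section Fin

variable {B : Type} [NormedCommRing B] [IsUltrametricDist B] [CompleteSpace B] [NormOneClass B]
  {n : ℕ}

variable (B n) in
/-- Separating the variable of index zero. -/
def finEquiv : CEquiv (Tate B (Fin (n + 1))) (Tate (Tate B (Fin n)) Unit) :=
  (rename B ((finSuccEquiv n).trans (Equiv.optionEquivSumPUnit _))).trans (sumEquiv B (Fin n) Unit)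

variable (B n) in
/-- Power series not involving the variable of index zero. -/
def emb : CHom (Tate B (Fin n)) (Tate B (Fin (n + 1))) := eval CC (renBl Fin.succ)

@[simp] lemma emb_C (b : B) : emb B n (C b) = C b := by simp [emb]
@[simp] lemma emb_X (i : Fin n) : emb B n (X i) = X i.succ := by simp [emb]

lemma finEquiv_X_zero : (finEquiv B n).hom (X 0) = X () := by
  simp [finEquiv, CEquiv.trans]

lemma finEquiv_emb (f : Tate B (Fin n)) : (finEquiv B n).hom (emb B n f) = C f := by
  have : (finEquiv B n).hom.comp (emb B n) = CC :=
    chom_ext (by simp [finEquiv, CEquiv.trans]) (by simp [finEquiv, CEquiv.trans])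
  exact DFunLike.congr_fun this f

lemma finEquiv_eval₂ (g : Polynomial (Tate B (Fin n))) :
    (finEquiv B n).hom (Polynomial.eval₂ (emb B n).toRingHom (X 0) g) = ofP g := by
  rw [← CHom.coe_toRingHom _ (Polynomial.eval₂ _ _ _), Polynomial.hom_eval₂, CHom.coe_toRingHom,
    finEquiv_X_zero, ofP, Polynomial.coe_eval₂RingHom]
  congr 1
  ext f : 1
  exact finEquiv_emb f

/-- Weierstrass division. -/
theorem nwd_fin {g : Polynomial (Tate B (Fin n))} (hg : g.Monic) (hg1 : ∀ i, ‖g.coeff i‖ ≤ 1)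
    {G : Tate B (Fin (n + 1))}
    (hG : ‖G - Polynomial.eval₂ (emb B n).toRingHom (X 0) g‖ < 1) :
    NWD (emb B n) (X 0) G g.natDegree := by
  have hX : (finEquiv B n).inv (X ()) = X 0 := by rw [← finEquiv_X_zero, CEquiv.inv_hom]
  have hC : ∀ f, (finEquiv B n).inv (C f) = emb B n f := fun f => by
    rw [← finEquiv_emb, CEquiv.inv_hom]
  have h := (nwd_unit hg hg1 (G := (finEquiv B n).hom G) ?_).transfer (finEquiv B n)
  · rw [hX, CEquiv.inv_hom] at h
    convert h using 1
    exact CHom.ext fun f => (hC f).symm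
  · convert hG using 1
    rw [← (finEquiv B n).norm_hom, map_sub]
    rw [finEquiv_eval₂]

end Fin

end Tate

end RigidQE
end

noncomputable section
namespace RigidQE

set_option linter.unusedSectionVars false

open Filter Topology

namespace Tate

section TopCoeff

variable {R : Type*} [CommRing R]

/-- A polynomial of degree at most `k` whose coefficient of degree `k` is `a`. -/
def TopCoeff (p : Polynomial R) (k : ℕ) (a : R) : Prop := p.natDegree ≤ k ∧ p.coeff k = a

lemma TopCoeff.mul {p q : Polynomial R} {k l : ℕ} {a b : R} (hp : TopCoeff p k a)
    (hq : TopCoeff q l b) : TopCoeff (p * q) (k + l) (a * b) :=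
  ⟨Polynomial.natDegree_mul_le.trans (add_le_add hp.1 hq.1), by
    rw [Polynomial.coeff_mul_add_eq_of_natDegree_le hp.1 hq.1, hp.2, hq.2]⟩

lemma TopCoeff.pow {p : Polynomial R} {a : R} (hp : TopCoeff p 1 a) (n : ℕ) :
    TopCoeff (p ^ n) n (a ^ n) := by
  induction n with
  | zero => exact ⟨by simp, by simp⟩
  | succ n ih => simpa only [pow_succ] using ih.mul hp

lemma TopCoeff.prod {ι : Type*} (s : Finset ι) {p : ι → Polynomial R} {k : ι → ℕ} {a : ι → R}
    (h : ∀ i, TopCoeff (p i) (k i) (a i)) :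
    TopCoeff (∏ i ∈ s, p i) (∑ i ∈ s, k i) (∏ i ∈ s, a i) := by
  classical
  induction s using Finset.induction_on with
  | empty => exact ⟨by simp, by simp⟩
  | insert i s hi ih =>
    rw [Finset.prod_insert hi, Finset.sum_insert hi, Finset.prod_insert hi]
    exact (h i).mul ih

end TopCoeff

variable {K : Type} [NormedField K] [CompleteSpace K] [IsAlgClosed K] [IsUltrametricDist K]
  {n : ℕ}

/-- The images of the variables under a linear change of coordinates. -/
def tiltBl (z : Bl K (Fin (n + 1))) : Bl (Tate K (Fin (n + 1))) (Fin (n + 1)) :=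
  ⟨Fin.cases (C (z 0) * X 0) fun j => X j.succ + C (z j.succ) * X 0, fun i => by
    have hz : ∀ i, ‖(C (z i) * X 0 : Tate K (Fin (n + 1)))‖ ≤ 1 := fun i =>
      (norm_C_mul_le _ _).trans (mul_le_one₀ (z.2 i) (norm_nonneg _) (norm_X_le _))
    refine Fin.cases (hz 0) (fun j => ?_) i
    exact (norm_add_le_max' _ _).trans (max_le (norm_X_le _) (hz _))⟩

@[simp] lemma tiltBl_zero (z : Bl K (Fin (n + 1))) : tiltBl z 0 = C (z 0) * X 0 := rfl
@[simp] lemma tiltBl_succ (z : Bl K (Fin (n + 1))) (j : Fin n) :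
    tiltBl z j.succ = X j.succ + C (z j.succ) * X 0 := rfl

/-- The parameters of the inverse change of coordinates. -/
def tiltInvBl (z : Bl K (Fin (n + 1))) (hz : ‖z 0‖ = 1) : Bl K (Fin (n + 1)) :=
  ⟨Fin.cases (z 0)⁻¹ fun j => - (z j.succ * (z 0)⁻¹), fun i => by
    refine Fin.cases ?_ (fun j => ?_) i
    · simp [hz]
    · simpa [hz] using z.2 _⟩

@[simp] lemma tiltInvBl_zero (z : Bl K (Fin (n + 1))) (hz : ‖z 0‖ = 1) :
    tiltInvBl z hz 0 = (z 0)⁻¹ := rfl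
@[simp] lemma tiltInvBl_succ (z : Bl K (Fin (n + 1))) (hz : ‖z 0‖ = 1) (j : Fin n) :
    tiltInvBl z hz j.succ = - (z j.succ * (z 0)⁻¹) := rfl

/-- A linear change of coordinates. -/
def tilt (z : Bl K (Fin (n + 1))) (hz : ‖z 0‖ = 1) :
    CEquiv (Tate K (Fin (n + 1))) (Tate K (Fin (n + 1))) where
  hom := sub (tiltBl z)
  inv := sub (tiltBl (tiltInvBl z hz))
  inv_hom f := by
    have h0 : z 0 ≠ 0 := by rw [← norm_ne_zero_iff, hz]; exact one_ne_zero
    have : (sub (tiltBl (tiltInvBl z hz))).comp (sub (tiltBl z)) = CHom.id _ := by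
      refine chom_ext (fun a => by simp) (fun i => ?_)
      refine Fin.cases ?_ (fun j => ?_) i
      · simp [map_mul, ← mul_assoc, h0, ← map_mul (C : K →+* Tate K (Fin (n + 1)))]
      · simp only [CHom.comp_apply, sub_X, tiltBl_succ, map_add, map_mul, sub_C, tiltBl_zero,
          tiltInvBl_succ, tiltInvBl_zero, CHom.id_apply, map_neg]
        ring
    exact DFunLike.congr_fun this f
  hom_inv f := by
    have h0 : z 0 ≠ 0 := by rw [← norm_ne_zero_iff, hz]; exact one_ne_zero
    have : (sub (tiltBl z)).comp (sub (tiltBl (tiltInvBl z hz))) = CHom.id _ := by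
      refine chom_ext (fun a => by simp) (fun i => ?_)
      refine Fin.cases ?_ (fun j => ?_) i
      · simp [map_mul, ← mul_assoc, h0, ← map_mul (C : K →+* Tate K (Fin (n + 1)))]
      · have h1 : (C (z 0)⁻¹ * C (z 0) : Tate K (Fin (n + 1))) = 1 := by
          rw [← map_mul, inv_mul_cancel₀ h0, map_one]
        simp only [CHom.comp_apply, sub_X, tiltBl_succ, map_add, map_mul, sub_C, tiltBl_zero,
          tiltInvBl_succ, CHom.id_apply, map_neg]
        linear_combination -(C (z j.succ) * X 0 : Tate K (Fin (n + 1))) * h1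
    exact DFunLike.congr_fun this f

/-- A linear change of coordinates, on polynomials. -/
def tiltPoly (z : Fin (n + 1) → K) :
    MvPolynomial (Fin (n + 1)) K →+* Polynomial (Tate K (Fin n)) :=
  MvPolynomial.eval₂Hom (Polynomial.C.comp C) (Fin.cases (Polynomial.C (C (z 0)) * Polynomial.X)
    fun j => Polynomial.C (X j) + Polynomial.C (C (z j.succ)) * Polynomial.X)

lemma eval_tiltPoly (z : Bl K (Fin (n + 1))) (p : MvPolynomial (Fin (n + 1)) K) :
    Polynomial.eval₂ (emb K n).toRingHom (X 0) (tiltPoly z.1 p) =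
      sub (tiltBl z) (ofPoly _ _ p) := by
  have : (Polynomial.eval₂RingHom (emb K n).toRingHom (X 0)).comp (tiltPoly z.1) =
      (sub (tiltBl z)).toRingHom.comp (ofPoly _ _) := by
    refine MvPolynomial.ringHom_ext (fun a => ?_) (fun i => ?_)
    · simp [tiltPoly]
      exact (sub_C (tiltBl z) a).symm
    · have h2 := sub_X (tiltBl z) i
      rw [X] at h2
      simp only [RingHom.comp_apply, CHom.coe_toRingHom, h2]
      refine Fin.cases ?_ (fun j => ?_) i
      · simp [tiltPoly]
      · simp [tiltPoly]
  exact RingHom.congr_fun this p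

lemma topCoeff_tiltPoly (z : Fin (n + 1) → K) (p : MvPolynomial (Fin (n + 1)) K) :
    TopCoeff (tiltPoly z p) p.totalDegree
      (C (MvPolynomial.eval z (p.homogeneousComponent p.totalDegree))) := by
  have hlin : ∀ i, TopCoeff (Fin.cases (Polynomial.C (C (z 0)) * Polynomial.X)
      (fun j => Polynomial.C (X j) + Polynomial.C (C (z j.succ)) * Polynomial.X) i :
        Polynomial (Tate K (Fin n))) 1 (C (z i)) := fun i => by
    refine Fin.cases ?_ (fun j => ?_) i
    · exact ⟨(Polynomial.natDegree_C_mul_le _ _).trans Polynomial.natDegree_X_le, by simp⟩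
    · refine ⟨?_, by simp⟩
      change (Polynomial.C _ + Polynomial.C _ * Polynomial.X).natDegree ≤ 1
      rw [add_comm]; exact Polynomial.natDegree_linear_le
  have hterm : ∀ ν : Fin (n + 1) →₀ ℕ, ∀ a : K, TopCoeff (tiltPoly z (MvPolynomial.monomial ν a))
      (∑ i, ν i) (C (a * ∏ i, z i ^ ν i)) := fun ν a => by
    have h1 := TopCoeff.prod Finset.univ fun i => (hlin i).pow (ν i)
    have h2 : TopCoeff (Polynomial.C (C a : Tate K (Fin n))) 0 (C a) := ⟨by simp, by simp⟩
    have h3 := h2.mul h1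
    rw [tiltPoly, MvPolynomial.coe_eval₂Hom, MvPolynomial.eval₂_monomial, Finsupp.prod_fintype _ _
      (by simp)]
    simpa using h3
  have hdeg : ∀ ν ∈ p.support, ∑ i, ν i ≤ p.totalDegree := fun ν hν => by
    have := MvPolynomial.le_totalDegree hν
    rwa [Finsupp.sum_fintype _ _ (by simp)] at this
  have hp : tiltPoly z p = ∑ ν ∈ p.support, tiltPoly z (MvPolynomial.monomial ν (p.coeff ν)) := by
    conv_lhs => rw [p.as_sum, map_sum]
  rw [hp]
  refine ⟨Polynomial.natDegree_sum_le_of_forall_le _ _ fun ν hν =>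
    (hterm ν _).1.trans (hdeg ν hν), ?_⟩
  rw [Polynomial.finsetSum_coeff, MvPolynomial.homogeneousComponent_apply, map_sum, map_sum,
    Finset.sum_filter]
  refine Finset.sum_congr rfl fun ν hν => ?_
  rw [Finsupp.degree_eq_sum]
  split_ifs with h
  · rw [← h, (hterm ν _).2, MvPolynomial.eval_monomial, Finsupp.prod_fintype _ _ (by simp)]
  · exact Polynomial.coeff_eq_zero_of_natDegree_lt
      ((hterm ν _).1.trans_lt (lt_of_le_of_ne (hdeg ν hν) h))

lemma exists_unit_poly {τ : Type} {f : Tate K τ} (hf : ‖f‖ = 1) :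
    ∃ p : MvPolynomial τ K, ‖f - ofPoly K τ p‖ < 1 ∧ p ≠ 0 ∧
      ∀ ν, p.coeff ν ≠ 0 → ‖p.coeff ν‖ = 1 := by
  classical
  have hfin : {ν | ¬ ‖f.coeff ν‖ < 1}.Finite :=
    eventually_cofinite.1 (f.tendsto_coeff.eventually (gt_mem_nhds one_pos))
  set p : MvPolynomial τ K := ∑ ν ∈ hfin.toFinset, MvPolynomial.monomial ν (f.coeff ν) with hp
  have hcoeff : ∀ ν, p.coeff ν = if ‖f.coeff ν‖ < 1 then 0 else f.coeff ν := fun ν => by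
    rw [hp, MvPolynomial.coeff_sum]
    simp only [MvPolynomial.coeff_monomial]
    rw [Finset.sum_ite_eq']
    simp only [Set.Finite.mem_toFinset, Set.mem_ofPred_eq]
    split_ifs <;> simp_all
  refine ⟨p, ?_, ?_, fun ν hν => ?_⟩
  · obtain ⟨ν, hν⟩ := (f - ofPoly K τ p).exists_norm_eq
    rw [← hν, coeff_sub, coeff_ofPoly, hcoeff]
    split_ifs with h
    · simpa using h
    · simp
  · obtain ⟨ν, hν⟩ := f.exists_norm_eq
    intro h0
    have h1 := hcoeff ν
    rw [h0, hν, hf, if_neg (lt_irrefl _)] at h1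
    rw [← h1] at hν
    simp [hf] at hν
  · rw [hcoeff] at hν ⊢
    split_ifs at hν ⊢ with h
    · exact absurd rfl hν
    · exact le_antisymm ((norm_coeff_le _ _).trans hf.le) (not_lt.1 h)

/-- Weierstrass preparation: after scaling, every nonzero series is regular in some direction. -/
theorem exists_nwd {f : Tate K (Fin (n + 1))} (hf : f ≠ 0) :
    ∃ (c : K) (φ : CHom (Tate K (Fin n)) (Tate K (Fin (n + 1)))) (y : Tate K (Fin (n + 1))) (d : ℕ),
      c ≠ 0 ∧ (∀ a, φ (C a) = C a) ∧ NWD φ y (C c * f) d := by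
  obtain ⟨c, hc, hc1, -⟩ := exists_scale hf
  obtain ⟨p, hp, hp0, hp2⟩ := exists_unit_poly hc1
  have hple : ‖ofPoly K (Fin (n + 1)) p‖ ≤ 1 := norm_ofPoly_le fun ν => by
    by_cases h : p.coeff ν = 0
    · simp [h]
    · exact (hp2 ν h).le
  set q := p.homogeneousComponent p.totalDegree
  have hq1 : ‖ofPoly K (Fin (n + 1)) q‖ = 1 := by
    refine le_antisymm (norm_ofPoly_le fun ν => ?_) ?_
    · rw [MvPolynomial.coeff_homogeneousComponent]
      split_ifs
      · simpa using (norm_coeff_le (ofPoly K (Fin (n + 1)) p) ν).trans hple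
      · simp
    · obtain ⟨ν, hν, hν2⟩ := Finset.exists_mem_eq_sup _ (MvPolynomial.support_nonempty.2 hp0)
        fun m : Fin (n + 1) →₀ ℕ => m.sum fun _ e => e
      have h1 := norm_coeff_le (ofPoly K (Fin (n + 1)) q) ν
      rw [coeff_ofPoly, MvPolynomial.coeff_homogeneousComponent, if_pos,
        hp2 _ (MvPolynomial.mem_support_iff.1 hν)] at h1
      · exact h1
      · rw [MvPolynomial.totalDegree, hν2]; rfl
  have hX : ‖(X 0 : Tate K (Fin (n + 1)))‖ = 1 := by
    refine le_antisymm (norm_X_le _) ?_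
    simpa [← mono_single, coeff_mono] using
      norm_coeff_le (X 0 : Tate K (Fin (n + 1))) (Finsupp.single 0 1)
  obtain ⟨z, hz1, hz0⟩ := exists_pt_norm_eq_one _ _ hq1 hX
  rw [pt_X] at hz0
  have hpt : pt z (ofPoly K (Fin (n + 1)) q) = MvPolynomial.eval z.1 q := eval_ofPoly _ _ _
  rw [hpt] at hz1
  set u := MvPolynomial.eval z.1 q
  have hu0 : u ≠ 0 := by rw [← norm_ne_zero_iff, hz1]; exact one_ne_zero
  obtain ⟨hd, htop⟩ := topCoeff_tiltPoly z.1 p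
  set g := Polynomial.C (C u⁻¹) * tiltPoly z.1 p
  have hgm : g.Monic := Polynomial.monic_of_natDegree_le_of_coeff_eq_one p.totalDegree
    ((Polynomial.natDegree_C_mul_le _ _).trans hd) (by
      rw [Polynomial.coeff_C_mul, htop, ← map_mul, inv_mul_cancel₀ hu0, map_one])
  have hg1 : ∀ i, ‖g.coeff i‖ ≤ 1 := fun i => by
    rw [Polynomial.coeff_C_mul]
    refine (norm_C_mul_le _ _).trans ?_
    rw [norm_inv, hz1, inv_one, one_mul, ← co_ofP, ← finEquiv_eval₂, eval_tiltPoly]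
    exact (norm_co_le _ _).trans (((finEquiv K n).norm_hom _).trans_le
      (((sub _).bound _).trans hple))
  have h := nwd_fin hgm hg1 (G := (tilt z hz0).hom (C (u⁻¹ * c) * f)) ?_
  · have h' := h.transfer (tilt z hz0)
    rw [CEquiv.inv_hom] at h'
    exact ⟨u⁻¹ * c, (tilt z hz0).inv.comp (emb K n), _, _, mul_ne_zero (inv_ne_zero hu0) hc,
      fun a => by simp [tilt], h'⟩
  · have h1 : Polynomial.eval₂ (emb K n).toRingHom (X 0) g =
        C u⁻¹ * (tilt z hz0).hom (ofPoly _ _ p) := by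
      rw [Polynomial.eval₂_mul, Polynomial.eval₂_C, eval_tiltPoly, CHom.coe_toRingHom, emb_C]
      rfl
    have h2 : (tilt z hz0).hom (C (u⁻¹ * c) * f) = C u⁻¹ * (tilt z hz0).hom (C c * f) := by
      simp [tilt, mul_assoc]
    rw [h1, h2, ← mul_sub, ← map_sub]
    refine (norm_C_mul_le _ _).trans_lt ?_
    rwa [norm_inv, hz1, inv_one, one_mul, CEquiv.norm_hom]

lemma _root_.RigidQE.NWD.isNoetherianRing_step {A B : Type} [NormedCommRing A] [NormedCommRing B]
    [IsNoetherianRing A] (h : ∀ f : B, f ≠ 0 → ∃ (u : B) (φ : CHom A B) (y : B) (d : ℕ),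
      IsUnit u ∧ NWD φ y (u * f) d) : IsNoetherianRing B := by
  refine isNoetherianRing_iff_ideal_fg _ |>.2 fun I => ?_
  by_cases hI : I = ⊥
  · rw [hI]; exact Submodule.fg_bot
  obtain ⟨f, hfI, hf⟩ := Submodule.exists_mem_ne_zero_of_ne_bot hI
  obtain ⟨u, φ, y, d, -, hdiv⟩ := h f hf
  have hf' : u * f ∈ I := I.mul_mem_left _ hfI
  let rem (r : Fin d → A) : B := ∑ j, φ (r j) * y ^ (j : ℕ)
  let M : Submodule A (Fin d → A) :=
    { carrier := {r | rem r ∈ I}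
      zero_mem' := by simp [rem]
      add_mem' := fun {a b} ha hb => by
        have : rem (a + b) = rem a + rem b := by simp [rem, add_mul, Finset.sum_add_distrib]
        change rem (a + b) ∈ I
        rw [this]; exact I.add_mem ha hb
      smul_mem' := fun c a ha => by
        have : rem (c • a) = φ c * rem a := by simp [rem, Finset.mul_sum, mul_assoc]
        change rem (c • a) ∈ I
        rw [this]; exact I.mul_mem_left _ ha }
  obtain ⟨s, hs⟩ := IsNoetherian.noetherian M
  classical
  refine ⟨insert (u * f) (s.image rem), le_antisymm ?_ ?_⟩
  · refine Ideal.span_le.2 fun b hb => ?_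
    rw [Finset.coe_insert, Finset.coe_image] at hb
    rcases hb with rfl | ⟨r, hr, rfl⟩
    · exact hf'
    · have : r ∈ M := hs ▸ Submodule.subset_span hr
      exact this
  · intro b hb
    obtain ⟨q, r, hqr⟩ := hdiv.1 b
    have hr : r ∈ M := by
      have : rem r = b - q * (u * f) := by rw [hqr]; simp [rem]
      change rem r ∈ I
      rw [this]; exact I.sub_mem hb (I.mul_mem_left _ hf')
    rw [hqr]
    refine Submodule.add_mem _ (Ideal.mul_mem_left _ _ (Ideal.subset_span (by simp))) ?_
    change rem r ∈ Ideal.span _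
    rw [← hs] at hr
    clear hqr
    induction hr using Submodule.span_induction with
    | mem x hx => exact Ideal.subset_span (by simp; exact Or.inr ⟨x, hx, rfl⟩)
    | zero => simp [rem]
    | add a b _ _ ha hb =>
      have : rem (a + b) = rem a + rem b := by simp [rem, add_mul, Finset.sum_add_distrib]
      rw [this]; exact Ideal.add_mem _ ha hb
    | smul c a _ ha =>
      have : rem (c • a) = φ c * rem a := by simp [rem, Finset.mul_sum, mul_assoc]
      rw [this]; exact Ideal.mul_mem_left _ _ ha

lemma coeff_zero_of_isEmpty {τ : Type} [IsEmpty τ] (f : Tate K τ) : C (f.coeff 0) = f := by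
  classical
  ext ν
  rw [Subsingleton.elim ν 0, coeff_C, if_pos rfl]

instance isNoetherianRing_fin (n : ℕ) : IsNoetherianRing (Tate K (Fin n)) := by
  induction n with
  | zero => exact isNoetherianRing_of_surjective K _ C fun f => ⟨_, coeff_zero_of_isEmpty f⟩
  | succ n ih =>
    refine NWD.isNoetherianRing_step (A := Tate K (Fin n)) fun f hf => ?_
    obtain ⟨c, φ, y, d, hc, -, h⟩ := exists_nwd hf
    exact ⟨C c, φ, y, d, (isUnit_iff_ne_zero.2 hc).map C, h⟩

instance isNoetherianRing {τ : Type} [Finite τ] : IsNoetherianRing (Tate K τ) := by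
  obtain ⟨n, ⟨e⟩⟩ := Finite.exists_equiv_fin τ
  exact isNoetherianRing_of_ringEquiv _ (rename K e.symm).toRingEquiv

instance isNoetherianRing₂ {σ τ : Type} [Finite σ] [Finite τ] :
    IsNoetherianRing (Tate (Tate K σ) τ) :=
  isNoetherianRing_of_ringEquiv _ (sumEquiv K σ τ).toRingEquiv

/-- Points of maximal ideals whose residue field is the ground field lie in the unit ball. -/
lemma norm_le_one_of_mem {τ : Type} {M : Ideal (Tate K τ)} (hM : M ≠ ⊤) {i : τ} {y : K}
    (h : X i - C y ∈ M) : ‖y‖ ≤ 1 := by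
  by_contra! hy
  have hy0 : y ≠ 0 := by rintro rfl; simp at hy; linarith
  have h1 : ‖(C y⁻¹ * X i : Tate K τ)‖ < 1 := by
    refine (norm_C_mul_le _ _).trans_lt ((mul_le_of_le_one_right (norm_nonneg _)
      (norm_X_le _)).trans_lt ?_)
    rw [norm_inv]; exact inv_lt_one_of_one_lt₀ hy
  refine hM (Ideal.eq_top_of_isUnit_mem _ (M.mul_mem_left (C (-y⁻¹)) h) ?_)
  have h2 : C (-y⁻¹) * (X i - C y) = 1 - (C y⁻¹ * X i : Tate K τ) := by
    rw [mul_sub, ← map_mul, neg_mul, inv_mul_cancel₀ hy0]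
    simp; ring
  rw [h2]
  exact (Units.oneSub _ h1).isUnit

/-- The weak Nullstellensatz, without bounds. -/
lemma exists_sub_C_mem (n : ℕ) (M : Ideal (Tate K (Fin n))) (hM : M.IsMaximal)
    (f : Tate K (Fin n)) : ∃ c : K, f - C c ∈ M := by
  induction n with
  | zero => exact ⟨f.coeff 0, by rw [coeff_zero_of_isEmpty, sub_self]; exact M.zero_mem⟩
  | succ n ih =>
    have hbot : M ≠ ⊥ := by
      rintro rfl
      have h0 : (⊥ : Ideal (Tate K (Fin (n + 1)))) = mI zeroBl := by
        refine hM.eq_of_le (fun h => ?_) bot_le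
        have h1 : (1 : Tate K (Fin (n + 1))) ∈ mI zeroBl := h ▸ Submodule.mem_top
        have := pt_eq_zero_of_mem_mI h1
        simp at this
      have h1 : X 0 ∈ (⊥ : Ideal (Tate K (Fin (n + 1)))) := by
        rw [h0, mem_mI_iff]; simp
      have h2 := congr_arg (fun f : Tate K (Fin (n + 1)) => f.coeff (Finsupp.single 0 1))
        (Ideal.mem_bot.1 h1)
      simp [← mono_single, coeff_mono] at h2
    obtain ⟨g, hgM, hg⟩ := Submodule.exists_mem_ne_zero_of_ne_bot hbot
    obtain ⟨c, φ, y, d, hc, hφC, hdiv⟩ := exists_nwd hg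
    let π : Tate K (Fin n) →+* Tate K (Fin (n + 1)) ⧸ M :=
      (Ideal.Quotient.mk M).comp φ.toRingHom
    have hfin : π.Finite := by
      algebraize [π]
      classical
      refine ⟨Finset.univ.image fun j : Fin d => (Ideal.Quotient.mk M y) ^ (j : ℕ), ?_⟩
      rw [eq_top_iff]
      rintro b -
      obtain ⟨b, rfl⟩ := Ideal.Quotient.mk_surjective b
      obtain ⟨q, r, hqr⟩ := hdiv.1 b
      have h1 : Ideal.Quotient.mk M b = ∑ j, r j • (Ideal.Quotient.mk M y) ^ (j : ℕ) := by
        rw [hqr, map_add, map_mul, Ideal.Quotient.eq_zero_iff_mem.2 (M.mul_mem_left _ hgM),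
          mul_zero, zero_add, map_sum]
        refine Finset.sum_congr rfl fun j _ => ?_
        rw [map_mul, map_pow, Algebra.smul_def]
        rfl
      rw [h1]
      exact Submodule.sum_mem _ fun j _ => Submodule.smul_mem _ _
        (Submodule.subset_span (by simp))
    have h_integral : π.IsIntegral := hfin.to_isIntegral
    have : M.IsMaximal := hM
    have hker : (RingHom.ker π).IsMaximal := by
      algebraize [π]
      have hb : (⊥ : Ideal (Tate K (Fin (n + 1)) ⧸ M)).IsMaximal :=
        (Ideal.bot_quotient_isMaximal_iff M).2 hM
      have := Ideal.isMaximal_comap_of_isIntegral_of_isMaximal (R := Tate K (Fin n))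
        (⊥ : Ideal (Tate K (Fin (n + 1)) ⧸ M)) (hI := hb)
      exact this
    let κ₀ : K →+* Tate K (Fin n) ⧸ RingHom.ker π := (Ideal.Quotient.mk _).comp C
    have hκ₀ : Function.Surjective κ₀ := fun a => by
      obtain ⟨a, rfl⟩ := Ideal.Quotient.mk_surjective a
      obtain ⟨c, hc⟩ := ih _ hker a
      exact ⟨c, (Ideal.Quotient.eq.2 hc).symm⟩
    have hlift : (RingHom.kerLift π).IsIntegral :=
      RingHom.IsIntegral.tower_top (Ideal.Quotient.mk _) _ h_integral
    have hκ := (RingHom.isIntegral_of_surjective κ₀ hκ₀).trans _ _ hlift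
    obtain ⟨c, hc⟩ := (IsAlgClosed.ringHom_bijective_of_isIntegral _ hκ).2 (Ideal.Quotient.mk M f)
    refine ⟨c, Ideal.Quotient.eq.1 (hc.symm.trans ?_)⟩
    change Ideal.Quotient.mk M (φ (C c)) = _
    rw [hφC]

/-- The weak Nullstellensatz. -/
theorem exists_mem_iff {τ : Type} [Finite τ] (M : Ideal (Tate K τ)) (hM : M.IsMaximal) :
    ∃ y : Bl K τ, ∀ f, f ∈ M ↔ pt y f = 0 := by
  obtain ⟨n, ⟨e⟩⟩ := Finite.exists_equiv_fin τ
  have key : ∀ f, ∃ c : K, f - C c ∈ M := fun f => by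
    have hM' := Ideal.comap_isMaximal_of_equiv (rename K e.symm).toRingEquiv (p := M)
    obtain ⟨c, hc⟩ := exists_sub_C_mem n _ hM' ((rename K e.symm).inv f)
    refine ⟨c, ?_⟩
    have : (rename K e.symm).hom ((rename K e.symm).inv f - C c) ∈ M := hc
    rwa [map_sub, CEquiv.hom_inv, rename_C] at this
  choose y hy using fun i => key (X i)
  refine ⟨⟨y, fun i => norm_le_one_of_mem hM.ne_top (hy i)⟩, fun f => ?_⟩
  set y' : Bl K τ := ⟨y, fun i => norm_le_one_of_mem hM.ne_top (hy i)⟩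
  have hle : mI y' ≤ M := Ideal.span_le.2 (by rintro _ ⟨i, rfl⟩; exact hy i)
  refine ⟨fun h => ?_, fun h => hle (mem_mI_iff.2 h)⟩
  by_contra h0
  have h1 : C (pt y' f) ∈ M := by
    have := M.sub_mem h (hle (sub_pt_mem_mI y' f))
    rwa [sub_sub_cancel] at this
  exact hM.ne_top (Ideal.eq_top_of_isUnit_mem _ h1 ((isUnit_iff_ne_zero.2 h0).map C))

theorem exists_mem_iff₂ {σ τ : Type} [Finite σ] [Finite τ] (M : Ideal (Tate (Tate K σ) τ))
    (hM : M.IsMaximal) : ∃ (x : Bl K σ) (y : Bl K τ), ∀ f, f ∈ M ↔ pt y (spec τ x f) = 0 := by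
  have hM' := Ideal.comap_isMaximal_of_equiv (sumEquiv K σ τ).toRingEquiv (p := M)
  obtain ⟨z, hz⟩ := exists_mem_iff _ hM'
  let x : Bl K σ := ⟨fun i => z (Sum.inl i), fun i => z.2 _⟩
  let y : Bl K τ := ⟨fun i => z (Sum.inr i), fun i => z.2 _⟩
  have hx : ∀ i, x i = z (Sum.inl i) := fun i => rfl
  have hy : ∀ i, y i = z (Sum.inr i) := fun i => rfl
  have h : ((pt y).comp (spec τ x)).comp (sumEquiv K σ τ).hom = pt z :=
    chom_ext (fun a => by simp) (by rintro (i | i) <;> simp [hx, hy])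
  refine ⟨x, y, fun f => ?_⟩
  have h1 := hz ((sumEquiv K σ τ).inv f)
  rw [← h] at h1
  simp only [CHom.comp_apply, CEquiv.hom_inv] at h1
  rw [← h1, Ideal.mem_comap]
  change _ ↔ (sumEquiv K σ τ).hom ((sumEquiv K σ τ).inv f) ∈ M
  rw [CEquiv.hom_inv]

end Tate

end RigidQE
end

noncomputable section
namespace RigidQE
set_option linter.unusedSectionVars false
open Filter Topology

section LinAlg
open Matrix

variable {R R' : Type*} [CommRing R] [CommRing R'] {a s t u : Type} [Fintype s] [Fintype t]

/-- The kernel of `Φ` is contained in the image of `Σ`. -/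
def Ex (Φ : Matrix a s R) (Sg : Matrix s t R) : Prop := ∀ w, Φ *ᵥ w = 0 → ∃ v, Sg *ᵥ v = w

lemma mulVec_mem {J : Ideal R} (M : Matrix a s R) {w : s → R} (h : ∀ j, w j ∈ J) (i : a) :
    (M *ᵥ w) i ∈ J := by
  simp only [mulVec, dotProduct]
  exact J.sum_mem fun j _ => J.mul_mem_left _ (h j)

lemma mulVec_mem_of_entries {J : Ideal R} {M : Matrix a s R} (h : ∀ i j, M i j ∈ J) (w : s → R)
    (i : a) : (M *ᵥ w) i ∈ J := by
  simp only [mulVec, dotProduct]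
  exact J.sum_mem fun j _ => J.mul_mem_right _ (h i j)

lemma map_mulVec' (φ : R →+* R') (M : Matrix a s R) (w : s → R) :
    M.map φ *ᵥ (φ ∘ w) = φ ∘ (M *ᵥ w) := by
  ext i
  simp [mulVec, dotProduct]

lemma mem_of_forall_maximal [IsNoetherianRing R] {N : Submodule R (s → R)} {w : s → R}
    (h : ∀ M : Ideal R, M.IsMaximal → (∀ r : R, r • w ∈ N → r ∈ M) →
      ∃ m ≤ M, ∀ k : ℕ, ∃ q : s → R, (∀ i, q i ∈ m ^ k) ∧ w - q ∈ N) : w ∈ N := by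
  by_contra hN
  let Q := (s → R) ⧸ N
  let w' : Q := Submodule.Quotient.mk w
  have hann : LinearMap.ker (LinearMap.toSpanSingleton R Q w') ≠ ⊤ := by
    intro htop
    have : (1 : R) ∈ LinearMap.ker (LinearMap.toSpanSingleton R Q w') := htop.ge trivial
    rw [LinearMap.mem_ker, LinearMap.toSpanSingleton_apply, one_smul,
      Submodule.Quotient.mk_eq_zero] at this
    exact hN this
  obtain ⟨M, hM, hle⟩ := Ideal.exists_le_maximal _ hann
  have hker : ∀ r : R, r • w ∈ N → r ∈ M := fun r hr => hle (by
    rw [LinearMap.mem_ker, LinearMap.toSpanSingleton_apply]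
    exact (Submodule.Quotient.mk_eq_zero N).2 hr)
  obtain ⟨m, hmM, hm⟩ := h M hM hker
  have hall : w' ∈ (⨅ i : ℕ, m ^ i • (⊤ : Submodule R Q)) := by
    rw [Submodule.mem_iInf]
    intro k
    obtain ⟨q, hq, hqN⟩ := hm k
    have h2 : w' = Submodule.Quotient.mk q := (Submodule.Quotient.eq N).2 hqN
    classical
    rw [h2, pi_eq_sum_univ q, ← Submodule.mkQ_apply, map_sum]
    refine Submodule.sum_mem _ fun i _ => ?_
    rw [map_smul]
    exact Submodule.smul_mem_smul (hq i) trivial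
  obtain ⟨r, hr⟩ := (Ideal.mem_iInf_smul_pow_eq_bot_iff _ _).1 hall
  have h1 : (1 - (r : R)) ∈ M := hker _ (by
    rw [sub_smul, one_smul, ← Submodule.Quotient.eq]
    exact hr.symm)
  have h2 := M.add_mem h1 (hmM r.2)
  rw [sub_add_cancel] at h2
  exact hM.ne_top ((Ideal.eq_top_iff_one _).2 h2)

end LinAlg

namespace Tate
open Matrix

section Fibre

variable {K : Type} [NormedField K] [CompleteSpace K] [IsAlgClosed K] [IsUltrametricDist K]
  {σ τ : Type} [Finite σ] [Finite τ] {a s t : Type} [Fintype s] [Fintype t]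

/-- The ideal of `A⟨τ⟩` generated by an ideal of `A`. -/
abbrev exI (τ : Type) {A : Type} [NormedCommRing A] [IsUltrametricDist A] (I : Ideal A) :
    Ideal (Tate A τ) := I.map C

/-- Exactness in all fibres over the zero set of `I`. -/
def FibExact (I : Ideal (Tate K σ)) (Φ : Matrix a s (Tate (Tate K σ) τ))
    (Sg : Matrix s t (Tate (Tate K σ) τ)) : Prop :=
  (∀ i j, (Φ * Sg) i j ∈ exI τ I) ∧
    ∀ x : Bl K σ, I ≤ mI x → Ex (Φ.map (spec τ x)) (Sg.map (spec τ x))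

lemma spec_map_CC (x : Bl K σ) (f : Tate K τ) : spec τ x (map CC f) = f :=
  Subtype.ext (MvPowerSeries.ext fun ν => pt_C x _)

lemma FibExact.lift_pow {I : Ideal (Tate K σ)} {Φ : Matrix a s (Tate (Tate K σ) τ)}
    {Sg : Matrix s t (Tate (Tate K σ) τ)} (h : FibExact I Φ Sg) {x : Bl K σ} (hx : I ≤ mI x)
    (k : ℕ) (J : Ideal (Tate K σ)) (hIJ : I ≤ J) (hkJ : mI x ^ k ≤ J)
    (w : s → Tate (Tate K σ) τ) (hw : ∀ i, (Φ *ᵥ w) i ∈ exI τ J) :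
    ∃ v, ∀ i, (w - Sg *ᵥ v) i ∈ exI τ J := by
  induction J using WellFoundedGT.induction generalizing w with
  | ind J ih =>
  by_cases hJ : J = ⊤
  · refine ⟨0, fun i => ?_⟩
    rw [hJ, exI, Ideal.map_top]
    trivial
  have hex : ∃ e, e ∉ J ∧ ∀ m ∈ mI x, m * e ∈ J := by
    classical
    have hk : ∃ k, mI x ^ k ≤ J := ⟨k, hkJ⟩
    have h0 : Nat.find hk ≠ 0 := fun h0 => by
      have := Nat.find_spec hk
      rw [h0, pow_zero, Ideal.one_eq_top, top_le_iff] at this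
      exact hJ this
    obtain ⟨j, hj⟩ := Nat.exists_eq_succ_of_ne_zero h0
    have h1 := Nat.find_min hk (m := j) (by omega)
    obtain ⟨e, he, he'⟩ := SetLike.not_le_iff_exists.1 h1
    refine ⟨e, he', fun m hm => Nat.find_spec hk ?_⟩
    rw [hj, Nat.succ_eq_add_one, pow_succ', ]
    exact Ideal.mul_mem_mul hm he
  obtain ⟨e, heJ, he⟩ := hex
  have hlt : J < J ⊔ Ideal.span {e} := by
    refine lt_of_le_of_ne le_sup_left fun h => heJ ?_
    rw [h]
    exact Ideal.mem_sup_right (Ideal.mem_span_singleton_self e)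
  have hmono : exI τ J ≤ exI τ (J ⊔ Ideal.span {e}) := Ideal.map_mono hlt.le
  obtain ⟨v, hv⟩ := ih _ hlt (hIJ.trans hlt.le) (hkJ.trans hlt.le) w fun i => hmono (hw i)
  have h1 : ∀ i, ∃ u, (w - Sg *ᵥ v) i - C e * u ∈ exI τ J := fun i => by
    have := hv i
    rw [exI, Ideal.map_sup, Ideal.map_span, Set.image_singleton] at this
    obtain ⟨p, hp, q, hq, hpq⟩ := Submodule.mem_sup.1 this
    obtain ⟨u, rfl⟩ := Ideal.mem_span_singleton'.1 hq
    refine ⟨u, ?_⟩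
    rw [← hpq, mul_comm u, add_sub_cancel_right]
    exact hp
  choose u hu using h1
  have h2 : ∀ i, C e * (Φ *ᵥ u) i ∈ exI τ J := fun i => by
    have e1 : C e * (Φ *ᵥ u) i = (Φ *ᵥ w) i - ((Φ * Sg) *ᵥ v) i
        - (Φ *ᵥ (w - Sg *ᵥ v - C (τ := τ) e • u)) i := by
      rw [mulVec_sub, mulVec_sub, mulVec_smul, mulVec_mulVec]
      simp
    rw [e1]
    refine Ideal.sub_mem _ (Ideal.sub_mem _ (hw i) ?_) (mulVec_mem _ hu i)
    exact mulVec_mem_of_entries (fun i j => Ideal.map_mono hIJ (h.1 i j)) _ _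
  have h3 : (Φ.map (spec τ x)) *ᵥ (spec τ x ∘ u) = 0 := by
    have := map_mulVec' (spec τ x).toRingHom Φ u
    refine this.trans (funext fun i => spec_eq_zero_of_coeff fun ν => mem_mI_iff.2 ?_)
    by_contra hne
    refine heJ ?_
    have h4 := coeff_mem_of_mem_map (h2 i) ν
    rw [coeff_C_mul] at h4
    have h5 := he _ (sub_pt_mem_mI x ((Φ *ᵥ u) i |>.coeff ν))
    have h6 := J.sub_mem h4 h5
    rw [show ∀ p q : Tate K σ, e * p - (p - q) * e = q * e from fun p q => by ring] at h6
    have h7 := J.mul_mem_left (C (pt x ((Φ *ᵥ u) i |>.coeff ν))⁻¹) h6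
    rwa [← mul_assoc, ← map_mul, inv_mul_cancel₀ hne, map_one, one_mul] at h7
  obtain ⟨v', hv'⟩ := h.2 x hx _ h3
  refine ⟨v + C (τ := τ) e • (map CC ∘ v'), fun i => ?_⟩
  have h4 : spec τ x ((u - Sg *ᵥ (map CC ∘ v')) i) = 0 := by
    have := congrFun (map_mulVec' (spec τ x).toRingHom Sg (map CC ∘ v')) i
    rw [Pi.sub_apply, map_sub]
    have h5 : (spec τ x).toRingHom ∘ (map CC ∘ v') = v' := funext fun j => spec_map_CC x _
    rw [h5] at this
    have h6 : (Sg.map (spec τ x).toRingHom *ᵥ v') i = spec τ x (u i) := congrFun hv' i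
    rw [h6] at this
    exact sub_eq_zero.2 this
  have h5 : C e * (u - Sg *ᵥ (map CC ∘ v')) i ∈ exI τ J := by
    have h6 := Ideal.mul_mem_mul (Ideal.mem_map_of_mem (C : _ →+* Tate (Tate K σ) τ)
      (Ideal.mem_span_singleton_self e)) (mem_map_mI_of_spec h4)
    rw [← Ideal.map_mul] at h6
    refine Ideal.map_mono ?_ h6
    rw [Ideal.span_singleton_mul_le_iff]
    intro m hm
    rw [mul_comm]
    exact he m hm
  have := Ideal.add_mem _ (hu i) h5
  convert this using 1
  rw [mulVec_add, mulVec_smul]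
  simp only [Pi.sub_apply, Pi.add_apply, Pi.smul_apply, smul_eq_mul]
  ring

/-- Exactness in all fibres over `V(I)` implies exactness modulo `I`. -/
theorem FibExact.lift {I : Ideal (Tate K σ)} {Φ : Matrix a s (Tate (Tate K σ) τ)}
    {Sg : Matrix s t (Tate (Tate K σ) τ)} (h : FibExact I Φ Sg)
    (w : s → Tate (Tate K σ) τ) (hw : ∀ i, (Φ *ᵥ w) i ∈ exI τ I) :
    ∃ v, ∀ i, (w - Sg *ᵥ v) i ∈ exI τ I := by
  let S := Tate (Tate K σ) τ
  let N : Submodule S (s → S) := LinearMap.range Sg.mulVecLin ⊔ Submodule.pi Set.univ fun _ => exI τ I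
  suffices hN : w ∈ N by
    obtain ⟨p, ⟨v, rfl⟩, q, hq, hpq⟩ := Submodule.mem_sup.1 hN
    refine ⟨v, fun i => ?_⟩
    have : (w - Sg *ᵥ v) = q := by rw [← hpq]; simp
    rw [this]
    exact hq i trivial
  refine mem_of_forall_maximal fun M hM hker => ?_
  obtain ⟨x, y, hxy⟩ := exists_mem_iff₂ M hM
  have hIx : I ≤ mI x := fun f hf => mem_mI_iff.2 (by
    have h1 : C f ∈ M := hker _ (Submodule.mem_sup_right fun i _ =>
      Ideal.mul_mem_right _ _ (Ideal.mem_map_of_mem _ hf))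
    simpa using (hxy _).1 h1)
  have hmM : exI τ (mI x) ≤ M := Ideal.map_le_iff_le_comap.2 fun f hf =>
    (hxy _).2 (by simp [mem_mI_iff.1 hf])
  refine ⟨_, hmM, fun k => ?_⟩
  obtain ⟨v, hv⟩ := h.lift_pow hIx k (I ⊔ mI x ^ k) le_sup_left le_sup_right w
    fun i => Ideal.map_mono le_sup_left (hw i)
  have h1 : ∀ i, ∃ p ∈ exI τ I, ∃ q ∈ exI τ (mI x) ^ k, p + q = (w - Sg *ᵥ v) i := fun i => by
    have := hv i
    rw [exI, Ideal.map_sup, Ideal.map_pow] at this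
    exact Submodule.mem_sup.1 this
  choose p hp q hq hpq using h1
  refine ⟨q, hq, ?_⟩
  have : w - q = Sg *ᵥ v + p := by
    ext1 i
    have := hpq i
    simp only [Pi.sub_apply, Pi.add_apply] at this ⊢
    linear_combination -this
  rw [this]
  exact Submodule.add_mem_sup ⟨v, rfl⟩ fun i _ => hp i

end Fibre

section Restriction

variable {K : Type} [NormedField K] [CompleteSpace K] [IsAlgClosed K] [IsUltrametricDist K]
  {τ : Type} [Fintype τ]

lemma norm_affine_le (c : K) (M : τ → K) (hc : ‖c‖ ≤ 1) (hM : ∀ j, ‖M j‖ ≤ 1) :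
    ‖(C c + ∑ j, C (M j) * X j : Tate K τ)‖ ≤ 1 := by
  refine (norm_add_le_max' _ _).trans (max_le ((norm_C _).trans_le hc) ?_)
  refine IsUltrametricDist.norm_sum_le_of_forall_le_of_nonneg zero_le_one fun j _ => ?_
  exact (norm_C_mul_le _ _).trans (mul_le_one₀ (hM j) (norm_nonneg _) (norm_X_le j))

/-- The affine substitution with constant part `c` and linear part `M`. -/
def affBl (c : Bl K τ) (M : τ → τ → K) (hM : ∀ i j, ‖M i j‖ ≤ 1) : Bl (Tate K τ) τ :=
  ⟨fun i => C (c i) + ∑ j, C (M i j) * X j, fun i => norm_affine_le _ _ (c.2 i) (hM i)⟩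

@[simp] lemma affBl_apply (c : Bl K τ) (M : τ → τ → K) (hM : ∀ i j, ‖M i j‖ ≤ 1) (i : τ) :
    affBl c M hM i = C (c i) + ∑ j, C (M i j) * X j := rfl

lemma X_sub_mem_mI (x : Bl K τ) (i : τ) : X i - C (x i) ∈ mI x := Ideal.subset_span ⟨i, rfl⟩

lemma sum_mul_sum_of_inverse {M N : τ → τ → K} {l : K} [DecidableEq τ]
    (hMN : ∀ i j, ∑ k, M i k * N k j = if i = j then l else 0) (Z : τ → Tate K τ) (i : τ) :
    ∑ j, C (M i j) * ∑ k, C (N j k) * Z k = C l * Z i := by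
  have h1 : ∀ k, ∑ j, C (M i j) * (C (N j k) * Z k) = C (if i = k then l else 0) * Z k := fun k => by
    rw [← hMN, map_sum, Finset.sum_mul]
    exact Finset.sum_congr rfl fun j _ => by rw [map_mul, mul_assoc]
  rw [Finset.sum_congr rfl fun j _ => Finset.mul_sum _ _ _, Finset.sum_comm,
    Finset.sum_congr rfl fun k _ => h1 k, Finset.sum_eq_single i]
  · rw [if_pos rfl]
  · intro k _ hk
    rw [if_neg hk.symm, map_zero, zero_mul]
  · simp

section Homothety

variable {x : Bl K τ} {h : CHom (Tate K τ) (Tate K τ)} {l : K} (hC : ∀ a, h (C a) = C a)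
  (hX : ∀ i, h (X i - C (x i)) = C l * (X i - C (x i)))
include hC hX

lemma homothety_pt (f : Tate K τ) : pt x (h f) = pt x f := by
  have : (pt x).comp h = pt x := chom_ext (fun a => by simp [hC]) fun i => by
    have := congrArg (pt x) (hX i)
    simpa [sub_eq_zero, hC] using this
  exact DFunLike.congr_fun this f

lemma homothety_sub_mem (j : ℕ) {f : Tate K τ} (hf : f ∈ mI x ^ j) :
    h f - C (l ^ j) * f ∈ mI x ^ (j + 1) := by
  have h0 : ∀ f : Tate K τ, h f - f ∈ mI x := fun f => by
    rw [mem_mI_iff, map_sub, homothety_pt hC hX, sub_self]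
  have h1 : ∀ f ∈ mI x, h f - C l * f ∈ mI x ^ 2 := fun f hf => by
    refine Submodule.span_induction (p := fun f _ => h f - C l * f ∈ mI x ^ 2) ?_ (by simp)
      (fun f g _ _ hf hg => ?_) (fun r f _ hf => ?_) hf
    · rintro _ ⟨i, rfl⟩
      rw [hX, sub_self]
      exact zero_mem _
    · rw [map_add]
      convert add_mem hf hg using 1
      ring
    · have hfm : h f - C l * f ∈ mI x ^ 2 := hf
      have h2 : (h r - r) * (C l * f) ∈ mI x ^ 2 := by
        rw [pow_two]
        exact Ideal.mul_mem_mul (h0 r) (Ideal.mul_mem_left _ _ ‹f ∈ _›)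
      convert add_mem (Ideal.mul_mem_left _ (h r) hfm) h2 using 1
      rw [smul_eq_mul, map_mul]
      ring
  have hpow : ∀ (j : ℕ) (f), f ∈ mI x ^ j → h f ∈ mI x ^ j := fun j f hf => by
    have : (mI x).map h.toRingHom ≤ mI x := by
      rw [Ideal.map_le_iff_le_comap]
      intro g hg
      rw [Ideal.mem_comap, mem_mI_iff]
      exact (homothety_pt hC hX g).trans (mem_mI_iff.1 hg)
    have h2 := Ideal.mem_map_of_mem h.toRingHom hf
    rw [Ideal.map_pow] at h2
    exact Ideal.pow_right_mono this j h2
  induction j generalizing f with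
  | zero => simpa using h0 f
  | succ j ih =>
    rw [pow_succ'] at hf
    refine Submodule.mul_induction_on hf (fun m hm g hg => ?_) (fun f g hf hg => ?_)
    · have e1 := Ideal.mul_mem_mul (h1 m hm) (hpow j g hg)
      have e2 := Ideal.mul_mem_mul (Ideal.mul_mem_left _ (C l) hm) (ih hg)
      rw [← pow_add] at e1
      rw [← pow_succ'] at e2
      rw [show j + 1 + 1 = 2 + j by ring]
      rw [show j + 1 + 1 = 2 + j by ring] at e2
      convert add_mem e1 e2 using 1
      rw [map_mul, pow_succ, map_mul]
      ring
    · convert add_mem hf hg using 1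
      rw [map_add]
      ring

lemma mem_of_homothety_mem (hl : l ≠ 0) (k : ℕ) {f : Tate K τ} (hf : h f ∈ mI x ^ k) :
    f ∈ mI x ^ k := by
  suffices ∀ j ≤ k, f ∈ mI x ^ j from this k le_rfl
  intro j
  induction j with
  | zero => simp
  | succ j ih =>
    intro hj
    have h1 := sub_mem (Ideal.pow_le_pow_right hj hf) (homothety_sub_mem hC hX j (ih (by omega)))
    rw [sub_sub_cancel] at h1
    have h2 := Ideal.mul_mem_left _ (C (l ^ j)⁻¹) h1
    rwa [← mul_assoc, ← map_mul, inv_mul_cancel₀ (pow_ne_zero _ hl), map_one, one_mul] at h2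

end Homothety

variable {a s t : Type} [Fintype s] [Fintype t]

/-- Exactness over `K⟨τ⟩` is preserved by restriction to an affinely embedded polydisc. -/
theorem Ex.restrict [Finite a] {Φ : Matrix a s (Tate K τ)} {Sg : Matrix s t (Tate K τ)}
    (hex : Ex Φ Sg)
    {c : Bl K τ} {M N : τ → τ → K} (hM : ∀ i j, ‖M i j‖ ≤ 1) (hN : ∀ i j, ‖N i j‖ ≤ 1) {l : K}
    (hl : l ≠ 0) [DecidableEq τ] (hMN : ∀ i j, ∑ k, M i k * N k j = if i = j then l else 0)
    (hNM : ∀ i j, ∑ k, N i k * M k j = if i = j then l else 0) :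
    Ex (Φ.map (sub (affBl c M hM))) (Sg.map (sub (affBl c M hM))) := by
  intro w hw
  set φ := sub (affBl c M hM) with hφ
  change w ∈ LinearMap.range (Sg.map φ).mulVecLin
  refine mem_of_forall_maximal fun P hP _ => ?_
  obtain ⟨y, hy⟩ := exists_mem_iff P hP
  refine ⟨mI y, fun f hf => (hy f).2 (mem_mI_iff.1 hf), fun k => ?_⟩
  let x : Bl K τ := ((pt y).comp φ).mapBl (XX K τ)
  have hx : ∀ i, x i = c i + ∑ j, M i j * y j := fun i => by simp [x, hφ]
  have hptx : ∀ f, pt y (φ f) = pt x f := fun f => by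
    have : (pt y).comp φ = pt x := chom_ext (fun a => by simp [hφ]) fun i => by simp [hφ, hx]
    exact DFunLike.congr_fun this f
  have hφX : ∀ i, φ (X i - C (x i)) = ∑ j, C (M i j) * (X j - C (y j)) := fun i => by
    simp only [hφ, map_sub, sub_X, sub_C, affBl_apply, hx, map_add, map_sum, map_mul, mul_sub,
      Finset.sum_sub_distrib]
    ring
  have hmap : (mI x).map φ.toRingHom = mI y := by
    apply le_antisymm
    · rw [Ideal.map_le_iff_le_comap]
      intro f hf
      exact mem_mI_iff.2 ((hptx f).trans (mem_mI_iff.1 hf))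
    · refine Ideal.span_le.2 ?_
      rintro _ ⟨i, rfl⟩
      have h1 : C l * (X i - C (y i)) = ∑ j, C (N i j) * φ (X j - C (x j)) := by
        rw [Finset.sum_congr rfl fun j _ => by rw [hφX j]]
        exact (sum_mul_sum_of_inverse hNM (fun k => X k - C (y k)) i).symm
      have h2 : C l * (X i - C (y i)) ∈ (mI x).map φ.toRingHom := by
        rw [h1]
        exact Ideal.sum_mem _ fun j _ => Ideal.mul_mem_left _ _
          (Ideal.mem_map_of_mem φ.toRingHom (X_sub_mem_mI x j))
      have h3 := Ideal.mul_mem_left _ (C l⁻¹) h2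
      rwa [← mul_assoc, ← map_mul, inv_mul_cancel₀ hl, map_one, one_mul] at h3
  have hmapk : ∀ k, (mI x ^ k).map φ.toRingHom = mI y ^ k := fun k => by
    rw [Ideal.map_pow, hmap]
  have hstep : ∀ (k : ℕ) (f), f ∈ mI y ^ k → ∃ g, f - φ g ∈ mI y ^ (k + 1) := fun k f hf => by
    rw [← hmapk k] at hf
    refine Submodule.span_induction (p := fun f _ => ∃ g, f - φ g ∈ mI y ^ (k + 1)) ?_
      ⟨0, by simp⟩ ?_ ?_ hf
    · rintro _ ⟨g, _, rfl⟩
      exact ⟨g, by simp⟩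
    · rintro f g _ _ ⟨f', hf'⟩ ⟨g', hg'⟩
      exact ⟨f' + g', by rw [map_add, add_sub_add_comm]; exact add_mem hf' hg'⟩
    · rintro r f hf ⟨g, hg⟩
      refine ⟨C (pt y r) * g, ?_⟩
      have hf' : f ∈ mI y ^ k := by rw [← hmapk k]; exact hf
      have h1 := Ideal.mul_mem_mul (sub_pt_mem_mI y r) hf'
      rw [← pow_succ'] at h1
      convert add_mem h1 (Ideal.mul_mem_left _ (C (pt y r)) hg) using 1
      rw [map_mul, hφ, sub_C, smul_eq_mul]
      ring
  have hdense : ∀ (k : ℕ) (f : Tate K τ), ∃ g, f - φ g ∈ mI y ^ k := fun k f => by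
    induction k with
    | zero => exact ⟨0, by simp⟩
    | succ k ih =>
      obtain ⟨g, hg⟩ := ih
      obtain ⟨g', hg'⟩ := hstep k _ hg
      exact ⟨g + g', by rwa [map_add, ← sub_sub]⟩
  let ψ : CHom (Tate K τ) (Tate K τ) := sub (affBl ⟨fun i => y i - ∑ j, N i j * x j, fun i => by
    change ‖y i - ∑ j, N i j * x j‖ ≤ 1
    rw [sub_eq_add_neg]
    refine (IsUltrametricDist.norm_add_le_max _ _).trans (max_le (y.2 i) ?_)
    rw [norm_neg]
    refine IsUltrametricDist.norm_sum_le_of_forall_le_of_nonneg zero_le_one fun j _ => ?_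
    rw [norm_mul]
    exact mul_le_one₀ (hN i j) (norm_nonneg _) (x.2 j)⟩ N hN)
  have hψX : ∀ i, ψ (X i - C (y i)) = ∑ j, C (N i j) * (X j - C (x j)) := fun i => by
    have : ψ (X i) = C (y i - ∑ j, N i j * x j) + ∑ j, C (N i j) * X j := sub_X _ _
    simp only [map_sub, this, ψ, sub_C, map_sum, map_mul, mul_sub, Finset.sum_sub_distrib]
    ring
  have hC : ∀ a, (ψ.comp φ) (C a) = C a := fun a => by simp [ψ, hφ]
  have hX : ∀ i, (ψ.comp φ) (X i - C (x i)) = C l * (X i - C (x i)) := fun i => by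
    have hψC : ∀ a, ψ (C a) = C a := fun a => sub_C _ _
    rw [CHom.comp_apply, hφX, map_sum]
    rw [Finset.sum_congr rfl fun j _ => by rw [map_mul, hψC, hψX j]]
    exact sum_mul_sum_of_inverse hMN (fun k => X k - C (x k)) i
  have hpull : ∀ (k : ℕ) (f), φ f ∈ mI y ^ k → f ∈ mI x ^ k := fun k f hf => by
    refine mem_of_homothety_mem hC hX hl k ?_
    have h1 : (mI y).map ψ.toRingHom ≤ mI x := Ideal.map_le_iff_le_comap.2 <| Ideal.span_le.2 <| by
      rintro _ ⟨i, rfl⟩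
      change ψ _ ∈ mI x
      rw [hψX]
      exact Ideal.sum_mem _ fun j _ => Ideal.mul_mem_left _ _ (X_sub_mem_mI x j)
    have h2 := Ideal.mem_map_of_mem ψ.toRingHom hf
    rw [Ideal.map_pow] at h2
    exact Ideal.pow_right_mono h1 k h2
  obtain ⟨r, hr⟩ := (mI x).exists_pow_inf_eq_pow_smul (LinearMap.range Φ.mulVecLin)
  choose w0 hw0 using fun i => hdense (k + r) (w i)
  have h1 : ∀ i, (Φ *ᵥ w0) i ∈ mI x ^ (k + r) := fun i => by
    apply hpull
    have e1 : φ ((Φ *ᵥ w0) i) = - (Φ.map φ *ᵥ (w - φ ∘ w0)) i := by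
      rw [mulVec_sub, hw]
      have := congrFun (map_mulVec' φ.toRingHom Φ w0) i
      simp only [zero_sub, Pi.neg_apply, neg_neg]
      exact this.symm
    rw [e1]
    exact neg_mem (mulVec_mem _ hw0 i)
  have h2 : Φ *ᵥ w0 ∈ mI x ^ (k + r) • ⊤ ⊓ LinearMap.range Φ.mulVecLin := by
    refine ⟨?_, ⟨w0, rfl⟩⟩
    classical
    cases nonempty_fintype a
    rw [SetLike.mem_coe, pi_eq_sum_univ (Φ *ᵥ w0)]
    exact Submodule.sum_mem _ fun i _ => Submodule.smul_mem_smul (h1 i) trivial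
  rw [hr _ (by omega), Nat.add_sub_cancel] at h2
  have h3 : Φ *ᵥ w0 ∈ (mI x ^ k • (⊤ : Submodule (Tate K τ) (s → Tate K τ))).map Φ.mulVecLin := by
    rw [Submodule.map_smul'', Submodule.map_top]
    exact Submodule.smul_mono le_rfl inf_le_right h2
  obtain ⟨u, hu, huw⟩ := h3
  have hu' : ∀ i, u i ∈ mI x ^ k := fun i => by
    have := Submodule.mem_map_of_mem (f := LinearMap.proj (R := Tate K τ)
      (φ := fun _ : s => Tate K τ) i) hu
    rw [Submodule.map_smul''] at this
    have h5 := Submodule.smul_mono (le_refl (mI x ^ k)) le_top this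
    rw [smul_eq_mul, Ideal.mul_top] at h5
    exact h5
  obtain ⟨v, hv⟩ := hex (w0 - u) (by rw [mulVec_sub, sub_eq_zero]; exact huw.symm)
  refine ⟨w - Sg.map φ *ᵥ (φ ∘ v), fun i => ?_, ⟨φ ∘ v, by simp⟩⟩
  have h4 : (Sg.map φ *ᵥ (φ ∘ v)) i = φ (w0 i - u i) := by
    have := congrFun (map_mulVec' φ.toRingHom Sg v) i
    rw [hv] at this
    exact this
  have h5 : φ (u i) ∈ mI y ^ k := by
    rw [← hmapk k]
    exact Ideal.mem_map_of_mem φ.toRingHom (hu' i)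
  rw [Pi.sub_apply, h4, map_sub, ← sub_add]
  exact add_mem (Ideal.pow_le_pow_right (Nat.le_add_right k r) (hw0 i)) h5

end Restriction

end Tate
end RigidQE
end

noncomputable section
namespace RigidQE
set_option linter.unusedSectionVars false
open Filter Topology

section WeierstrassDivision
open Matrix

/-- Unique division with remainder by `ω`: remainders are polynomials of degree `< d` in `y`. -/
def WD {A B : Type*} [CommRing A] [CommRing B] (φ : A →+* B) (y ω : B) (d : ℕ) : Prop :=
  ∀ b : B, ∃! p : B × (Fin d → A), b = p.1 * ω + ∑ j, φ (p.2 j) * y ^ (j : ℕ)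

lemma NWD.wd {A B : Type} [NormedCommRing A] [NormedCommRing B] {φ : CHom A B} {y ω : B} {d : ℕ}
    (h : NWD φ y ω d) : WD φ.toRingHom y ω d := by
  intro b
  obtain ⟨q, r, hqr⟩ := h.1 b
  refine ⟨(q, r), hqr, ?_⟩
  rintro ⟨q', r'⟩ h'
  have h1 := h.2 (q' - q) (r' - r)
  have h2 : (q' - q) * ω + ∑ j, φ ((r' - r) j) * y ^ (j : ℕ) = 0 := by
    have e : q' * ω + ∑ j, φ (r' j) * y ^ (j : ℕ) = q * ω + ∑ j, φ (r j) * y ^ (j : ℕ) :=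
      h'.symm.trans hqr
    simp only [Pi.sub_apply, map_sub, sub_mul, Finset.sum_sub_distrib]
    linear_combination e
  rw [h2, norm_zero] at h1
  have e1 : q' = q := sub_eq_zero.1 (norm_le_zero_iff.1 h1.1)
  have e2 : r' = r := funext fun i => sub_eq_zero.1 (norm_le_zero_iff.1 (h1.2 i))
  rw [e1, e2]

namespace WD

variable {A B A' B' : Type*} [CommRing A] [CommRing B] [CommRing A'] [CommRing B']
  {φ : A →+* B} {y ω : B} {d : ℕ} (h : WD φ y ω d)

/-- The remainder. -/
def red (h : WD φ y ω d) (b : B) : Fin d → A := (h b).choose.2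

/-- The quotient. -/
def quo (h : WD φ y ω d) (b : B) : B := (h b).choose.1

include h

lemma eq_quo_add (b : B) : b = h.quo b * ω + ∑ j, φ (h.red b j) * y ^ (j : ℕ) :=
  (h b).choose_spec.1

lemma red_eq {b q : B} {r : Fin d → A} (e : b = q * ω + ∑ j, φ (r j) * y ^ (j : ℕ)) :
    h.red b = r := (congrArg Prod.snd ((h b).choose_spec.2 (q, r) e)).symm

lemma eq_zero_of_mul {b : B} (hb : b * ω = 0) : b = 0 := by
  obtain ⟨p, _, hp⟩ := h 0
  have h1 := hp (b, 0) (by simp [hb])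
  have h2 := hp (0, 0) (by simp)
  exact congrArg Prod.fst (h1.trans h2.symm)

lemma red_add (b c : B) : h.red (b + c) = h.red b + h.red c :=
  h.red_eq (q := h.quo b + h.quo c) (by
    conv_lhs => rw [h.eq_quo_add b, h.eq_quo_add c]
    simp only [Pi.add_apply, map_add, add_mul, Finset.sum_add_distrib]
    ring)

lemma red_mul (a : A) (b : B) : h.red (φ a * b) = a • h.red b :=
  h.red_eq (q := φ a * h.quo b) (by
    conv_lhs => rw [h.eq_quo_add b]
    simp only [Pi.smul_apply, smul_eq_mul, map_mul, mul_add, Finset.mul_sum, mul_assoc])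

lemma red_mul_omega (b : B) : h.red (b * ω) = 0 := h.red_eq (q := b) (by simp)

lemma red_lift (r : Fin d → A) : h.red (∑ j, φ (r j) * y ^ (j : ℕ)) = r :=
  h.red_eq (q := 0) (by simp)

/-- The remainder as an additive map. -/
def redHom : B →+ (Fin d → A) := AddMonoidHom.mk' h.red h.red_add

lemma red_sum {ι : Type*} (s : Finset ι) (f : ι → B) : h.red (∑ i ∈ s, f i) = ∑ i ∈ s, h.red (f i) :=
  map_sum h.redHom f s

lemma red_natural {φ' : A' →+* B'} {y' ω' : B'} (h' : WD φ' y' ω' d)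
    (α : A →+* A') (β : B →+* B') (hφ : ∀ a, β (φ a) = φ' (α a)) (hy : β y = y') (hω : β ω = ω')
    (b : B) : h'.red (β b) = α ∘ h.red b :=
  h'.red_eq (q := β (h.quo b)) (by
    conv_lhs => rw [h.eq_quo_add b]
    simp [hφ, hy, hω])

/-- The matrix of multiplication by `b` on remainders. -/
def mulMat (b : B) : Matrix (Fin d) (Fin d) A := Matrix.of fun i j => h.red (b * y ^ (j : ℕ)) i

lemma red_mul_eq (b c : B) : h.red (b * c) = h.mulMat b *ᵥ h.red c := by
  have e : b * c = (b * h.quo c) * ω + ∑ j, φ (h.red c j) * (b * y ^ (j : ℕ)) := by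
    conv_lhs => rw [h.eq_quo_add c]
    rw [mul_add, Finset.mul_sum, mul_assoc]
    congr 1
    exact Finset.sum_congr rfl fun j _ => by ring
  conv_lhs => rw [e]
  rw [red_add, red_mul_omega, zero_add, red_sum]
  ext i
  rw [Finset.sum_apply]
  simp only [mulVec, dotProduct, mulMat, of_apply, red_mul, Pi.smul_apply, smul_eq_mul]
  exact Finset.sum_congr rfl fun j _ => mul_comm _ _

variable {a s t : Type} [Fintype s] [Fintype t]

/-- The block matrix of a matrix acting on remainders. -/
def blk (Φ : Matrix a s B) : Matrix (a × Fin d) (s × Fin d) A :=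
  Matrix.of fun p q => h.mulMat (Φ p.1 q.1) p.2 q.2

/-- Remainders of a vector. -/
def redv (w : s → B) : s × Fin d → A := fun p => h.red (w p.1) p.2

/-- The vector of polynomials with given coefficients. -/
def liftv (_h : WD φ y ω d) (v : s × Fin d → A) : s → B := fun i => ∑ j, φ (v (i, j)) * y ^ (j : ℕ)

lemma redv_liftv (v : s × Fin d → A) : h.redv (h.liftv v) = v :=
  funext fun p => congrFun (h.red_lift fun j => v (p.1, j)) p.2

lemma redv_mulVec (Φ : Matrix a s B) (w : s → B) :
    h.redv (Φ *ᵥ w) = h.blk Φ *ᵥ h.redv w := by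
  ext ⟨i, k⟩
  simp only [redv, mulVec, dotProduct, blk, of_apply, Fintype.sum_prod_type]
  rw [red_sum, Finset.sum_apply]
  refine Finset.sum_congr rfl fun j _ => ?_
  rw [red_mul_eq]
  rfl

lemma eq_quo_add_liftv (w : s → B) : w = ω • (h.quo ∘ w) + h.liftv (h.redv w) :=
  funext fun i => by
    conv_lhs => rw [h.eq_quo_add (w i)]
    simp [liftv, redv, mul_comm]

lemma eq_of_redv_eq {w w' : s → B} (e : h.redv w = h.redv w') : ∃ q, w = w' + ω • q :=
  ⟨h.quo ∘ w - h.quo ∘ w', by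
    have h1 := h.eq_quo_add_liftv w
    have h2 := h.eq_quo_add_liftv w'
    rw [e] at h1
    funext i
    have h1 := congrFun h1 i
    have h2 := congrFun h2 i
    simp only [Pi.add_apply, Pi.smul_apply, Pi.sub_apply, smul_eq_mul] at h1 h2 ⊢
    linear_combination h1 - h2⟩

lemma ex_blk {Φ : Matrix a s B} {Sg : Matrix s t B} {Ps : Matrix s a B} [Fintype a]
    [DecidableEq a] (hex : Ex Φ Sg) (hP : Φ * Ps = ω • 1) :
    Ex (h.blk Φ) (h.blk (fromCols Sg Ps)) := by
  intro v hv
  have h1 : h.redv (Φ *ᵥ h.liftv v) = h.redv (0 : a → B) := by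
    rw [redv_mulVec, redv_liftv, hv]
    exact funext fun p => (congrFun (map_zero h.redHom) p.2).symm
  obtain ⟨q, hq⟩ := h.eq_of_redv_eq h1
  rw [zero_add] at hq
  obtain ⟨u, hu⟩ := hex (h.liftv v - Ps *ᵥ q) (by
    rw [mulVec_sub, mulVec_mulVec, hP, hq, smul_mulVec, one_mulVec, sub_self])
  refine ⟨h.redv (Sum.elim u q), ?_⟩
  rw [← redv_mulVec, fromCols_mulVec_sumElim, hu, sub_add_cancel, redv_liftv]

lemma ex_of_blk {Φ : Matrix a s B} {Sg : Matrix s t B} {Ps : Matrix s a B} [Fintype a]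
    [DecidableEq a] [DecidableEq s]
    (hex : Ex (h.blk Φ) (h.blk (fromCols Sg Ps))) (hS : Φ * Sg = 0) (hP : Φ * Ps = ω • 1)
    (hT : ∃ Th : Matrix t s B, ω • 1 - Ps * Φ = Sg * Th) : Ex Φ Sg := by
  intro w hw
  obtain ⟨Th, hT⟩ := hT
  obtain ⟨v, hv⟩ := hex (h.redv w) (by
    rw [← redv_mulVec, hw]
    exact funext fun p => congrFun (map_zero h.redHom) p.2)
  have h1 : h.redv w = h.redv (fromCols Sg Ps *ᵥ h.liftv v) := by rw [redv_mulVec, redv_liftv, hv]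
  obtain ⟨q, hq⟩ := h.eq_of_redv_eq h1
  obtain ⟨u, u', huu⟩ : ∃ u u', h.liftv v = Sum.elim u u' :=
    ⟨_, _, (Sum.elim_comp_inl_inr _).symm⟩
  have h2 : ω • q = Sg *ᵥ (Th *ᵥ q) + Ps *ᵥ (Φ *ᵥ q) := by
    rw [mulVec_mulVec, mulVec_mulVec, ← hT, sub_mulVec, sub_add_cancel, smul_mulVec, one_mulVec]
  rw [huu, fromCols_mulVec_sumElim, h2] at hq
  have h3 : w = Sg *ᵥ (u + Th *ᵥ q) + Ps *ᵥ (u' + Φ *ᵥ q) := by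
    rw [hq, mulVec_add, mulVec_add]
    abel
  have h4 : ω • (u' + Φ *ᵥ q) = 0 := by
    rw [h3, mulVec_add, mulVec_mulVec, mulVec_mulVec, hS, hP, zero_mulVec, zero_add, smul_mulVec,
      one_mulVec] at hw
    exact hw
  have h5 : u' + Φ *ᵥ q = 0 := funext fun i =>
    h.eq_zero_of_mul (by rw [mul_comm]; exact congrFun h4 i)
  rw [h5, mulVec_zero, add_zero] at h3
  exact ⟨_, h3.symm⟩

lemma blk_natural {φ' : A' →+* B'} {y' ω' : B'} (h' : WD φ' y' ω' d)
    (α : A →+* A') (β : B →+* B') (hφ : ∀ a, β (φ a) = φ' (α a)) (hy : β y = y') (hω : β ω = ω')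
    (Φ : Matrix a s B) : h'.blk (Φ.map β) = (h.blk Φ).map α := by
  ext ⟨i, k⟩ ⟨j, l⟩
  have := congrFun (h.red_natural h' α β hφ hy hω (Φ i j * y ^ (l : ℕ))) k
  rw [map_mul, map_pow, hy] at this
  exact this

lemma blk_mul {Φ : Matrix a s B} {Sg : Matrix s t B} : h.blk (Φ * Sg) = h.blk Φ * h.blk Sg := by
  ext ⟨i, k⟩ ⟨j, l⟩
  have := congrFun (h.redv_mulVec Φ fun m => Sg m j * y ^ (l : ℕ)) (i, k)
  simp only [redv, mulVec, dotProduct] at this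
  simp only [blk, mulMat, of_apply, mul_apply, Finset.sum_mul] at this ⊢
  simp only [mul_assoc]
  exact this

end WD

end WeierstrassDivision

section Ultra

variable (U : Ultrafilter ℕ)

/-- Bounded sequences. -/
def bddSeq (A : Type) [NormedCommRing A] : Subring (ℕ → A) where
  carrier := {f | ∃ c, ∀ k, ‖f k‖ ≤ c}
  zero_mem' := ⟨0, by simp⟩
  one_mem' := ⟨‖(1 : A)‖, by simp⟩
  add_mem' := by
    rintro f g ⟨c, hc⟩ ⟨c', hc'⟩
    exact ⟨c + c', fun k => (norm_add_le _ _).trans (add_le_add (hc k) (hc' k))⟩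
  neg_mem' := by
    rintro f ⟨c, hc⟩
    exact ⟨c, fun k => by simpa using hc k⟩
  mul_mem' := by
    rintro f g ⟨c, hc⟩ ⟨c', hc'⟩
    exact ⟨c * c', fun k => (norm_mul_le _ _).trans
      (mul_le_mul (hc k) (hc' k) (norm_nonneg _) ((norm_nonneg _).trans (hc k)))⟩

/-- Bounded sequences tending to zero along `U`. -/
def nullSeq (A : Type) [NormedCommRing A] : Ideal (bddSeq A) where
  carrier := {f | Tendsto (fun k => ‖f.1 k‖) U (𝓝 0)}
  zero_mem' := by simp
  add_mem' := by
    intro f g hf hg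
    refine squeeze_zero (fun k => norm_nonneg _) (fun k => norm_add_le _ _) ?_
    simpa using Tendsto.add hf hg
  smul_mem' := by
    rintro ⟨f, c, hc⟩ g hg
    refine squeeze_zero (fun k => norm_nonneg _) (g := fun k => c * ‖g.1 k‖) (fun k => ?_) ?_
    · exact (norm_mul_le _ _).trans (mul_le_mul_of_nonneg_right (hc k) (norm_nonneg _))
    · simpa using Tendsto.const_mul c hg

/-- The (bounded) ultraproduct of a normed ring. -/
def UP (A : Type) [NormedCommRing A] : Type := bddSeq A ⧸ nullSeq U A

instance (A : Type) [NormedCommRing A] : CommRing (UP U A) :=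
  inferInstanceAs (CommRing (bddSeq A ⧸ nullSeq U A))

namespace UP

variable {A B D : Type} [NormedCommRing A] [NormedCommRing B] [NormedCommRing D] {U}

variable (U) in
/-- The class of a bounded sequence. -/
def mk : bddSeq A →+* UP U A := Ideal.Quotient.mk _

lemma mk_surjective : Function.Surjective (mk U : bddSeq A → UP U A) := Ideal.Quotient.mk_surjective

lemma mk_eq_zero {f : bddSeq A} : mk U f = 0 ↔ Tendsto (fun k => ‖f.1 k‖) U (𝓝 0) :=
  Ideal.Quotient.eq_zero_iff_mem

variable (U) in
/-- The homomorphism to the ultraproduct defined by a sequence of homomorphisms. -/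
def lift (φ : ℕ → CHom A B) : A →+* UP U B :=
  (mk U).comp ((RingHom.pi fun k => (φ k).toRingHom).codRestrict (bddSeq B)
    fun a => ⟨‖a‖, fun k => (φ k).bound a⟩)

lemma lift_eq_zero {φ : ℕ → CHom A B} {a : A} :
    lift U φ a = 0 ↔ Tendsto (fun k => ‖φ k a‖) U (𝓝 0) := mk_eq_zero

variable (U) in
/-- Functoriality of the ultraproduct. -/
def map (φ : CHom A B) : UP U A →+* UP U B :=
  Ideal.Quotient.lift _ ((mk U).comp (((RingHom.pi fun k => φ.toRingHom.comp (Pi.evalRingHom _ k)).comp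
    (bddSeq A).subtype).codRestrict (bddSeq B) fun a => by
      obtain ⟨c, hc⟩ := a.2
      exact ⟨c, fun k => (φ.bound _).trans (hc k)⟩)) fun a ha =>
    mk_eq_zero.2 (squeeze_zero (fun k => norm_nonneg _) (fun k => φ.bound _) ha)

end UP

lemma NWD.up {A B : Type} [NormedCommRing A] [NormedCommRing B] {φ : CHom A B} {y : B} {ω : bddSeq B}
    {d : ℕ} (h : ∀ k, NWD φ y (ω.1 k) d) :
    WD (UP.map U φ) (UP.mk U ⟨fun _ => y, ‖y‖, fun _ => le_rfl⟩) (UP.mk U ω) d := by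
  have key : ∀ (q : bddSeq B) (r : Fin d → bddSeq A),
      UP.mk U q * UP.mk U ω + ∑ j : Fin d, UP.map U φ (UP.mk U (r j)) *
        (UP.mk U ⟨fun _ => y, ‖y‖, fun _ => le_rfl⟩) ^ (j : ℕ) =
      UP.mk U (q * ω + ∑ j : Fin d, ⟨fun k => φ ((r j).1 k), (r j).2.imp fun _ hc k =>
        (φ.bound _).trans (hc k)⟩ * ⟨fun _ => y, ‖y‖, fun _ => le_rfl⟩ ^ (j : ℕ)) := fun q r => by
    rw [map_add, map_mul, map_sum]
    congr 1
  have key' : ∀ (q : bddSeq B) (r : Fin d → bddSeq A) (k : ℕ),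
      (q * ω + ∑ j : Fin d, (⟨fun k => φ ((r j).1 k), (r j).2.imp fun _ hc k =>
        (φ.bound _).trans (hc k)⟩ * ⟨fun _ => y, ‖y‖, fun _ => le_rfl⟩ ^ (j : ℕ) : bddSeq B)).1 k =
      q.1 k * ω.1 k + ∑ j : Fin d, φ ((r j).1 k) * y ^ (j : ℕ) := fun q r k => by
    have : ∀ f : Fin d → bddSeq B, (∑ j, f j).1 k = ∑ j, (f j).1 k := fun f =>
      map_sum ((Pi.evalRingHom (fun _ => B) k).comp (bddSeq B).subtype) f _
    change q.1 k * ω.1 k + (∑ j, _ : bddSeq B).1 k = _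
    rw [this]
    rfl
  have hinj : ∀ (q : UP U B) (r : Fin d → UP U A),
      q * UP.mk U ω + ∑ j : Fin d, UP.map U φ (r j) *
        (UP.mk U ⟨fun _ => y, ‖y‖, fun _ => le_rfl⟩) ^ (j : ℕ) = 0 → q = 0 ∧ r = 0 := by
    intro q r h0
    obtain ⟨q, rfl⟩ := UP.mk_surjective q
    choose r' hr using fun j => UP.mk_surjective (r j)
    obtain rfl : (fun j => UP.mk U (r' j)) = r := funext hr
    rw [key, UP.mk_eq_zero] at h0
    simp only [key'] at h0
    refine ⟨UP.mk_eq_zero.2 ?_, funext fun i => UP.mk_eq_zero.2 ?_⟩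
    · exact squeeze_zero (fun k => norm_nonneg _) (fun k => ((h k).2 _ fun j => (r' j).1 k).1) h0
    · exact squeeze_zero (fun k => norm_nonneg _)
        (fun k => ((h k).2 (q.1 k) fun j => (r' j).1 k).2 i) h0
  intro b
  obtain ⟨⟨b, c, hc⟩, rfl⟩ := UP.mk_surjective b
  choose q r hqr using fun k => (h k).1 (b k)
  have hb := fun k => (h k).2 (q k) (r k)
  simp only [← hqr] at hb
  let q' : bddSeq B := ⟨q, c, fun k => (hb k).1.trans (hc k)⟩
  let r' : Fin d → bddSeq A := fun j => ⟨fun k => r k j, c, fun k => ((hb k).2 j).trans (hc k)⟩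
  have hex : UP.mk U ⟨b, c, hc⟩ = UP.mk U q' * UP.mk U ω + ∑ j : Fin d, UP.map U φ (UP.mk U (r' j)) *
        (UP.mk U ⟨fun _ => y, ‖y‖, fun _ => le_rfl⟩) ^ (j : ℕ) := by
    rw [key]
    congr 1
    exact Subtype.ext (funext fun k => (hqr k).trans (key' q' r' k).symm)
  refine ⟨(UP.mk U q', fun j => UP.mk U (r' j)), hex, ?_⟩
  rintro ⟨q2, r2⟩ h2
  have h3 := hinj (q2 - UP.mk U q') (r2 - fun j => UP.mk U (r' j)) (by
    simp only [Pi.sub_apply, map_sub, sub_mul, Finset.sum_sub_distrib]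
    linear_combination hex - h2)
  rw [sub_eq_zero, sub_eq_zero] at h3
  rw [h3.1, h3.2]

end Ultra

end RigidQE
end

noncomputable section
namespace RigidQE
set_option linter.unusedSectionVars false
open Filter Topology Matrix

section Minors

variable {R R' : Type*} [CommRing R] [CommRing R'] {a s t : Type} [Fintype s] [Fintype t] [Fintype a]

lemma fromCols_one_map [DecidableEq a] (φ : R →+* R') (Φ : Matrix a s R) :
    (fromCols Φ (1 : Matrix a a R)).map φ = fromCols (Φ.map φ) 1 := by
  ext i (j | j)
  · rfl
  · simp [one_apply, apply_ite φ]

lemma Ex.of_fromCols {e : Type} [Fintype e] {Φ : Matrix a s R} {E : Matrix a e R}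
    {Sg : Matrix s t R} (h : Ex (fromCols Φ E) (fromRows Sg (0 : Matrix e t R))) : Ex Φ Sg := by
  intro w hw
  obtain ⟨v, hv⟩ := h (Sum.elim w 0) (by rw [fromCols_mulVec_sumElim, hw, mulVec_zero, add_zero])
  refine ⟨v, funext fun i => ?_⟩
  simpa [fromRows_mulVec] using congrFun hv (Sum.inl i)

lemma Ex.fromCols {e : Type} [Fintype e] {Φ : Matrix a s R} {E : Matrix a e R}
    {Sg : Matrix s t R} (h : Ex Φ Sg) (h' : ∀ w w', Φ *ᵥ w + E *ᵥ w' = 0 → w' = 0) :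
    Ex (fromCols Φ E) (fromRows Sg (0 : Matrix e t R)) := by
  intro w hw
  obtain ⟨u, u', rfl⟩ : ∃ u u', w = Sum.elim u u' := ⟨_, _, (Sum.elim_comp_inl_inr _).symm⟩
  rw [fromCols_mulVec_sumElim] at hw
  obtain rfl := h' _ _ hw
  rw [mulVec_zero, add_zero] at hw
  obtain ⟨v, rfl⟩ := h u hw
  exact ⟨v, by rw [fromRows_mulVec, zero_mulVec]⟩

lemma eq_zero_of_minimal_minor [IsDomain R] [DecidableEq a] {Φ : Matrix a s R} {χ : a → s ⊕ a}
    (h0 : ((fromCols Φ (1 : Matrix a a R)).submatrix id χ).det ≠ 0)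
    (h1 : ∀ p j, (χ p).isRight → ((fromCols Φ (1 : Matrix a a R)).submatrix id
      (Function.update χ p (Sum.inl j))).det = 0) (w : s → R) (w' : {p // (χ p).isRight} → R)
    (hw : Φ *ᵥ w + ((fromCols Φ (1 : Matrix a a R)).submatrix id fun p : {p // (χ p).isRight} =>
      χ p) *ᵥ w' = 0) : w' = 0 := by
  classical
  set M := (fromCols Φ (1 : Matrix a a R)).submatrix id χ with hM
  have hE : ((fromCols Φ (1 : Matrix a a R)).submatrix id fun p : {p // (χ p).isRight} =>
      χ p) *ᵥ w' = M *ᵥ fun p => if h : (χ p).isRight then w' ⟨p, h⟩ else 0 := by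
    ext i
    refine Fintype.sum_of_injective (fun p : {p // (χ p).isRight} => p.1) Subtype.val_injective
      _ _ (fun p hp => ?_) fun p => ?_
    · have : ¬ (χ p).isRight := fun h => hp ⟨⟨p, h⟩, rfl⟩
      simp [this]
    · simp [hM, p.2]
  rw [hE] at hw
  have h2 := congrArg (fun v => M.adjugate *ᵥ v) hw
  simp only [mulVec_add, mulVec_mulVec, adjugate_mul, mulVec_zero, smul_mulVec, one_mulVec] at h2
  ext ⟨p, hp⟩
  have h3 := congrFun h2 p
  have h4 : ((M.adjugate * Φ) *ᵥ w) p = 0 := by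
    refine Finset.sum_eq_zero fun j _ => ?_
    have : (M.adjugate * Φ) p j = 0 := by
      have e : (M.adjugate * Φ) p j = (M.adjugate *ᵥ fun i => Φ i j) p := rfl
      rw [e, ← cramer_eq_adjugate_mulVec, cramer_apply, ← h1 p j hp]
      congr 1
      ext i q
      by_cases hq : q = p
      · subst hq; simp
      · simp [hq, hM]
    exact mul_eq_zero_of_left this _
  simp only [Pi.add_apply, h4, zero_add, Pi.smul_apply, hp, dif_pos, smul_eq_mul, Pi.zero_apply,
    mul_eq_zero, h0, false_or] at h3
  exact h3

lemma exists_mul_eq_det_smul [DecidableEq a] (Φ : Matrix a s R) (χ : a → s ⊕ a) :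
    ∃ Ψ : Matrix (s ⊕ {p // (χ p).isRight}) a R, fromCols Φ
      ((fromCols Φ (1 : Matrix a a R)).submatrix id fun p : {p // (χ p).isRight} =>
      χ p) * Ψ = ((fromCols Φ (1 : Matrix a a R)).submatrix id χ).det • 1 := by
  classical
  set M := (fromCols Φ (1 : Matrix a a R)).submatrix id χ with hM
  let κ : a → s ⊕ {p // (χ p).isRight} := fun p =>
    if h : (χ p).isRight then Sum.inr ⟨p, h⟩ else Sum.inl ((χ p).getLeft (by simpa using h))
  refine ⟨(1 : Matrix (s ⊕ {p // (χ p).isRight}) _ R).submatrix id κ * M.adjugate, ?_⟩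
  have : fromCols Φ ((fromCols Φ (1 : Matrix a a R)).submatrix id fun p : {p // (χ p).isRight} =>
      χ p) * (1 : Matrix (s ⊕ {p // (χ p).isRight}) _ R).submatrix id κ = M := by
    ext i p
    rw [mul_apply]
    simp only [submatrix_apply, id, one_apply, mul_ite, mul_one, mul_zero, Finset.sum_ite_eq',
      Finset.mem_univ, if_true, κ, hM]
    by_cases h : (χ p).isRight
    · simp [h]
    · simp only [h, dif_neg, Bool.false_eq_true, not_false_eq_true, fromCols_apply_inl]
      conv_rhs => rw [← Sum.inl_getLeft (χ p) (by simpa using h)]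
      rfl
  rw [← Matrix.mul_assoc, this, mul_adjugate]

end Minors

namespace Tate

section Prime

variable {K : Type} [NormedField K] [CompleteSpace K] [IsAlgClosed K] [IsUltrametricDist K]
  {σ τ : Type} {U : Ultrafilter ℕ} {x : ℕ → Bl K σ}

variable (U) in
/-- The ideal of functions tending to zero along a sequence of points. -/
def pI (x : ℕ → Bl K σ) : Ideal (Tate K σ) := RingHom.ker (UP.lift U fun k => pt (x k))

lemma mem_pI {f : Tate K σ} : f ∈ pI U x ↔ Tendsto (fun k => ‖pt (x k) f‖) U (𝓝 0) :=
  UP.lift_eq_zero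

lemma exists_eventually_le {f : Tate K σ} (hf : f ∉ pI U x) :
    ∃ ε > 0, ∀ᶠ k in U, ε ≤ ‖pt (x k) f‖ := by
  by_contra! h
  refine hf (mem_pI.2 (Metric.tendsto_nhds.2 fun ε hε => ?_))
  filter_upwards [h ε hε] with k hk
  simpa using hk

lemma not_mem_pI {f : Tate K σ} {ε : ℝ} (hε : 0 < ε) (h : ∀ᶠ k in U, ε ≤ ‖pt (x k) f‖) :
    f ∉ pI U x := fun hf => by
  obtain ⟨k, hk, hk'⟩ := (h.and ((mem_pI.1 hf).eventually_lt_const hε)).exists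
  exact absurd hk hk'.not_ge

instance : (pI U x).IsPrime where
  ne_top' h := not_mem_pI (U := U) (x := x) (f := 1) one_pos (by simp) (h ▸ trivial)
  mem_or_mem' := by
    intro f g hfg
    by_contra! h
    obtain ⟨ε, hε, h1⟩ := exists_eventually_le h.1
    obtain ⟨ε', hε', h2⟩ := exists_eventually_le h.2
    refine not_mem_pI (mul_pos hε hε') ?_ hfg
    filter_upwards [h1, h2] with k hk hk'
    rw [map_mul, norm_mul]
    exact mul_le_mul hk hk' hε'.le (norm_nonneg _)

variable (U) in
/-- Restriction to the sequence of fibres over `x`, followed by a substitution. -/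
def thetaHom (x : ℕ → Bl K σ) (b : Bl (Tate K τ) τ) : Tate (Tate K σ) τ →+* UP U (Tate K τ) :=
  UP.lift U fun k => (sub b).comp (spec τ (x k))

lemma thetaHom_eq_zero {b : Bl (Tate K τ) τ} {f : Tate (Tate K σ) τ} (hf : f ∈ exI τ (pI U x)) :
    thetaHom U x b f = 0 := by
  have : exI τ (pI U x) ≤ RingHom.ker (thetaHom U x b) := by
    rw [Ideal.map_le_iff_le_comap]
    intro f hf
    refine UP.lift_eq_zero.2 ?_
    have := mem_pI.1 hf
    simpa using this
  exact this hf

lemma exists_invert [Finite σ] {p : Tate K σ} {ϖ : K} (hϖ : ϖ ≠ 0)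
    (h : ∀ᶠ k in U, ‖ϖ‖ ≤ ‖pt (x k) p‖) :
    ∃ (x' : ℕ → Bl K (σ ⊕ Unit)) (ι : CHom (Tate K σ) (Tate K (σ ⊕ Unit))) (z : Tate K (σ ⊕ Unit)),
      ‖z‖ ≤ 1 ∧ (∀ c, ι (C c) = C c) ∧ (∀ k f, pt (x' k) (ι f) = pt (x k) f) ∧
      ι p * z - C ϖ ∈ pI U x' ∧ ∀ y, pI U x' ≤ mI y →
        ∃ y0, pI U x ≤ mI y0 ∧ (∀ f, pt y (ι f) = pt y0 f) ∧ pt y0 p ≠ 0 := by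
  classical
  let v : ℕ → K := fun k => if ‖ϖ‖ ≤ ‖pt (x k) p‖ then ϖ / pt (x k) p else 0
  have hv : ∀ k, ‖v k‖ ≤ 1 := fun k => by
    by_cases hk : ‖ϖ‖ ≤ ‖pt (x k) p‖
    · simp only [v, if_pos hk, norm_div]
      exact div_le_one_of_le₀ hk (norm_nonneg _)
    · simp [v, if_neg hk]
  let x' : ℕ → Bl K (σ ⊕ Unit) := fun k => ⟨Sum.elim (x k) fun _ => v k, by
    rintro (i | i)
    · exact (x k).2 i
    · exact hv k⟩
  have hx1 : ∀ k i, x' k (Sum.inl i) = x k i := fun k i => rfl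
  have hx2 : ∀ k, x' k (Sum.inr ()) = v k := fun k => rfl
  let ι : CHom (Tate K σ) (Tate K (σ ⊕ Unit)) := eval CC (renBl Sum.inl)
  have hι : ∀ (y : Bl K (σ ⊕ Unit)) (y0 : Bl K σ), (∀ i, y0 i = y (Sum.inl i)) →
      ∀ f, pt y (ι f) = pt y0 f := fun y y0 hy f => by
    have : (pt y).comp ι = pt y0 := chom_ext (fun a => by simp [ι]) fun i => by simp [ι, hy]
    rw [← this]; rfl
  have hz : ι p * X (Sum.inr ()) - C ϖ ∈ pI U x' := by
    refine mem_pI.2 (tendsto_const_nhds.congr' ?_)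
    filter_upwards [h] with k hk
    have hp : pt (x k) p ≠ 0 := fun h0 => by
      rw [h0, norm_zero] at hk
      exact hϖ (norm_le_zero_iff.1 hk)
    rw [map_sub, map_mul, hι (x' k) (x k) fun i => hx1 k i, pt_X, pt_C, hx2]
    simp only [v, if_pos hk]
    rw [mul_div_cancel₀ _ hp, sub_self, norm_zero]
  refine ⟨x', ι, X (Sum.inr ()), norm_X_le _, fun c => by simp [ι], fun k => hι _ _ fun i => hx1 k i,
    hz, fun y hy => ?_⟩
  let y0 : Bl K σ := ⟨fun i => y (Sum.inl i), fun i => y.2 _⟩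
  have hy0 := hι y y0 fun i => rfl
  refine ⟨y0, ?_, hy0, ?_⟩
  · intro f hf
    have : ι f ∈ pI U x' := by
      rw [mem_pI] at hf ⊢
      simpa only [hι (x' _) (x _) fun i => hx1 _ i] using hf
    rw [mem_mI_iff, ← hy0]
    exact pt_eq_zero_of_mem_mI (hy this)
  · intro h0
    have := pt_eq_zero_of_mem_mI (hy hz)
    rw [map_sub, map_mul, hy0, h0, zero_mul, pt_C, zero_sub, neg_eq_zero] at this
    exact hϖ this

end Prime

end Tate

end RigidQE
end

noncomputable section
namespace RigidQE
set_option linter.unusedSectionVars false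
open Filter Topology Matrix

lemma WD.red_mem {A B : Type*} [CommRing A] [CommRing B] {φ : A →+* B} {y ω : B} {d : ℕ}
    (h : WD φ y ω d) {I : Ideal A} {f : B} (hf : f ∈ I.map φ) (i : Fin d) : h.red f i ∈ I := by
  let J : Ideal B :=
    { carrier := {f | ∀ i, h.red f i ∈ I}
      zero_mem' := fun i => by
        rw [show h.red 0 = 0 from map_zero h.redHom]
        exact I.zero_mem
      add_mem' := fun {f g} hf hg i => by
        rw [h.red_add]
        exact I.add_mem (hf i) (hg i)
      smul_mem' := fun c f hf i => by
        rw [smul_eq_mul, h.red_mul_eq]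
        exact mulVec_mem _ hf i }
  have : I.map φ ≤ J := by
    rw [Ideal.map_le_iff_le_comap]
    intro a ha i
    rw [← mul_one (φ a), h.red_mul]
    exact I.mul_mem_right _ ha
  exact this hf i

lemma smul_one_map {R R' r : Type*} [CommRing R] [CommRing R'] [DecidableEq r] (θ : R →+* R')
    (c : R) : (c • (1 : Matrix r r R)).map θ = θ c • 1 := by
  ext i j
  by_cases hij : i = j <;> simp [hij, one_apply]

namespace Tate

variable {K : Type} [NormedField K] [CompleteSpace K] [IsAlgClosed K] [IsUltrametricDist K]
  {σ τ : Type} [Finite σ] {U : Ultrafilter ℕ} {x : ℕ → Bl K σ} {a s t u : Type} [Fintype a]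
  [Fintype s] [Fintype t] [Fintype u]

lemma FibExact.exists_eq_mul [Finite τ] {I : Ideal (Tate K σ)} {Φ : Matrix a s (Tate (Tate K σ) τ)}
    {Sg : Matrix s t (Tate (Tate K σ) τ)} (h : FibExact I Φ Sg) (M : Matrix s u (Tate (Tate K σ) τ))
    (hM : ∀ i j, (Φ * M) i j ∈ exI τ I) : ∃ Θ : Matrix t u (Tate (Tate K σ) τ), ∀ i j, (M - Sg * Θ)
        i j ∈ exI τ I := by
  choose v hv using fun j => h.lift (fun i => M i j) fun i => hM i j
  exact ⟨fun i j => v j i, fun i j => hv j i⟩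

lemma map_map_eq_of_mem {R' : Type*} [CommRing R'] {R : Type*} [CommRing R] {I : Ideal R}
    {θ : R →+* R'} (hθ : ∀ f ∈ I, θ f = 0) {M M' : Matrix a u R} (h : ∀ i j, (M - M') i j ∈ I) :
    M.map θ = M'.map θ := by
  ext i j
  have := hθ _ (h i j)
  rwa [Matrix.sub_apply, map_sub, sub_eq_zero] at this

lemma spec_emb (n : ℕ) (y : Bl K σ) (f : Tate (Tate K σ) (Fin n)) :
    spec (Fin (n + 1)) y (emb _ n f) = emb K n (spec (Fin n) y f) := by
  have : (spec (Fin (n + 1)) y).comp (emb _ n) = (emb K n).comp (spec (Fin n) y) :=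
    chom_ext (fun a => by simp) fun i => by simp
  exact congrArg (fun φ => φ f) this

/-- Extend a substitution by a new first variable, which is left unchanged. -/
def consBl {n : ℕ} (b : Bl (Tate K (Fin n)) (Fin n)) : Bl (Tate K (Fin (n + 1))) (Fin (n + 1)) :=
  ⟨Fin.cases (X 0) fun j => emb K n (b j), fun i => by
    refine Fin.cases (norm_X_le _) (fun j => ?_) i
    exact ((emb K n).bound _).trans (b.2 j)⟩

@[simp] lemma consBl_zero {n : ℕ} (b : Bl (Tate K (Fin n)) (Fin n)) : consBl b 0 = X 0 := rfl
@[simp] lemma consBl_succ {n : ℕ} (b : Bl (Tate K (Fin n)) (Fin n)) (j : Fin n) :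
    consBl b j.succ = emb K n (b j) := rfl

lemma sub_consBl_emb {n : ℕ} (b : Bl (Tate K (Fin n)) (Fin n)) (f : Tate K (Fin n)) :
    sub (consBl b) (emb K n f) = emb K n (sub b f) := by
  have : (sub (consBl b)).comp (emb K n) = (emb K n).comp (sub b) :=
    chom_ext (fun a => by simp) fun i => by simp
  exact congrArg (fun φ => φ f) this

variable (K U) in
/-- Exactness in the fibres over a sequence of points gives, after a substitution, exactness of
the limit. -/
def ELoc (n : ℕ) : Prop :=
  ∀ (σ : Type) [Finite σ] (a s t : Type) [Fintype a] [Fintype s] [Fintype t]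
    (Φ : Matrix a s (Tate (Tate K σ) (Fin n))) (Sg : Matrix s t (Tate (Tate K σ) (Fin n)))
    (x : ℕ → Bl K σ), FibExact (pI U x) Φ Sg →
    ∃ b : Bl (Tate K (Fin n)) (Fin n), (∀ j, coeff 0 (b j) = 0) ∧
      Ex (Φ.map (thetaHom U x b)) (Sg.map (thetaHom U x b))

lemma norm_lt_one_nwd {B : Type} [NormedCommRing B] [IsUltrametricDist B] [CompleteSpace B]
    [NormOneClass B] {n d : ℕ} {ω : Tate B (Fin (n + 1))} (hω : ‖ω - X 0 ^ d‖ < 1) :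
    NWD (emb B n) (X 0) ω d := by
  have : Nontrivial (Tate B (Fin n)) := NormOneClass.nontrivial
  have h := nwd_fin (B := B) (n := n) (G := ω) (g := Polynomial.X ^ d) (Polynomial.monic_X_pow d)
    (fun i => by
      rw [Polynomial.coeff_X_pow]
      split_ifs
      · simp
      · simp) (by simpa using hω)
  rwa [Polynomial.natDegree_X_pow] at h

lemma ELoc.weierstrass {n : ℕ} (ih : ELoc K U n) {d : ℕ}
    {Φ : Matrix a s (Tate (Tate K σ) (Fin (n + 1)))} {Sg : Matrix s t (Tate (Tate K σ) (Fin (n + 1)))}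
    {Ψ : Matrix s a (Tate (Tate K σ) (Fin (n + 1)))} {ω : Tate (Tate K σ) (Fin (n + 1))}
    [DecidableEq a]
    (h1 : FibExact (pI U x) Φ Sg) (h2 : ∀ i j, (Φ * Ψ - ω •
      (1 : Matrix a a (Tate (Tate K σ) (Fin (n + 1))))) i j ∈ exI _ (pI U x))
    (hω : ‖ω - X 0 ^ d‖ < 1) :
    ∃ b : Bl (Tate K (Fin (n + 1))) (Fin (n + 1)), (∀ j, coeff 0 (b j) = 0) ∧
      Ex (Φ.map (thetaHom U x b)) (Sg.map (thetaHom U x b)) := by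
  classical
  have hW := (norm_lt_one_nwd hω).wd
  have hexI : exI (Fin (n + 1)) (pI U x) = (exI (Fin n) (pI U x)).map
      (emb (Tate K σ) n).toRingHom := by
    rw [Ideal.map_map]
    exact congrArg (fun f => Ideal.map f (pI U x))
      (RingHom.ext fun c => (emb_C (B := Tate K σ) (n := n) c).symm)
  have hfib : FibExact (pI U x) (hW.blk Φ) (hW.blk (fromCols Sg Ψ)) := by
    refine ⟨fun p q => ?_, fun y hy => ?_⟩
    · rw [← hW.blk_mul]
      have key : (Φ * fromCols Sg Ψ) p.1 q.1 ∈ exI _ (pI U x) ∨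
          ∃ c, (Φ * fromCols Sg Ψ) p.1 q.1 - c * ω ∈ exI _ (pI U x) := by
        rcases q with ⟨(j | j), q⟩
        · exact Or.inl (h1.1 p.1 j)
        · refine Or.inr ⟨(1 : Matrix a a _) p.1 j, ?_⟩
          have := h2 p.1 j
          rwa [Matrix.sub_apply, Matrix.smul_apply, smul_eq_mul, mul_comm ω] at this
      change hW.red ((Φ * fromCols Sg Ψ) p.1 q.1 * X 0 ^ (q.2 : ℕ)) p.2 ∈ _
      rcases key with h | ⟨c, h⟩
      · exact hW.red_mem (hexI ▸ Ideal.mul_mem_right _ _ h) _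
      · have e : (Φ * fromCols Sg Ψ) p.1 q.1 * X 0 ^ (q.2 : ℕ) =
            ((Φ * fromCols Sg Ψ) p.1 q.1 - c * ω) * X 0 ^ (q.2 : ℕ) + c * X 0 ^ (q.2 : ℕ) * ω := by
          ring
        rw [e, hW.red_add, hW.red_mul_omega, add_zero]
        exact hW.red_mem (hexI ▸ Ideal.mul_mem_right _ _ h) _
    · have hy' : NWD (emb K n) (X 0) (spec (Fin (n + 1)) y ω) d := norm_lt_one_nwd (by
        refine lt_of_le_of_lt ?_ hω
        have := (spec (Fin (n + 1)) y).bound (ω - X 0 ^ d)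
        rwa [map_sub, map_pow, spec_X] at this)
      have hP : Φ.map (spec _ y) * Ψ.map (spec _ y) = spec (Fin (n + 1)) y ω • 1 := by
        have := map_map_eq_of_mem (θ := (spec (Fin (n + 1)) y).toRingHom)
          (fun f hf => spec_eq_zero_of_mem_map hy hf) h2
        rw [Matrix.map_mul] at this
        exact this.trans (smul_one_map _ _)
      have := hy'.wd.ex_blk (h1.2 y hy) hP
      have e1 := hW.blk_natural hy'.wd (spec (Fin n) y).toRingHom (spec (Fin (n + 1)) y).toRingHom
        (fun a => spec_emb n y a) (by simp) rfl Φ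
      have e2 := hW.blk_natural hy'.wd (spec (Fin n) y).toRingHom (spec (Fin (n + 1)) y).toRingHom
        (fun a => spec_emb n y a) (by simp) rfl (fromCols Sg Ψ)
      have e3 : (fromCols Sg Ψ).map (spec (Fin (n + 1)) y) =
        fromCols (Sg.map (spec (Fin (n + 1)) y)) (Ψ.map (spec (Fin (n + 1)) y)) := by
        ext i (j | j) <;> rfl
      rw [← e3] at this
      exact (congrArg₂ Ex e1 e2).mp this
  obtain ⟨b, hb0, hb⟩ := ih σ _ _ _ _ _ x hfib
  have hup : ∀ k, NWD (emb K n) (X 0) (sub (consBl b) (spec (Fin (n + 1)) (x k) ω)) d := fun k =>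
    norm_lt_one_nwd (by
      refine lt_of_le_of_lt ?_ hω
      have := ((sub (consBl b)).comp (spec (Fin (n + 1)) (x k))).bound (ω - X 0 ^ d)
      rwa [map_sub, map_pow, CHom.comp_apply, CHom.comp_apply, spec_X, sub_X, consBl_zero] at this)
  refine ⟨consBl b, fun j => ?_, ?_⟩
  · refine Fin.cases ?_ (fun j => ?_) j
    · rw [consBl_zero, ← pt_zero, pt_X]
      rfl
    · have : (pt zeroBl).comp (emb K n) = pt zeroBl := chom_ext (fun a => by simp) fun i => by simp
      rw [consBl_succ, ← pt_zero, ← CHom.comp_apply, this, pt_zero, hb0]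
  · have hθ : ∀ f ∈ exI (Fin (n + 1)) (pI U x), thetaHom U x (consBl b) f = 0 := fun f hf =>
      thetaHom_eq_zero hf
    have hW' := NWD.up (U := U) (ω := ⟨fun k => sub (consBl b) (spec (Fin (n + 1)) (x k) ω), ‖ω‖,
      fun k => ((sub (consBl b)).comp (spec _ (x k))).bound ω⟩) hup
    have hX : thetaHom U x (consBl b) (X 0) =
        UP.mk U ⟨fun _ => X 0, ‖(X 0 : Tate K (Fin (n + 1)))‖, fun _ => le_rfl⟩ := by
      refine congrArg (UP.mk U) (Subtype.ext (funext fun k => ?_))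
      change sub (consBl b) (spec _ (x k) (X 0)) = X 0
      simp
    have hemb : ∀ f, thetaHom U x (consBl b) (emb _ n f) = UP.map U (emb K n) (thetaHom U x b f) :=
      fun f => by
        refine congrArg (UP.mk U) (Subtype.ext (funext fun k => ?_))
        change sub (consBl b) (spec _ (x k) (emb _ n f)) = emb K n (sub b (spec _ (x k) f))
        rw [spec_emb, sub_consBl_emb]
    have e1 := hW.blk_natural hW' (thetaHom U x b) (thetaHom U x (consBl b)) hemb hX rfl Φ
    have e2 := hW.blk_natural hW' (thetaHom U x b) (thetaHom U x (consBl b)) hemb hX rfl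
      (fromCols Sg Ψ)
    rw [← e1, ← e2] at hb
    have e3 : (fromCols Sg Ψ).map (thetaHom U x (consBl b)) =
        fromCols (Sg.map (thetaHom U x (consBl b))) (Ψ.map (thetaHom U x (consBl b))) := by
      ext i (j | j) <;> rfl
    rw [e3] at hb
    refine hW'.ex_of_blk hb ?_ ?_ ?_
    · rw [← Matrix.map_mul]
      ext i j
      exact hθ _ (h1.1 i j)
    · rw [← Matrix.map_mul, map_map_eq_of_mem hθ h2, smul_one_map]
      rfl
    · obtain ⟨Θ, hΘ⟩ := h1.exists_eq_mul (ω • 1 - Ψ * Φ) fun i j => by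
        have e : Φ * (ω • 1 - Ψ * Φ) = -((Φ * Ψ - ω • 1) * Φ) := by
          rw [Matrix.mul_sub, Matrix.sub_mul, Matrix.mul_assoc, Matrix.mul_smul, Matrix.smul_mul,
            Matrix.mul_one, Matrix.one_mul, neg_sub]
        rw [e, Matrix.neg_apply, Matrix.mul_apply]
        exact neg_mem (Ideal.sum_mem _ fun k _ => Ideal.mul_mem_right _ _ (h2 i k))
      refine ⟨Θ.map (thetaHom U x (consBl b)), ?_⟩
      rw [← Matrix.map_mul, ← Matrix.map_mul, ← map_map_eq_of_mem hθ hΘ, Matrix.map_sub _ (map_sub _),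
        smul_one_map]
      rfl

end Tate
end RigidQE
end

noncomputable section
namespace RigidQE
set_option linter.unusedSectionVars false
open Filter Topology Matrix

namespace Tate

section Bounds

variable {B : Type} [NormedCommRing B] {τ : Type}

lemma bpow_add (u : τ → B) (μ ν : τ →₀ ℕ) : bpow u (μ + ν) = bpow u μ * bpow u ν :=
  Finsupp.prod_add_index' (fun _ => pow_zero _) fun _ _ _ => pow_add _ _ _

lemma bpow_single (u : τ → B) (i : τ) (n : ℕ) : bpow u (Finsupp.single i n) = u i ^ n :=
  Finsupp.prod_single_index (pow_zero _)

lemma bpow_mul (u v : τ → B) (ν : τ →₀ ℕ) : bpow (u * v) ν = bpow u ν * bpow v ν := by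
  simp [bpow, Finsupp.prod, mul_pow, Finset.prod_mul_distrib]

lemma bpow_const (c : B) (ν : τ →₀ ℕ) : bpow (fun _ => c) ν = c ^ ν.degree := by
  simp only [bpow, Finsupp.prod, Finset.prod_pow_eq_pow_sum, Finsupp.degree]
  rfl

lemma map_bpow {D : Type} [NormedCommRing D] (φ : B →+* D) (u : τ → B) (ν : τ →₀ ℕ) :
    φ (bpow u ν) = bpow (φ ∘ u) ν := by
  simp [bpow, Finsupp.prod]

variable [IsUltrametricDist B] [NormOneClass B] {u v : τ → B} {r s : ℝ}

lemma norm_bpow_le_pow (hr : 0 ≤ r) (hu : ∀ i, ‖u i‖ ≤ r) (ν : τ →₀ ℕ) :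
    ‖bpow u ν‖ ≤ r ^ ν.degree := by
  induction ν using Finsupp.induction_linear with
  | zero => simp [bpow]
  | add μ ν hμ hν =>
    rw [bpow_add, map_add, pow_add]
    exact (norm_mul_le _ _).trans (mul_le_mul hμ hν (norm_nonneg _) (pow_nonneg hr _))
  | single i n =>
    rw [bpow_single, Finsupp.degree_single]
    exact (norm_pow_le _ _).trans (pow_le_pow_left₀ (norm_nonneg _) (hu i) _)

lemma norm_bpow_sub_le (hr : 0 ≤ r) (hs : 0 ≤ s) (hu : ∀ i, ‖u i‖ ≤ r) (hv : ∀ i, ‖v i‖ ≤ r)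
    (huv : ∀ i, ‖u i - v i‖ ≤ r * s) (ν : τ →₀ ℕ) :
    ‖bpow u ν - bpow v ν‖ ≤ r ^ ν.degree * s := by
  have key : ∀ {m n : ℕ} {a b a' b' : B}, ‖a'‖ ≤ r ^ m → ‖b‖ ≤ r ^ n → ‖a - a'‖ ≤ r ^ m * s →
      ‖b - b'‖ ≤ r ^ n * s → ‖a * b - a' * b'‖ ≤ r ^ (m + n) * s := by
    intro m n a b a' b' h1 h2 h3 h4
    have e : a * b - a' * b' = (a - a') * b + a' * (b - b') := by ring
    rw [e]
    refine (IsUltrametricDist.norm_add_le_max _ _).trans (max_le ?_ ?_)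
    · refine (norm_mul_le _ _).trans ((mul_le_mul h3 h2 (norm_nonneg _) (by positivity)).trans_eq ?_)
      ring
    · refine (norm_mul_le _ _).trans ((mul_le_mul h1 h4 (norm_nonneg _) (by positivity)).trans_eq ?_)
      ring
  induction ν using Finsupp.induction_linear with
  | zero => simpa [bpow] using hs
  | add μ ν hμ hν =>
    rw [bpow_add, bpow_add, map_add]
    exact key (norm_bpow_le_pow hr hv _) (norm_bpow_le_pow hr hu _) hμ hν
  | single i n =>
    rw [bpow_single, bpow_single, Finsupp.degree_single]
    induction n with
    | zero => simpa using hs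
    | succ n ih =>
      rw [pow_succ, pow_succ]
      refine key (n := 1) ((norm_pow_le _ _).trans (pow_le_pow_left₀ (norm_nonneg _) (hv i) _))
        (by simpa using hu i) ih (by simpa using huv i)

end Bounds

variable {K : Type} [NormedField K] [CompleteSpace K] [IsAlgClosed K] [IsUltrametricDist K]
  {σ τ : Type} [Finite σ] {U : Ultrafilter ℕ} {x : ℕ → Bl K σ} {a s t u : Type} [Fintype a]
  [Fintype s] [Fintype t] [Fintype u]

lemma FibExact.exists_augment [Finite τ] {Φ : Matrix a s (Tate (Tate K σ) τ)}
    {Sg : Matrix s t (Tate (Tate K σ) τ)} [DecidableEq a] (h : FibExact (pI U x) Φ Sg) :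
    ∃ (e : Type) (_ : Fintype e) (E : Matrix a e (Tate (Tate K σ) τ)) (g : Tate (Tate K σ) τ)
      (ν : τ →₀ ℕ) (Ψ : Matrix (s ⊕ e) a (Tate (Tate K σ) τ)), coeff ν g ∉ pI U x ∧
      fromCols Φ E * Ψ = g • 1 ∧
      (∀ i j, (fromCols Φ E * fromRows Sg (0 : Matrix e t _)) i j ∈ exI τ (pI U x)) ∧
      ∀ y : Bl K σ, pI U x ≤ mI y → spec τ y g ≠ 0 → Ex ((fromCols Φ E).map (spec τ y))
        ((fromRows Sg (0 : Matrix e t _)).map (spec τ y)) := by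
  classical
  let P : (a → s ⊕ a) → Prop := fun χ => ∃ ν,
    coeff ν ((fromCols Φ (1 : Matrix a a _)).submatrix id χ).det ∉ pI U x
  have hne : ∃ n χ, P χ ∧ (Finset.univ.filter fun p => (χ p).isRight).card = n := by
    refine ⟨_, Sum.inr, ⟨0, ?_⟩, rfl⟩
    have : (fromCols Φ (1 : Matrix a a _)).submatrix id Sum.inr = 1 := rfl
    rw [this, det_one, coeff_one, if_pos rfl]
    exact (Ideal.ne_top_iff_one _).1 Ideal.IsPrime.ne_top'
  obtain ⟨χ, ⟨ν, hν⟩, hχ⟩ := Nat.find_spec hne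
  obtain ⟨Ψ, hΨ⟩ := exists_mul_eq_det_smul Φ χ
  refine ⟨_, inferInstance, _, _, ν, Ψ, hν, hΨ, fun i j => ?_, fun y hy hg => ?_⟩
  · rw [fromCols_mul_fromRows, Matrix.mul_zero, add_zero]
    exact h.1 i j
  · have e1 : ∀ {r : Type} [Fintype r] (E : Matrix a r (Tate (Tate K σ) τ)),
        (fromCols Φ E).map (spec τ y) = fromCols (Φ.map (spec τ y)) (E.map (spec τ y)) :=
      fun E => by ext i (j | j) <;> rfl
    have e2 : (fromRows Sg (0 : Matrix {p // (χ p).isRight} t _)).map (spec τ y) =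
        fromRows (Sg.map (spec τ y)) 0 := by
      refine Matrix.ext fun i j => ?_
      rcases i with i | i
      · rfl
      · exact map_zero (spec τ y)
    have e4 : (fromCols Φ (1 : Matrix a a _)).map (spec τ y) = fromCols (Φ.map (spec τ y)) 1 :=
      fromCols_one_map (spec τ y).toRingHom Φ
    have e3 : ∀ χ : a → s ⊕ a, spec τ y ((fromCols Φ (1 : Matrix a a _)).submatrix id χ).det =
        ((fromCols (Φ.map (spec τ y)) (1 : Matrix a a _)).submatrix id χ).det := fun χ => by
      have := (spec τ y).toRingHom.map_det ((fromCols Φ (1 : Matrix a a _)).submatrix id χ)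
      refine this.trans (congrArg det ?_)
      rw [← e4]
      rfl
    rw [e1, e2]
    refine Ex.fromCols (h.2 y hy) fun w w' hw => ?_
    refine eq_zero_of_minimal_minor (e3 χ ▸ hg) (fun p j hp => ?_) w w' ?_
    · rw [← e3]
      refine spec_eq_zero_of_coeff fun μ => hy ?_
      by_contra hμ
      have hlt : (Finset.univ.filter fun q => (Function.update χ p (Sum.inl j) q).isRight).card <
          Nat.find hne := by
        rw [← hχ]
        refine Finset.card_lt_card ((Finset.ssubset_iff_of_subset fun q hq => ?_).2 ⟨p, ?_, ?_⟩)
        · by_cases hqp : q = p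
          · simp [hqp] at hq
          · simpa [hqp] using hq
        · simpa using hp
        · simp
      exact Nat.find_min hne hlt ⟨_, ⟨μ, hμ⟩, rfl⟩
    · rw [← e4]
      exact hw

lemma spec_map_of_pt {σ' : Type} {ι : CHom (Tate K σ) (Tate K σ')} {y : Bl K σ'} {y0 : Bl K σ}
    (h : ∀ f, pt y (ι f) = pt y0 f) (f : Tate (Tate K σ) τ) :
    spec τ y (map ι f) = spec τ y0 f := by
  ext ν
  exact h _

lemma map_mem_exI {σ' : Type} {ι : CHom (Tate K σ) (Tate K σ')} {I : Ideal (Tate K σ)}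
    {I' : Ideal (Tate K σ')} (h : ∀ f ∈ I, ι f ∈ I') {f : Tate (Tate K σ) τ} (hf : f ∈ exI τ I) :
    map ι f ∈ exI τ I' := by
  have : exI τ I ≤ (exI τ I').comap (map ι (τ := τ)).toRingHom := by
    rw [Ideal.map_le_iff_le_comap]
    intro f hf
    change map ι (C f) ∈ exI τ I'
    rw [map_C]
    exact Ideal.mem_map_of_mem _ (h f hf)
  exact this hf

lemma sub_mem_exI {A : Type} [NormedCommRing A] [IsUltrametricDist A] [CompleteSpace A]
    [NormOneClass A] {I : Ideal A} (b : Bl (Tate A τ) τ) {f : Tate A τ} (hf : f ∈ exI τ I) :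
    sub b f ∈ exI τ I := by
  have : exI τ I ≤ (exI τ I).comap (sub b).toRingHom := by
    rw [Ideal.map_le_iff_le_comap]
    intro f hf
    change sub b (C f) ∈ exI τ I
    rw [sub_C]
    exact Ideal.mem_map_of_mem _ hf
  exact this hf

lemma exists_norm_lt (hK : ∃ c : K, c ≠ 0 ∧ ‖c‖ < 1) {ε : ℝ} (hε : 0 < ε) :
    ∃ c : K, c ≠ 0 ∧ ‖c‖ < ε ∧ ‖c‖ < 1 := by
  obtain ⟨c, hc, h1⟩ := hK
  obtain ⟨n, hn⟩ := exists_pow_lt_of_lt_one hε h1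
  refine ⟨c ^ (n + 1), pow_ne_zero _ hc, ?_, ?_⟩
  · rw [norm_pow]
    exact (pow_le_pow_of_le_one (norm_nonneg _) h1.le n.le_succ).trans_lt hn
  · rw [norm_pow]
    exact pow_lt_one₀ (norm_nonneg _) h1 n.succ_ne_zero

lemma infinite_norm_eq_one (hK : ∃ c : K, c ≠ 0 ∧ ‖c‖ < 1) : {c : K | ‖c‖ = 1}.Infinite := by
  obtain ⟨c, hc, h1⟩ := hK
  refine Set.infinite_of_injective_forall_mem (f := fun n : ℕ => 1 + c ^ (n + 1)) (fun m n h => ?_)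
    fun n => ?_
  · have h2 := congrArg norm (add_left_cancel h)
    simp only [norm_pow] at h2
    have := pow_right_injective₀ (norm_pos_iff.2 hc) h1.ne h2
    omega
  · have h2 : ‖c ^ (n + 1)‖ < ‖(1 : K)‖ := by
      rw [norm_pow, norm_one]
      exact pow_lt_one₀ (norm_nonneg _) h1 n.succ_ne_zero
    have := IsUltrametricDist.norm_add_eq_max_of_norm_ne_norm h2.ne'
    rw [max_eq_left h2.le, norm_one] at this
    exact this

/-- The multi-indices of a given degree. -/
def degSet (τ : Type) [Finite τ] (d : ℕ) : Finset (τ →₀ ℕ) := (Finsupp.finite_of_degree_eq d).toFinset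

lemma mem_degSet [Finite τ] {d : ℕ} {ν : τ →₀ ℕ} : ν ∈ degSet τ d ↔ ν.degree = d := by
  simp [degSet]

lemma exists_direction [Finite τ] (hK : ∃ c : K, c ≠ 0 ∧ ‖c‖ < 1) {P : Ideal (Tate K σ)} [P.IsPrime]
    {g : Tate (Tate K σ) τ} {ν : τ →₀ ℕ} (hν : coeff ν g ∉ P) :
    ∃ c : τ → K, (∀ i, ‖c i‖ = 1) ∧ ∑ μ ∈ degSet τ ν.degree, C (bpow c μ) * coeff μ g ∉ P := by
  classical
  by_contra! hcon
  let π := Ideal.Quotient.mk P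
  let Q : MvPolynomial τ (Tate K σ ⧸ P) :=
    ∑ μ ∈ degSet τ ν.degree, MvPolynomial.monomial μ (π (coeff μ g))
  have hinj : Function.Injective fun c : K => π (C c) := (π.comp C).injective
  have hQ : Q = 0 := by
    refine MvPolynomial.funext_set (fun _ => (fun c : K => π (C c)) '' {c | ‖c‖ = 1})
      (fun _ => (infinite_norm_eq_one hK).image hinj.injOn) fun v hv => ?_
    choose c hc hcv using fun i => hv i trivial
    have := Ideal.Quotient.eq_zero_iff_mem.2 (hcon c hc)
    simp only [map_sum, map_mul] at this
    simp only [Q, map_sum, MvPolynomial.eval_monomial, map_zero]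
    rw [← this]
    refine Finset.sum_congr rfl fun μ _ => ?_
    rw [mul_comm]
    congr 1
    simp only [bpow, Finsupp.prod, map_prod, map_pow, ← hcv]
    rfl
  have := congrArg (MvPolynomial.coeff ν) hQ
  simp only [Q, MvPolynomial.coeff_sum, MvPolynomial.coeff_monomial, MvPolynomial.coeff_zero,
    Finset.sum_ite_eq', mem_degSet, if_true] at this
  exact hν (Ideal.Quotient.eq_zero_iff_mem.1 this)

end Tate
end RigidQE
end

noncomputable section
namespace RigidQE
set_option linter.unusedSectionVars false
open Filter Topology Matrix

namespace Tate

section Trunc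

variable {B τ : Type} [NormedCommRing B] [IsUltrametricDist B]

/-- The part of a power series supported on a finite set of exponents. -/
def trunc (S : Finset (τ →₀ ℕ)) (f : Tate B τ) : Tate B τ := ∑ μ ∈ S, C (coeff μ f) * mono μ

lemma coeff_trunc [DecidableEq τ] (S : Finset (τ →₀ ℕ)) (f : Tate B τ) (ν : τ →₀ ℕ) :
    coeff ν (trunc S f) = if ν ∈ S then coeff ν f else 0 := by
  rw [trunc, coeff_sum]
  simp only [coeff_C_mul, coeff_mono, mul_ite, mul_one, mul_zero, Finset.sum_ite_eq']

end Trunc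

section Numeric

variable {K : Type} [NormedField K] [CompleteSpace K] [IsAlgClosed K] [IsUltrametricDist K]
  {σ : Type}

lemma exists_weierstrass_sub {n d : ℕ} {I : Ideal (Tate K σ)} {G : Tate (Tate K σ) (Fin (n + 1))}
    {c : Fin (n + 1) → K} (hc : ∀ i, ‖c i‖ = 1) {ϖ δ : K} (hϖ : ϖ ≠ 0) (hδ : δ ≠ 0)
    (hδϖ : ‖δ‖ * ‖G‖ < ‖ϖ‖) (hδ1 : ‖δ‖ < 1) {z : Tate K σ} (hz : ‖z‖ ≤ 1)
    (hG : ∀ μ : Fin (n + 1) →₀ ℕ, μ.degree < d → coeff μ G ∈ I)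
    (hq : (∑ μ ∈ degSet (Fin (n + 1)) d, C (bpow c μ) * coeff μ G) * z - C ϖ ∈ I)
    {u : Bl (Tate (Tate K σ) (Fin (n + 1))) (Fin (n + 1))}
    (hu : ∀ i, ‖u i - C (C (δ * c i)) * X 0‖ ≤ ‖δ‖ * ‖δ‖) :
    ∃ ω κ : Tate (Tate K σ) (Fin (n + 1)), ‖ω - X 0 ^ d‖ < 1 ∧ ω - κ * sub u G ∈ exI _ I := by
  classical
  set q := ∑ μ ∈ degSet (Fin (n + 1)) d, C (bpow c μ) * coeff μ G with hqdef
  let low := (Finset.range d).biUnion (degSet (Fin (n + 1)))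
  have hlow : ∀ {μ}, μ ∈ low ↔ μ.degree < d := fun {μ} => by
    simp [low, mem_degSet]
  let R := G - trunc low G - trunc (degSet _ d) G
  have hR : ∀ ν, coeff ν R = if ν.degree ≤ d then 0 else coeff ν G := fun ν => by
    simp only [R, coeff_sub, coeff_trunc, hlow, mem_degSet]
    rcases lt_trichotomy ν.degree d with h | h | h
    · simp [h, h.ne, h.le]
    · simp [h]
    · simp [h.not_gt, h.ne', h.not_ge]
  let v : Fin (n + 1) → Tate (Tate K σ) (Fin (n + 1)) := fun i => C (C (δ * c i)) * X 0
  have hv : ∀ i, ‖v i‖ ≤ ‖δ‖ := fun i => by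
    refine (norm_C_mul_le _ _).trans ?_
    rw [norm_C, norm_mul, hc, mul_one]
    exact mul_le_of_le_one_right (norm_nonneg _) (norm_X_le _)
  have hu' : ∀ i, ‖u i‖ ≤ ‖δ‖ := fun i => by
    rw [← sub_add_cancel (u i) (v i)]
    refine (norm_add_le_max' _ _).trans (max_le ((hu i).trans ?_) (hv i))
    exact mul_le_of_le_one_right (norm_nonneg _) hδ1.le
  have hvpow : ∀ μ : Fin (n + 1) →₀ ℕ, bpow v μ = C (C (δ ^ μ.degree * bpow c μ)) * X 0 ^
      μ.degree := by
    intro μ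
    have e1 : bpow v μ = bpow (fun i => (C (C (δ * c i)) : Tate (Tate K σ) (Fin (n + 1)))) μ *
        bpow (fun _ => X 0) μ := bpow_mul _ _ μ
    have e2 : C (C (bpow (fun i => δ * c i) μ)) =
        bpow (fun i => (C (C (δ * c i)) : Tate (Tate K σ) (Fin (n + 1)))) μ :=
      map_bpow ((C : Tate K σ →+* Tate (Tate K σ) (Fin (n + 1))).comp C) _ μ
    have e3 : bpow (fun i => δ * c i) μ = bpow (fun _ => δ) μ * bpow c μ := bpow_mul _ _ μ
    rw [e1, ← e2, e3, bpow_const, bpow_const]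
  let S1 := sub u (trunc (degSet _ d) G)
  have hS1 : S1 = ∑ μ ∈ degSet (Fin (n + 1)) d, C (coeff μ G) * bpow u.1 μ := by
    simp only [S1, trunc]
    rw [map_sum]
    refine Finset.sum_congr rfl fun μ _ => ?_
    rw [map_mul, sub_C]
    congr 1
    exact eval_mono _ _ _
  have hS0 : C (C (δ ^ d) * q) * X 0 ^ d =
      ∑ μ ∈ degSet (Fin (n + 1)) d, C (coeff μ G) * bpow v μ := by
    rw [hqdef, Finset.mul_sum, map_sum, Finset.sum_mul]
    refine Finset.sum_congr rfl fun μ hμ => ?_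
    rw [hvpow, mem_degSet.1 hμ]
    simp only [map_mul]
    ring
  have hn1 : ‖S1 - C (C (δ ^ d) * q) * X 0 ^ d‖ ≤ ‖G‖ * (‖δ‖ ^ d * ‖δ‖) := by
    rw [hS1, hS0, ← Finset.sum_sub_distrib]
    refine IsUltrametricDist.norm_sum_le_of_forall_le_of_nonneg (by positivity) fun μ hμ => ?_
    rw [← mul_sub]
    refine (norm_C_mul_le _ _).trans (mul_le_mul (norm_coeff_le _ _) ?_ (norm_nonneg _)
      (norm_nonneg _))
    have := norm_bpow_sub_le (norm_nonneg δ) (norm_nonneg δ) hu' hv hu μ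
    rwa [mem_degSet.1 hμ] at this
  have hn2 : ‖sub u R‖ ≤ ‖G‖ * (‖δ‖ ^ d * ‖δ‖) := by
    refine norm_eval_le_of _ _ _ (by positivity) fun ν => ?_
    rw [hR]
    split_ifs with h
    · simp only [norm_zero, zero_mul]
      positivity
    · refine mul_le_mul (norm_coeff_le _ _) ?_ (norm_nonneg _) (norm_nonneg _)
      refine (norm_bpow_le_pow (norm_nonneg _) hu' ν).trans ?_
      rw [← pow_succ]
      exact pow_le_pow_of_le_one (norm_nonneg _) hδ1.le (by omega)
  let κ : Tate (Tate K σ) (Fin (n + 1)) := C (C (ϖ * δ ^ d)⁻¹ * z)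
  have hκ : ‖κ‖ ≤ (‖ϖ‖ * ‖δ‖ ^ d)⁻¹ := by
    rw [norm_C]
    refine (norm_C_mul_le _ _).trans ?_
    rw [norm_inv, norm_mul, norm_pow]
    exact mul_le_of_le_one_right (by positivity) hz
  refine ⟨X 0 ^ d + κ * ((S1 - C (C (δ ^ d) * q) * X 0 ^ d) + sub u R), κ, ?_, ?_⟩
  · rw [add_sub_cancel_left]
    have hpos : 0 < ‖δ‖ ^ d := pow_pos (norm_pos_iff.2 hδ) _
    have hpos' : 0 < ‖ϖ‖ := norm_pos_iff.2 hϖ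
    calc _ ≤ (‖ϖ‖ * ‖δ‖ ^ d)⁻¹ * (‖G‖ * (‖δ‖ ^ d * ‖δ‖)) :=
          (norm_mul_le' _ _).trans (mul_le_mul hκ
            ((norm_add_le_max' _ _).trans (max_le hn1 hn2)) (norm_nonneg _) (by positivity))
      _ = (‖δ‖ * ‖G‖) / ‖ϖ‖ := by field_simp
      _ < 1 := (div_lt_one hpos').2 hδϖ
  · have e1 : sub u G = sub u (trunc low G) + S1 + sub u R := by
      simp only [S1]
      rw [← map_add, ← map_add]
      congr 1
      simp only [R]
      ring
    have e2 : κ * (C (C (δ ^ d) * q) * X 0 ^ d) = C (C ϖ⁻¹ * (q * z)) * X 0 ^ d := by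
      simp only [κ]
      rw [← mul_assoc, ← map_mul]
      congr 2
      have : (C ϖ⁻¹ : Tate K σ) = C (ϖ * δ ^ d)⁻¹ * C (δ ^ d) := by
        rw [← map_mul]
        congr 1
        field_simp
      rw [this]
      ring
    have e3 : (X 0 ^ d + κ * ((S1 - C (C (δ ^ d) * q) * X 0 ^ d) + sub u R)) - κ * sub u G =
        -(C (C ϖ⁻¹) * X 0 ^ d * C (q * z - C ϖ)) - κ * sub u (trunc low G) := by
      have e4 : (C (C ϖ⁻¹) * C (C ϖ) : Tate (Tate K σ) (Fin (n + 1))) = 1 := by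
        rw [← map_mul, ← map_mul, inv_mul_cancel₀ hϖ, map_one, map_one]
      simp only [map_mul] at e2
      rw [e1]
      simp only [map_mul, map_sub]
      linear_combination -e2 - X 0 ^ d * e4
    rw [e3]
    refine Ideal.sub_mem _ (neg_mem (Ideal.mul_mem_left _ _ (Ideal.mem_map_of_mem _ hq)))
      (Ideal.mul_mem_left _ _ ?_)
    refine sub_mem_exI u ?_
    exact Ideal.sum_mem _ fun μ hμ => Ideal.mul_mem_right _ _
      (Ideal.mem_map_of_mem _ (hG μ (hlow.1 hμ)))

end Numeric

variable {K : Type} [NormedField K] [CompleteSpace K] [IsAlgClosed K] [IsUltrametricDist K]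
  {σ τ : Type} [Finite σ] {U : Ultrafilter ℕ} {x : ℕ → Bl K σ} {a s t u : Type} [Fintype a]
  [Fintype s] [Fintype t] [Fintype u]

lemma fibExact_map [Finite τ] {σ' : Type} [Finite σ'] {Φ : Matrix a s (Tate (Tate K σ) τ)}
    {Sg : Matrix s t (Tate (Tate K σ) τ)} {I : Ideal (Tate K σ)} {I' : Ideal (Tate K σ')}
    {ι : CHom (Tate K σ) (Tate K σ')} (hι : ∀ f ∈ I, ι f ∈ I')
    (h1 : ∀ i j, (Φ * Sg) i j ∈ exI τ I)
    (h2 : ∀ y, I' ≤ mI y → ∃ y0, (∀ f, pt y (ι f) = pt y0 f) ∧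
      Ex (Φ.map (spec τ y0)) (Sg.map (spec τ y0))) :
    FibExact I' (Φ.map (map ι)) (Sg.map (map ι)) := by
  refine ⟨fun i j => ?_, fun y hy => ?_⟩
  · have : Φ.map (map ι) * Sg.map (map ι) = (Φ * Sg).map (map ι) :=
      (Matrix.map_mul (f := (map ι (τ := τ)).toRingHom)).symm
    rw [this]
    exact map_mem_exI hι (h1 i j)
  · obtain ⟨y0, h0, h⟩ := h2 y hy
    have e : ∀ {r r' : Type} (M : Matrix r r' (Tate (Tate K σ) τ)),
        (M.map (map ι)).map (spec τ y) = M.map (spec τ y0) := fun M =>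
      Matrix.ext fun i j => spec_map_of_pt h0 _
    rw [e, e]
    exact h

lemma map_mem_pI {σ' : Type} [Finite σ'] {x' : ℕ → Bl K σ'} {ι : CHom (Tate K σ) (Tate K σ')}
    (h : ∀ k f, pt (x' k) (ι f) = pt (x k) f) {f : Tate K σ} (hf : f ∈ pI U x) :
    ι f ∈ pI U x' := by
  rw [mem_pI] at hf ⊢
  simpa only [h] using hf

lemma thetaHom_comp {σ' : Type} [Finite σ'] {x' : ℕ → Bl K σ'} {ι : CHom (Tate K σ) (Tate K σ')}
    (h : ∀ k f, pt (x' k) (ι f) = pt (x k) f) (b b' : Bl (Tate K τ) τ)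
    (b0 : Bl (Tate (Tate K σ') τ) τ) (hb : ∀ y i, spec τ y (b0 i) = b i) (f : Tate (Tate K σ) τ) :
    thetaHom U x' b' (sub b0 (map ι f)) = thetaHom U x ((sub b').mapBl b) f := by
  have e1 : ∀ y, (spec τ y).comp (sub b0) = (sub b).comp (spec τ y) := fun y =>
    chom_ext (fun a => by simp) fun i => by simp [hb]
  have e2 : (sub b').comp (sub b) = sub ((sub b').mapBl b) :=
    chom_ext (fun a => by simp) fun i => by simp
  refine congrArg (UP.mk U) (Subtype.ext (funext fun k => ?_))
  change sub b' (spec τ (x' k) (sub b0 (map ι f))) = sub ((sub b').mapBl b) (spec τ (x k) f)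
  rw [← e2, ← spec_map_of_pt (h k)]
  exact congrArg (sub b') (congrArg (fun φ => φ (map ι f)) (e1 (x' k)))

lemma Ex.of_smul_one {R : Type*} [CommRing R] [DecidableEq s] {Φ : Matrix a s R} {Sg : Matrix s t R}
    {Ψ : Matrix s a R}
    {Θ : Matrix t s R} {c : R} (hc : IsUnit c) (h : c • (1 : Matrix s s R) - Ψ * Φ = Sg * Θ) : Ex Φ
        Sg := by
  intro w hw
  obtain ⟨e, he⟩ := hc.exists_right_inv
  refine ⟨e • Θ *ᵥ w, ?_⟩
  rw [mulVec_smul, mulVec_mulVec, ← h, sub_mulVec, ← mulVec_mulVec, hw, mulVec_zero, sub_zero,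
    smul_mulVec, one_mulVec, smul_smul, mul_comm, he, one_smul]

lemma coeff_zero_of_isEmpty' [IsEmpty τ] {B : Type} [NormedCommRing B] [IsUltrametricDist B]
    (f : Tate B τ) : C (f.coeff 0) = f := by
  classical
  ext ν
  rw [Subsingleton.elim ν 0, coeff_C, if_pos rfl]

lemma eLoc_zero (hK : ∃ c : K, c ≠ 0 ∧ ‖c‖ < 1) : ELoc K U 0 := by
  classical
  intro σ _ a s t _ _ _ Φ Sg x h
  obtain ⟨e, _, E, g, ν, Ψ, hν, hΨ, h1, h2⟩ := h.exists_augment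
  rw [Subsingleton.elim ν 0] at hν
  obtain ⟨ε, hε, hev⟩ := exists_eventually_le hν
  obtain ⟨ϖ, hϖ, hϖε, -⟩ := exists_norm_lt hK hε
  obtain ⟨x', ι, z, -, -, hx', hz, hy⟩ :=
    exists_invert hϖ (hev.mono fun k hk => hϖε.le.trans hk)
  have hg : C (coeff 0 g) = g := coeff_zero_of_isEmpty' g
  have hfib := fibExact_map (ι := ι) (fun f hf => map_mem_pI hx' hf) h1 (fun y hyI => by
    obtain ⟨y0, hy0, hpt, hne⟩ := hy y hyI
    refine ⟨y0, hpt, h2 y0 hy0 fun h0 => hne ?_⟩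
    rw [← hg, spec_C] at h0
    have := congrArg (coeff 0) h0
    simpa [coeff_C] using this)
  have hb : ∀ f, thetaHom U x' (XX K (Fin 0)) (map ι f) = thetaHom U x (XX K (Fin 0)) f := fun f => by
    refine congrArg (UP.mk U) (Subtype.ext (funext fun k => ?_))
    exact congrArg (sub _) (spec_map_of_pt (hx' k) f)
  refine ⟨XX K (Fin 0), fun j => j.elim0, Ex.of_fromCols (E := E.map (thetaHom U x (XX K (Fin 0)))) ?_⟩
  set θ := thetaHom U x (XX K (Fin 0))
  set θ' := thetaHom U x' (XX K (Fin 0))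
  set Φ' := fromCols Φ E
  set Sg' := fromRows Sg (0 : Matrix e t (Tate (Tate K σ) (Fin 0)))
  have e1 : fromCols (Φ.map θ) (E.map θ) = (Φ'.map (map ι)).map θ' :=
    Matrix.ext fun i j => by rcases j with j | j <;> exact (hb _).symm
  have e2 : fromRows (Sg.map θ) 0 = (Sg'.map (map ι)).map θ' := by
    refine Matrix.ext fun i j => ?_
    rcases i with i | i
    · exact (hb _).symm
    · refine Eq.trans ?_ (hb _).symm
      exact (map_zero θ).symm
  rw [e1, e2]
  have e3 : Φ'.map (map ι) * Ψ.map (map ι) = map ι g • 1 := by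
    have e4 : Φ'.map (map ι) * Ψ.map (map ι) = (Φ' * Ψ).map (map ι) :=
      (Matrix.map_mul (f := (map ι (τ := Fin 0)).toRingHom)).symm
    rw [e4, hΨ]
    exact smul_one_map (map ι (τ := Fin 0)).toRingHom g
  obtain ⟨Θ, hΘ⟩ := hfib.exists_eq_mul (map ι g • 1 - Ψ.map (map ι) * Φ'.map (map ι)) (fun i j => by
    rw [Matrix.mul_sub, ← Matrix.mul_assoc, e3, Matrix.mul_smul, Matrix.mul_one, Matrix.smul_mul,
      Matrix.one_mul, sub_self]
    exact Ideal.zero_mem _)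
  have e5 := map_map_eq_of_mem (θ := θ') (fun f hf => thetaHom_eq_zero hf) hΘ
  rw [Matrix.map_sub _ (fun _ _ => map_sub θ' _ _), Matrix.map_mul, Matrix.map_mul, smul_one_map] at e5
  refine Ex.of_smul_one (c := θ' (map ι g)) ?_ e5
  have e6 : θ' (C (ι (coeff 0 g) * z - C ϖ)) = 0 :=
    thetaHom_eq_zero (Ideal.mem_map_of_mem _ hz)
  have e7 : IsUnit (θ' (C (C ϖ))) := (((IsUnit.mk0 ϖ hϖ).map C).map C).map θ'
  rw [← hg, map_C]
  rw [map_sub, map_sub, sub_eq_zero, map_mul, map_mul] at e6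
  exact isUnit_of_mul_isUnit_left (e6 ▸ e7)

section Direction

variable {n : ℕ} (c : Fin (n + 1) → K) (δ : K)

/-- The linear substitution contracting the polydisc towards a line. -/
def dirMat (i : Fin (n + 1)) : Fin (n + 1) → K :=
  Fin.cases (δ * c i) fun j => if i = j.succ then δ * δ else 0

/-- The inverse of `dirMat`, up to the scalar `δ * δ`. -/
def dirInv : Fin (n + 1) → Fin (n + 1) → K :=
  Fin.cases (Fin.cases (δ * (c 0)⁻¹) fun _ => 0)
    fun i => Fin.cases (-(c i.succ * (c 0)⁻¹)) fun j => if i = j then 1 else 0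

variable {c δ} (hc : ∀ i, ‖c i‖ = 1) (hδ : ‖δ‖ < 1)
include hc hδ

lemma norm_dirMat_le (i j : Fin (n + 1)) : ‖dirMat c δ i j‖ ≤ 1 := by
  refine Fin.cases ?_ (fun j => ?_) j
  · simp [dirMat, hc, hδ.le]
  · simp only [dirMat, Fin.cases_succ]
    split_ifs
    · rw [norm_mul]
      exact mul_le_one₀ hδ.le (norm_nonneg _) hδ.le
    · simp

lemma norm_dirInv_le (i j : Fin (n + 1)) : ‖dirInv c δ i j‖ ≤ 1 := by
  refine Fin.cases (Fin.cases ?_ (fun j => ?_) j) (fun i => Fin.cases ?_ (fun j => ?_) j) i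
  · simp [dirInv, hc, hδ.le]
  · simp [dirInv]
  · simp [dirInv, hc]
  · simp only [dirInv, Fin.cases_succ]
    split_ifs <;> simp

omit hδ in
lemma dirMat_mul_dirInv (i j : Fin (n + 1)) :
    ∑ k, dirMat c δ i k * dirInv c δ k j = if i = j then δ * δ else 0 := by
  have h0 : c 0 ≠ 0 := norm_pos_iff.1 (by rw [hc]; exact one_pos)
  rw [Fin.sum_univ_succ]
  refine Fin.cases (Fin.cases ?_ (fun j => ?_) j) (fun i => Fin.cases ?_ (fun j => ?_) j) i
  · simp [dirMat, dirInv, (Fin.succ_ne_zero _).symm]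
    field_simp
  · simp [dirMat, dirInv, (Fin.succ_ne_zero _).symm]
  · simp [dirMat, dirInv, (Fin.succ_ne_zero _).symm]
    ring
  · simp [dirMat, dirInv, (Fin.succ_ne_zero _).symm]

omit hδ in
lemma dirInv_mul_dirMat (i j : Fin (n + 1)) :
    ∑ k, dirInv c δ i k * dirMat c δ k j = if i = j then δ * δ else 0 := by
  have h0 : c 0 ≠ 0 := norm_pos_iff.1 (by rw [hc]; exact one_pos)
  rw [Fin.sum_univ_succ]
  refine Fin.cases (Fin.cases ?_ (fun j => ?_) j) (fun i => Fin.cases ?_ (fun j => ?_) j) i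
  · simp [dirMat, dirInv, (Fin.succ_ne_zero _).symm]
    field_simp
  · simp [dirMat, dirInv, (Fin.succ_ne_zero _).symm]
  · simp [dirMat, dirInv, (Fin.succ_ne_zero _).symm]
    field_simp
    ring
  · simp [dirMat, dirInv, (Fin.succ_ne_zero _).symm]

end Direction

lemma norm_map_affBl_sub_le {n : ℕ} {c : Fin (n + 1) → K} {δ : K} (hc : ∀ i, ‖c i‖ = 1)
    (hδ : ‖δ‖ < 1) (i : Fin (n + 1)) :
    ‖map (CC (B := K) (τ := σ)) (affBl zeroBl (dirMat c δ) (norm_dirMat_le hc hδ) i) -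
      C (C (δ * c i)) * X 0‖ ≤ ‖δ‖ * ‖δ‖ := by
  have e : map (CC (B := K) (τ := σ)) (affBl zeroBl (dirMat c δ) (norm_dirMat_le hc hδ) i) -
      C (C (δ * c i)) * X 0 = ∑ j : Fin n, C (C (if i = j.succ then δ * δ else 0)) * X j.succ := by
    rw [affBl_apply, Fin.sum_univ_succ, zeroBl_apply, map_zero, zero_add, map_add, map_mul, map_sum]
    simp [dirMat]
  rw [e]
  refine IsUltrametricDist.norm_sum_le_of_forall_le_of_nonneg (by positivity) fun j _ => ?_
  refine (norm_C_mul_le _ _).trans ?_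
  refine (mul_le_of_le_one_right (norm_nonneg _) (norm_X_le _)).trans ?_
  rw [norm_C]
  split_ifs
  · exact (norm_mul _ _).le
  · simp only [norm_zero]
    positivity

lemma FibExact.substitute [Finite τ] {I : Ideal (Tate K σ)}
    {Φ : Matrix a s (Tate (Tate K σ) τ)} {Sg : Matrix s t (Tate (Tate K σ) τ)}
    (h : FibExact I Φ Sg) {u : Bl (Tate (Tate K σ) τ) τ} {b : Bl K σ → Bl (Tate K τ) τ}
    (hu : ∀ y i, spec τ y (u i) = b y i)
    (hb : ∀ y, I ≤ mI y →
      Ex ((Φ.map (spec τ y)).map (sub (b y))) ((Sg.map (spec τ y)).map (sub (b y)))) :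
    FibExact I (Φ.map (sub u)) (Sg.map (sub u)) := by
  refine ⟨fun i j => ?_, fun y hy => ?_⟩
  · have : Φ.map (sub u) * Sg.map (sub u) = (Φ * Sg).map (sub u) :=
      (Matrix.map_mul (f := (sub u).toRingHom)).symm
    rw [this]
    exact sub_mem_exI u (h.1 i j)
  · have e0 : (spec τ y).comp (sub u) = (sub (b y)).comp (spec τ y) :=
      chom_ext (fun a => by simp) fun i => by simp [hu]
    have e : ∀ {r r' : Type} (M : Matrix r r' (Tate (Tate K σ) τ)),
        (M.map (sub u)).map (spec τ y) = (M.map (spec τ y)).map (sub (b y)) := fun M =>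
      Matrix.ext fun i j => congrArg (fun φ => φ (M i j)) e0
    rw [e, e]
    exact hb y hy

lemma FibExact.restrict {n : ℕ} {I : Ideal (Tate K σ)}
    {Φ : Matrix a s (Tate (Tate K σ) (Fin n))} {Sg : Matrix s t (Tate (Tate K σ) (Fin n))}
    (h : FibExact I Φ Sg) {b : Bl (Tate K (Fin n)) (Fin n)}
    (hb : ∀ y, I ≤ mI y → Ex ((Φ.map (spec _ y)).map (sub b)) ((Sg.map (spec _ y)).map (sub b))) :
    FibExact I (Φ.map (sub ((map CC).mapBl b))) (Sg.map (sub ((map CC).mapBl b))) :=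
  h.substitute (b := fun _ => b) (fun y i => by simp [spec_map_CC]) hb

lemma eLoc_succ (hK : ∃ c : K, c ≠ 0 ∧ ‖c‖ < 1) {n : ℕ} (ih : ELoc K U n) : ELoc K U (n + 1) := by
  classical
  intro σ _ a s t _ _ _ Φ Sg x h
  obtain ⟨e, _, E, g, ν', Ψ, hν', hΨ, h1, h2⟩ := h.exists_augment
  have hex : ∃ d, ∃ ν : Fin (n + 1) →₀ ℕ, ν.degree = d ∧ coeff ν g ∉ pI U x := ⟨_, ν', rfl, hν'⟩
  obtain ⟨ν, hνd, hν⟩ := Nat.find_spec hex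
  have hmin : ∀ μ : Fin (n + 1) →₀ ℕ, μ.degree < ν.degree → coeff μ g ∈ pI U x := fun μ hμ => by
    by_contra hcon
    exact Nat.find_min hex (hνd ▸ hμ) ⟨μ, rfl, hcon⟩
  obtain ⟨c, hc, hp⟩ := exists_direction hK hν
  set d := ν.degree
  set p := ∑ μ ∈ degSet (Fin (n + 1)) d, C (bpow c μ) * coeff μ g with hpdef
  obtain ⟨ε, hε, hev⟩ := exists_eventually_le hp
  obtain ⟨ϖ, hϖ, hϖε, -⟩ := exists_norm_lt hK hε
  obtain ⟨x', ι, z, hz1, hιC, hx', hz, hy⟩ :=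
    exists_invert hϖ (hev.mono fun k hk => hϖε.le.trans hk)
  obtain ⟨δ, hδ, hδϖ, hδ1⟩ := exists_norm_lt hK
    (show 0 < ‖ϖ‖ / (‖map ι g‖ + 1) from div_pos (norm_pos_iff.2 hϖ) (by positivity))
  rw [lt_div_iff₀ (by positivity)] at hδϖ
  have hfib := fibExact_map (ι := ι) (fun f hf => map_mem_pI hx' hf) h1 (fun y hyI => by
    obtain ⟨y0, hy0, hpt, hne⟩ := hy y hyI
    refine ⟨y0, hpt, h2 y0 hy0 fun h0 => hne ?_⟩
    rw [hpdef, map_sum]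
    refine Finset.sum_eq_zero fun μ _ => ?_
    have := congrArg (coeff μ) h0
    rw [coeff_spec, coeff_zero] at this
    rw [map_mul, this, mul_zero])
  set b0 := affBl zeroBl (dirMat c δ) (norm_dirMat_le hc hδ1)
  set u := (map (CC (B := K) (τ := σ ⊕ Unit))).mapBl b0
  set Φ' := fromCols Φ E
  set Sg' := fromRows Sg (0 : Matrix e t (Tate (Tate K σ) (Fin (n + 1))))
  obtain ⟨ω, κ, hω, hκ⟩ := exists_weierstrass_sub (I := pI U x') (G := map ι g) (d := d) (z := z)
    (u := u) hc hϖ hδ (lt_of_le_of_lt (by nlinarith [norm_nonneg δ]) hδϖ) hδ1 hz1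
    (fun μ hμ => map_mem_pI hx' (hmin μ hμ)) (by
      convert hz using 3
      rw [hpdef, map_sum]
      refine Finset.sum_congr rfl fun μ _ => ?_
      rw [map_mul, hιC]
      rfl) fun i => norm_map_affBl_sub_le hc hδ1 i
  have hfib2 := hfib.restrict (b := b0) fun y hyI =>
    Ex.restrict (hfib.2 y hyI) (norm_dirMat_le hc hδ1) (norm_dirInv_le hc hδ1) (mul_ne_zero hδ hδ)
      (dirMat_mul_dirInv hc) (dirInv_mul_dirMat hc)
  obtain ⟨b', hb', hEx⟩ := ih.weierstrass (Ψ := κ • (Ψ.map (map ι)).map (sub u)) (ω := ω)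
    hfib2 (fun i j => by
      have e3 : (Φ'.map (map ι)).map (sub u) * (Ψ.map (map ι)).map (sub u) = sub u (map ι g) • 1 := by
        have e4 : (Φ'.map (map ι)).map (sub u) * (Ψ.map (map ι)).map (sub u) =
            (Φ' * Ψ).map ((sub u).comp (map ι)) :=
          (Matrix.map_mul (f := ((sub u).comp (map ι (τ := Fin (n + 1)))).toRingHom)).symm
        rw [e4, hΨ]
        exact smul_one_map ((sub u).comp (map ι (τ := Fin (n + 1)))).toRingHom g
      change ((Φ'.map (map ι)).map (sub u) * (κ • (Ψ.map (map ι)).map (sub u)) -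
        ω • (1 : Matrix a a (Tate (Tate K (σ ⊕ Unit)) (Fin (n + 1))))) i j ∈ _
      rw [Matrix.mul_smul, e3, smul_smul, ← sub_smul, Matrix.smul_apply, smul_eq_mul]
      refine Ideal.mul_mem_right _ _ ?_
      rw [← neg_sub]
      exact neg_mem hκ) hω
  refine ⟨(sub b').mapBl b0, fun j => ?_, ?_⟩
  · have e : (pt zeroBl).comp (sub b') = pt zeroBl :=
      chom_ext (fun a => by simp) fun i => by simp [pt_zero, hb']
    rw [CHom.mapBl_apply, ← pt_zero]
    refine (congrArg (fun φ => φ (b0 j)) e).trans ?_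
    simp [b0]
  · have hθ : ∀ f, thetaHom U x' b' (sub u (map ι f)) = thetaHom U x ((sub b').mapBl b0) f :=
      thetaHom_comp hx' b0 b' u fun y i => by simp [u, spec_map_CC]
    refine Ex.of_fromCols (E := E.map (thetaHom U x ((sub b').mapBl b0))) ?_
    convert hEx using 1
    · refine Matrix.ext fun i j => ?_
      rcases j with j | j <;> exact (hθ _).symm
    · refine Matrix.ext fun i j => ?_
      rcases i with i | i
      · exact (hθ _).symm
      · exact (map_zero (thetaHom U x ((sub b').mapBl b0))).symm.trans (hθ _).symm

theorem eLoc (hK : ∃ c : K, c ≠ 0 ∧ ‖c‖ < 1) (n : ℕ) : ELoc K U n := by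
  induction n with
  | zero => exact eLoc_zero hK
  | succ n ih => exact eLoc_succ hK ih

end Tate
end RigidQE
end

noncomputable section
namespace RigidQE

set_option linter.unusedSectionVars false

open Polynomial

section Det

variable {K : Type} [NormedField K] {R : Type} [CommRing R] [Algebra K R] {Ω : Type}
  {R' : Type} [CommRing R'] [Algebra K R'] {Ω' : Type}

/-- Two points have the same type with respect to `P` if the norms of the values of the
elements of `P` are ordered in the same way at both. -/
def SameType (e : Ω → R →ₐ[K] K) (P : Finset R) (ω ω' : Ω) : Prop :=
  ∀ p ∈ P, ∀ q ∈ P, (‖e ω p‖ ≤ ‖e ω q‖ ↔ ‖e ω' p‖ ≤ ‖e ω' q‖)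

/-- A function on `Ω` which only depends on the type with respect to some finite set. -/
def Det {α : Type*} (e : Ω → R →ₐ[K] K) (G : Ω → α) : Prop :=
  ∃ P : Finset R, ∀ ω ω', SameType e P ω ω' → G ω = G ω'

variable {e : Ω → R →ₐ[K] K} {α β γ : Type*}

lemma SameType.mono {P Q : Finset R} (h : P ⊆ Q) {ω ω' : Ω} (hs : SameType e Q ω ω') :
    SameType e P ω ω' := fun p hp q hq => hs p (h hp) q (h hq)

lemma SameType.eq_zero_iff {P : Finset R} {ω ω' : Ω} (hs : SameType e P ω ω') {p : R}
    (hp : p ∈ P) (h0 : 0 ∈ P) : e ω p = 0 ↔ e ω' p = 0 := by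
  simpa using hs p hp 0 h0

lemma Det.comp (g : α → β) {G : Ω → α} (hG : Det e G) : Det e fun ω => g (G ω) := by
  obtain ⟨P, hP⟩ := hG
  exact ⟨P, fun ω ω' h => congrArg g (hP ω ω' h)⟩

open Classical in
lemma Det.map₂ (g : α → β → γ) {G : Ω → α} {H : Ω → β} (hG : Det e G) (hH : Det e H) :
    Det e fun ω => g (G ω) (H ω) := by
  obtain ⟨P, hP⟩ := hG
  obtain ⟨Q, hQ⟩ := hH
  refine ⟨P ∪ Q, fun ω ω' h => ?_⟩
  simp only [hP ω ω' (h.mono Finset.subset_union_left), hQ ω ω' (h.mono Finset.subset_union_right)]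

lemma Det.const (a : α) : Det e fun _ => a := ⟨∅, fun _ _ _ => rfl⟩

open Classical in
lemma Det.pi {ι : Type*} [Finite ι] {G : ι → Ω → α} (hG : ∀ i, Det e (G i)) :
    Det e fun ω i => G i ω := by
  have := Fintype.ofFinite ι
  choose P hP using hG
  refine ⟨Finset.univ.biUnion P, fun ω ω' h => funext fun i => hP i ω ω' (h.mono ?_)⟩
  exact Finset.subset_biUnion_of_mem P (Finset.mem_univ i)

lemma Det.exists {ι : Type*} [Finite ι] {G : ι → Ω → Prop} (hG : ∀ i, Det e (G i)) :
    Det e fun ω => ∃ i, G i ω := (Det.pi hG).comp fun f => ∃ i, f i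

lemma Det.forall {ι : Type*} [Finite ι] {G : ι → Ω → Prop} (hG : ∀ i, Det e (G i)) :
    Det e fun ω => ∀ i, G i ω := (Det.pi hG).comp fun f => ∀ i, f i

lemma Det.and {G H : Ω → Prop} (hG : Det e G) (hH : Det e H) : Det e fun ω => G ω ∧ H ω :=
  Det.map₂ And hG hH

lemma Det.not {G : Ω → Prop} (hG : Det e G) : Det e fun ω => ¬ G ω := Det.comp Not hG

lemma det_le (p q : R) : Det e fun ω => ‖e ω p‖ ≤ ‖e ω q‖ := by
  classical
  exact ⟨{p, q}, fun ω ω' h => propext (h p (by simp) q (by simp))⟩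

lemma det_lt (p q : R) : Det e fun ω => ‖e ω p‖ < ‖e ω q‖ := by
  simpa using (det_le (e := e) q p).not

lemma det_eq_zero (p : R) : Det e fun ω => e ω p = 0 := by
  simpa using det_le (e := e) p 0

lemma Det.pullback {e' : Ω' → R' →ₐ[K] K} (ψ : R' →+* R) (g : Ω → Ω')
    (h : ∀ ω p, e ω (ψ p) = e' (g ω) p) {G : Ω' → α} (hG : Det e' G) :
    Det e fun ω => G (g ω) := by
  classical
  obtain ⟨P, hP⟩ := hG
  refine ⟨P.image ψ, fun ω ω' hs => hP _ _ fun p hp q hq => ?_⟩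
  have := hs (ψ p) (Finset.mem_image_of_mem _ hp) (ψ q) (Finset.mem_image_of_mem _ hq)
  simpa only [h] using this

/-- Determined sets are finite unions of finite intersections of comparison sets. -/
lemma Det.induction {S : Ω → Prop} (hS : Det e S) (B : Set Ω → Prop) (hempty : B ∅)
    (huniv : B Set.univ) (hunion : ∀ s t, B s → B t → B (s ∪ t))
    (hinter : ∀ s t, B s → B t → B (s ∩ t))
    (hle : ∀ p q : R, B {ω | ‖e ω p‖ ≤ ‖e ω q‖}) (hlt : ∀ p q : R, B {ω | ‖e ω p‖ < ‖e ω q‖}) :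
    B {ω | S ω} := by
  classical
  obtain ⟨P, hP⟩ := hS
  let ty : Ω → (P × P → Prop) := fun ω pq => ‖e ω pq.1‖ ≤ ‖e ω pq.2‖
  have := Fintype.ofFinite (P × P → Prop)
  have h : {ω | S ω} = (Finset.univ.filter fun τ => ∃ ω, S ω ∧ ty ω = τ).sup fun τ =>
      Finset.univ.inf fun pq : P × P => {ω | ty ω pq ↔ τ pq} := by
    ext ω
    simp only [Finset.sup_set_eq_biUnion, Finset.inf_set_eq_iInter, Finset.mem_filter,
      Finset.mem_univ, true_and, Set.iInter_true, Set.mem_iUnion, Set.mem_iInter,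
      Set.mem_ofPred_eq, exists_prop]
    constructor
    · exact fun h => ⟨ty ω, ⟨ω, h, rfl⟩, fun _ => Iff.rfl⟩
    · rintro ⟨τ, ⟨ω', h', rfl⟩, h⟩
      rw [hP ω ω' fun p hp q hq => h (⟨p, hp⟩, ⟨q, hq⟩)]
      exact h'
  rw [h]
  refine Finset.sup_induction hempty (fun s hs t ht => hunion s t hs ht) fun τ _ =>
    Finset.inf_induction huniv (fun s hs t ht => hinter s t hs ht) fun pq _ => ?_
  by_cases hτ : τ pq
  · simpa [hτ, ty] using hle pq.1 pq.2
  · simpa [hτ, ty] using hlt pq.2 pq.1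

/-- Evaluation of polynomials over `R` at a point of `Ω × K`. -/
def extEv (e : Ω → R →ₐ[K] K) (z : Ω × K) : R[X] →ₐ[K] K :=
  (aeval z.2).comp (mapAlgHom (e z.1))

@[simp] lemma extEv_apply (z : Ω × K) (p : R[X]) :
    extEv e z p = (p.map (e z.1 : R →+* K)).eval z.2 := by
  simp [extEv, Polynomial.aeval_def, Polynomial.eval₂_eq_eval_map]

end Det

section Peak

variable {K : Type} [NormedField K] [IsUltrametricDist K]

/-- The largest index at which a nonzero polynomial has a coefficient of maximal norm. -/
def peak (G : K[X]) : ℕ := sSup {i | G.coeff i ≠ 0 ∧ ∀ j, ‖G.coeff j‖ ≤ ‖G.coeff i‖}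

/-- `n` is the largest index at which `G` has a coefficient of maximal norm. -/
def IsPeak (G : K[X]) (n : ℕ) : Prop :=
  G.coeff n ≠ 0 ∧ (∀ j, ‖G.coeff j‖ ≤ ‖G.coeff n‖) ∧ ∀ j, n < j → ‖G.coeff j‖ < ‖G.coeff n‖

lemma IsPeak.peak_eq {G : K[X]} {n : ℕ} (h : IsPeak G n) : peak G = n := by
  refine IsGreatest.csSup_eq ⟨⟨h.1, h.2.1⟩, fun i hi => ?_⟩
  by_contra! hn
  exact absurd (h.2.2 i hn) (not_lt.2 (hi.2 n))

lemma exists_isPeak {G : K[X]} (hG : G ≠ 0) : ∃ n, IsPeak G n := by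
  classical
  obtain ⟨m, hm, hmax⟩ := G.support.exists_max_image (fun i => ‖G.coeff i‖)
    (Polynomial.support_nonempty.2 hG)
  have hne : (G.support.filter fun i => ‖G.coeff m‖ ≤ ‖G.coeff i‖).Nonempty := ⟨m, by simp_all⟩
  have h1 := Finset.max'_mem _ hne
  refine ⟨Finset.max' _ hne, ?_⟩
  set n := Finset.max' _ hne
  rw [Finset.mem_filter, mem_support_iff] at h1
  have h2 : ∀ j, ‖G.coeff j‖ ≤ ‖G.coeff m‖ := fun j => by
    by_cases hj : G.coeff j = 0
    · simp [hj]
    · exact hmax j (mem_support_iff.2 hj)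
  refine ⟨h1.1, fun j => (h2 j).trans h1.2, fun j hj => ?_⟩
  by_contra! hc
  have : j ≤ n := Finset.le_max' _ j (by
    rw [Finset.mem_filter, mem_support_iff]
    refine ⟨fun h0 => h1.1 ?_, h1.2.trans hc⟩
    simpa [h0] using hc)
  omega

lemma peak_zero : peak (0 : K[X]) = 0 := by simp [peak]

lemma IsPeak.mul {G H : K[X]} {m n : ℕ} (hG : IsPeak G m) (hH : IsPeak H n) :
    IsPeak (G * H) (m + n) := by
  have hpos : 0 < ‖G.coeff m‖ * ‖H.coeff n‖ := by
    have := hG.1; have := hH.1; positivity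
  have hterm : ∀ i j, ‖G.coeff i * H.coeff j‖ ≤ ‖G.coeff m‖ * ‖H.coeff n‖ := fun i j => by
    rw [norm_mul]; exact mul_le_mul (hG.2.1 i) (hH.2.1 j) (by positivity) (by positivity)
  have hterm' : ∀ i j, m < i ∨ n < j → ‖G.coeff i * H.coeff j‖ < ‖G.coeff m‖ * ‖H.coeff n‖ := by
    intro i j h
    rw [norm_mul]
    rcases h with h | h
    · exact (mul_le_mul_of_nonneg_left (hH.2.1 j) (by positivity)).trans_lt
        (mul_lt_mul_of_pos_right (hG.2.2 i h) (by have := hH.1; positivity))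
    · exact (mul_le_mul_of_nonneg_right (hG.2.1 i) (by positivity)).trans_lt
        (mul_lt_mul_of_pos_left (hH.2.2 j h) (by have := hG.1; positivity))
  have hsum : ∀ s : Finset (ℕ × ℕ), (∀ p ∈ s, m < p.1 ∨ n < p.2) →
      ‖∑ p ∈ s, G.coeff p.1 * H.coeff p.2‖ < ‖G.coeff m‖ * ‖H.coeff n‖ := by
    intro s hs
    rcases s.eq_empty_or_nonempty with rfl | hne
    · simpa using hpos
    · obtain ⟨p, hp, hle⟩ := IsUltrametricDist.exists_norm_finsetSum_le_of_nonempty hne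
        (fun p : ℕ × ℕ => G.coeff p.1 * H.coeff p.2)
      exact hle.trans_lt (hterm' _ _ (hs p hp))
  have hmain : ‖(G * H).coeff (m + n)‖ = ‖G.coeff m‖ * ‖H.coeff n‖ := by
    rw [coeff_mul, ← Finset.add_sum_erase _ _ (a := (m, n)) (by simp)]
    have h2 := hsum ((Finset.HasAntidiagonal.antidiagonal (m + n)).erase (m, n)) (by
      rintro ⟨i, j⟩ hij
      simp only [Finset.mem_erase, ne_eq, Prod.mk.injEq, Finset.HasAntidiagonal.mem_antidiagonal]
        at hij ⊢
      omega)
    rw [← norm_mul] at h2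
    rw [IsUltrametricDist.norm_add_eq_max_of_norm_ne_norm h2.ne', max_eq_left h2.le, norm_mul]
  refine ⟨fun h => by simp [h] at hmain; rcases hmain with h | h; exacts [hG.1 h, hH.1 h],
    fun k => ?_, fun k hk => ?_⟩
  · rw [hmain, coeff_mul]
    exact IsUltrametricDist.norm_sum_le_of_forall_le_of_nonneg hpos.le fun p _ => hterm _ _
  · rw [hmain, coeff_mul]
    refine hsum _ ?_
    rintro ⟨i, j⟩ hij
    simp only [Finset.HasAntidiagonal.mem_antidiagonal] at hij ⊢
    omega

lemma peak_mul {G H : K[X]} (hG : G ≠ 0) (hH : H ≠ 0) : peak (G * H) = peak G + peak H := by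
  obtain ⟨m, hm⟩ := exists_isPeak hG
  obtain ⟨n, hn⟩ := exists_isPeak hH
  rw [hm.peak_eq, hn.peak_eq, (hm.mul hn).peak_eq]

lemma peak_C (a : K) : peak (C a : K[X]) = 0 := by
  by_cases ha : a = 0
  · simp [ha, peak_zero]
  · refine IsPeak.peak_eq ⟨by simpa using ha, fun j => ?_, fun j hj => ?_⟩
    · rw [coeff_C]; split <;> simp
    · rw [coeff_C, if_neg (by omega)]; simpa using ha

lemma peak_multiset_prod (s : Multiset K[X]) (hs : ∀ G ∈ s, G ≠ 0) :
    peak s.prod = (s.map peak).sum := by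
  induction s using Multiset.induction_on with
  | empty => simpa using peak_C (1 : K)
  | cons G s ih =>
    have h0 : s.prod ≠ 0 := Multiset.prod_ne_zero fun h => hs 0 (Multiset.mem_cons_of_mem h) rfl
    rw [Multiset.prod_cons, peak_mul (hs G (by simp)) h0, Multiset.map_cons, Multiset.sum_cons,
      ih fun H hH => hs H (Multiset.mem_cons_of_mem hH)]

open Classical in
/-- The condition `b ≠ 0 ∧ ∀ i, ‖a i‖ ≤ ‖b‖` is detected by a difference of peaks. -/
lemma peak_sub_peak {r : ℕ} (a : ℕ → K) (b : K) :
    (peak (C b * X ^ (r + 1) + ∑ i ∈ Finset.range r, C (a i) * X ^ i) : ℤ) -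
      peak (C b * X ^ r + ∑ i ∈ Finset.range r, C (a i) * X ^ i) =
      if b ≠ 0 ∧ ∀ i < r, ‖a i‖ ≤ ‖b‖ then 1 else 0 := by
  have hc : ∀ s j, r ≤ s → (C b * X ^ s + ∑ i ∈ Finset.range r, C (a i) * X ^ i : K[X]).coeff j =
      if j < r then a j else if j = s then b else 0 := by
    intro s j hs
    simp only [coeff_add, coeff_C_mul_X_pow, finsetSum_coeff, Finset.sum_ite_eq, Finset.mem_range]
    split_ifs <;> first | omega | simp
  have h1 : ∀ s, r ≤ s → (b ≠ 0 ∧ ∀ i < r, ‖a i‖ ≤ ‖b‖) →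
      peak (C b * X ^ s + ∑ i ∈ Finset.range r, C (a i) * X ^ i) = s := by
    intro s hs hb
    refine IsPeak.peak_eq ⟨?_, fun j => ?_, fun j hj => ?_⟩
    · rw [hc s s hs, if_neg (by omega), if_pos rfl]; exact hb.1
    · rw [hc s s hs, if_neg (by omega), if_pos rfl, hc s j hs]
      split_ifs with h1 h2
      exacts [hb.2 j h1, le_rfl, by simp]
    · rw [hc s s hs, if_neg (by omega), if_pos rfl, hc s j hs, if_neg (by omega),
        if_neg (by omega)]
      simpa using hb.1
  split_ifs with h
  · rw [h1 _ (by omega) h, h1 _ le_rfl h]; push_cast; ring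
  · rw [sub_eq_zero, Nat.cast_inj]
    by_cases hb : b = 0
    · simp [hb]
    · have h3 : ∃ i < r, ‖b‖ < ‖a i‖ := by
        by_contra! h3; exact h ⟨hb, h3⟩
      obtain ⟨i₀, hi₀, hbi⟩ := h3
      unfold peak
      congr 1
      have key : ∀ s, r ≤ s →
          {i | (C b * X ^ s + ∑ i ∈ Finset.range r, C (a i) * X ^ i : K[X]).coeff i ≠ 0 ∧
            ∀ j, ‖(C b * X ^ s + ∑ i ∈ Finset.range r, C (a i) * X ^ i : K[X]).coeff j‖ ≤
              ‖(C b * X ^ s + ∑ i ∈ Finset.range r, C (a i) * X ^ i : K[X]).coeff i‖} =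
          {i | i < r ∧ a i ≠ 0 ∧ ∀ j < r, ‖a j‖ ≤ ‖a i‖} := by
        intro s hs
        ext i
        simp only [Set.mem_ofPred_eq, hc s _ hs]
        constructor
        · rintro ⟨h4, h5⟩
          have h6 := h5 i₀
          rw [if_pos hi₀] at h6
          have hir : i < r := by
            by_contra hir
            rw [if_neg hir] at h4 h6
            split_ifs at h4 h6
            · exact absurd h6 (not_le.2 hbi)
            · exact h4 rfl
          rw [if_pos hir] at h4
          refine ⟨hir, h4, fun j hj => ?_⟩
          simpa [hj, hir] using h5 j
        · rintro ⟨hir, h4, h5⟩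
          rw [if_pos hir]
          refine ⟨h4, fun j => ?_⟩
          split_ifs with h7 h8
          exacts [h5 j h7, hbi.le.trans (h5 _ hi₀), by simp]
      rw [key _ (Nat.le_succ r), key _ le_rfl]

end Peak

end RigidQE
end

noncomputable section
namespace RigidQE

set_option linter.unusedSectionVars false

open Polynomial

section Elim

variable {K : Type} [NormedField K] [IsAlgClosed K] [IsUltrametricDist K]
  {R : Type} [CommRing R] [Algebra K R] {Ω : Type} {e : Ω → R →ₐ[K] K}

lemma det_peak_trailingCoeff (F : R[X][X]) :
    Det e fun ω => peak (F.map (mapRingHom (e ω : R →+* K))).trailingCoeff := by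
  classical
  let P : Finset R := insert 0 (F.support.biUnion fun i =>
    (F.coeff i).support.image (F.coeff i).coeff)
  have hP : ∀ i j, (F.coeff i).coeff j ∈ P := fun i j => by
    by_cases h0 : (F.coeff i).coeff j = 0
    · rw [h0]; exact Finset.mem_insert_self _ _
    · refine Finset.mem_insert_of_mem (Finset.mem_biUnion.2 ⟨i, ?_, Finset.mem_image.2
        ⟨j, mem_support_iff.2 h0, rfl⟩⟩)
      rw [mem_support_iff]
      intro h
      simp [h] at h0
  refine ⟨P, fun ω ω' hs => ?_⟩
  have h0 : (0 : R) ∈ P := Finset.mem_insert_self _ _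
  have hsupp : (F.map (mapRingHom (e ω : R →+* K))).support =
      (F.map (mapRingHom (e ω' : R →+* K))).support := by
    ext i
    simp only [mem_support_iff, coeff_map, coe_mapRingHom, ne_eq, not_iff_not,
      Polynomial.ext_iff, coeff_zero, RingHom.coe_coe]
    exact forall_congr' fun j => hs.eq_zero_iff (hP i j) h0
  have hdeg : (F.map (mapRingHom (e ω : R →+* K))).natTrailingDegree =
      (F.map (mapRingHom (e ω' : R →+* K))).natTrailingDegree := by
    simp only [natTrailingDegree, trailingDegree, hsupp]
  simp only [trailingCoeff, hdeg, coeff_map, coe_mapRingHom, peak, RingHom.coe_coe]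
  congr 1
  ext i
  simp only [Set.mem_ofPred_eq, ne_eq]
  rw [hs.eq_zero_iff (hP _ i) h0]
  exact and_congr_right fun _ => forall_congr' fun j => hs _ (hP _ j) _ (hP _ i)

lemma trailingCoeff_C' {A : Type*} [Semiring A] (a : A) : (C a).trailingCoeff = a := by
  simp [trailingCoeff]

open Classical in
lemma trailingCoeff_X_add_C (ℓ : K[X]) : (X + C ℓ : K[X][X]).trailingCoeff =
    if ℓ = 0 then 1 else ℓ := by
  have h0 : (X + C ℓ : K[X][X]).coeff 0 = ℓ := by simp
  split_ifs with h
  · simp [h, trailingCoeff]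
  · rw [trailingCoeff, natTrailingDegree_eq_zero_of_constantCoeff_ne_zero, h0]
    simpa using h

lemma trailingCoeff_multiset_prod (s : Multiset K[X][X]) :
    s.prod.trailingCoeff = (s.map trailingCoeff).prod := by
  induction s using Multiset.induction_on with
  | empty => simpa using trailingCoeff_C' (1 : K[X])
  | cons G s ih => simp [trailingCoeff_mul, ih]

lemma peak_trailingCoeff_prod (s : Multiset K[X]) :
    peak (s.map fun ℓ => (X + C ℓ : K[X][X])).prod.trailingCoeff = (s.map peak).sum := by
  rw [trailingCoeff_multiset_prod, Multiset.map_map, peak_multiset_prod, Multiset.map_map]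
  · congr 1
    refine Multiset.map_congr rfl fun ℓ _ => ?_
    simp only [Function.comp, trailingCoeff_X_add_C]
    split_ifs with h
    · rw [h, peak_zero, ← C_1, peak_C]
    · rfl
  · intro G hG
    obtain ⟨ℓ, -, rfl⟩ := Multiset.mem_map.1 hG
    simp only [Function.comp, trailingCoeff_X_add_C]
    split_ifs with h
    exacts [one_ne_zero, h]

open Classical in
lemma det_sum_peak (h : R[X]) (d : ℕ) (hd : h.natDegree ≤ d) (ℓ : R[X][X]) :
    Det e fun ω => if e ω (h.coeff d) = 0 then 0 else ((h.map (e ω : R →+* K)).roots.map fun t =>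
      peak ((ℓ.map (mapRingHom (e ω : R →+* K))).eval (C t))).sum := by
  let F : R[X][X] := resultant (h.map ((C : R[X] →+* R[X][X]).comp C)) (C X + ℓ.map C) d ℓ.natDegree
  have key := Det.map₂ (fun a b => if a then 0 else b) (det_eq_zero (e := e) (h.coeff d))
    (det_peak_trailingCoeff (e := e) F)
  convert key using 2 with ω
  by_cases h0 : e ω (h.coeff d) = 0
  · simp [h0]
  rw [if_neg h0, if_neg h0]
  set φ : R →+* K := (e ω : R →+* K) with hφ
  have h0' : φ (h.coeff d) ≠ 0 := h0
  have hdeg : (h.map φ).natDegree = d := by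
    refine le_antisymm (natDegree_map_le.trans hd) (le_natDegree_of_ne_zero ?_)
    simpa using h0'
  have hFm : F.map (mapRingHom φ) = resultant ((h.map φ).map ((C : K[X] →+* K[X][X]).comp C))
      (C X + (ℓ.map (mapRingHom φ)).map C) d ℓ.natDegree := by
    rw [← coe_mapRingHom, ← resultant_map_map]
    congr 1
    · rw [Polynomial.map_map, Polynomial.map_map]
      congr 1
      ext a
      simp
    · rw [Polynomial.map_add, Polynomial.map_map, coe_mapRingHom, Polynomial.map_map]
      congr 1
      · simp
      · congr 1
        ext a <;> simp
  have hsp : (h.map φ).Splits := IsAlgClosed.splits _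
  have hinj : Function.Injective ((C : K[X] →+* K[X][X]).comp C) :=
    (C_injective).comp C_injective
  have hdeg' : ((h.map φ).map ((C : K[X] →+* K[X][X]).comp C)).natDegree = d := by
    rw [natDegree_map_eq_of_injective hinj, hdeg]
  have hn : (C X + (ℓ.map (mapRingHom φ)).map C : K[X][X][X]).natDegree ≤ ℓ.natDegree := by
    refine (natDegree_add_le _ _).trans (max_le (by simp) ?_)
    exact natDegree_map_le.trans natDegree_map_le
  rw [hFm]
  have := resultant_eq_prod_eval ((h.map φ).map ((C : K[X] →+* K[X][X]).comp C))
    (C X + (ℓ.map (mapRingHom φ)).map C) ℓ.natDegree hn (hsp.map _)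
  rw [hdeg'] at this
  rw [this, hsp.roots_map, leadingCoeff_map_of_injective hinj, Multiset.map_map]
  have h1 : (h.map φ).leadingCoeff ≠ 0 := by
    rw [leadingCoeff, hdeg]; simpa using h0'
  have h2 : ((h.map φ).roots.map ((fun x => eval x (C X + (ℓ.map (mapRingHom φ)).map C)) ∘
      ((C : K[X] →+* K[X][X]).comp C))).prod = (((h.map φ).roots.map fun t =>
        (ℓ.map (mapRingHom φ)).eval (C t)).map fun ℓ => (X + C ℓ : K[X][X])).prod := by
    rw [Multiset.map_map]
    congr 1
    refine Multiset.map_congr rfl fun t _ => ?_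
    simp [eval_map, eval₂_at_apply]
  have hlc : (((C : K[X] →+* K[X][X]).comp C) (h.map φ).leadingCoeff ^ ℓ.natDegree).trailingCoeff =
      C ((h.map φ).leadingCoeff ^ ℓ.natDegree) := by
    rw [RingHom.comp_apply, ← C_pow, ← C_pow, trailingCoeff_C']
  rw [h2, trailingCoeff_mul, hlc, peak_mul, peak_C, zero_add, peak_trailingCoeff_prod,
    Multiset.map_map]
  · rfl
  · exact C_ne_zero.2 (pow_ne_zero _ h1)
  · rw [Ne, trailingCoeff_eq_zero]
    refine Multiset.prod_ne_zero fun h => ?_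
    obtain ⟨ℓ, -, h⟩ := Multiset.mem_map.1 h
    exact (monic_X_add_C ℓ).ne_zero h

open Classical in
/-- The sum of `g` over the roots of `h` where the coefficient of degree `d` does not vanish. -/
def rootSum (e : Ω → R →ₐ[K] K) (h : R[X]) (d : ℕ) (g : Ω × K → ℤ) (ω : Ω) : ℤ :=
  if e ω (h.coeff d) = 0 then 0 else
    ((h.map (e ω : R →+* K)).roots.map fun t => g (ω, t)).sum

/-- The functions whose sum over the roots of `h` is determined by the type. -/
def rootGroup (e : Ω → R →ₐ[K] K) (h : R[X]) (d : ℕ) : AddSubgroup (Ω × K → ℤ) where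
  carrier := {g | Det e (rootSum e h d g)}
  zero_mem' := by
    have : rootSum e h d 0 = fun _ => 0 := by
      funext ω; simp [rootSum]
    change Det e _
    rw [this]
    exact Det.const 0
  add_mem' {g g'} hg hg' := by
    have : rootSum e h d (g + g') = fun ω => rootSum e h d g ω + rootSum e h d g' ω := by
      funext ω
      by_cases h0 : e ω (h.coeff d) = 0 <;> simp [rootSum, h0, Multiset.sum_map_add]
    change Det e _
    rw [this]
    exact Det.map₂ (· + ·) hg hg'
  neg_mem' {g} hg := by
    have : rootSum e h d (-g) = fun ω => -rootSum e h d g ω := by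
      funext ω
      by_cases h0 : e ω (h.coeff d) = 0 <;> simp [rootSum, h0]
    change Det e _
    rw [this]
    exact Det.comp (- ·) hg

/-- The set where `q ≠ 0` and all of the first `r` members of `p` are bounded by `q`. -/
def domSet (e : Ω → R →ₐ[K] K) (r : ℕ) (p : ℕ → R) (q : R) : Set Ω :=
  {z | e z q ≠ 0 ∧ ∀ i < r, ‖e z (p i)‖ ≤ ‖e z q‖}

lemma indicator_inter_one {Z : Type} (s t : Set Z) :
    (s ∩ t).indicator (1 : Z → ℤ) = s.indicator 1 * t.indicator 1 := by
  classical
  funext z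
  by_cases hs : z ∈ s <;> by_cases ht : z ∈ t <;> simp [hs, ht]

lemma domSet_inter (r r' : ℕ) (p p' : ℕ → R) (q q' : R) :
    domSet e r p q ∩ domSet e r' p' q' =
      domSet e (r + r') (fun i => if i < r then p i * q' else p' (i - r) * q) (q * q') := by
  ext z
  simp only [domSet, Set.mem_inter_iff, Set.mem_ofPred_eq, map_mul, ne_eq, mul_eq_zero, not_or]
  constructor
  · rintro ⟨⟨h1, h2⟩, h3, h4⟩
    refine ⟨⟨h1, h3⟩, fun i hi => ?_⟩
    split_ifs with h
    · rw [map_mul, norm_mul, norm_mul]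
      exact mul_le_mul_of_nonneg_right (h2 i h) (norm_nonneg _)
    · rw [map_mul, norm_mul, norm_mul, mul_comm]
      exact mul_le_mul_of_nonneg_left (h4 _ (by omega)) (norm_nonneg _)
  · rintro ⟨⟨h1, h3⟩, h⟩
    refine ⟨⟨h1, fun i hi => ?_⟩, h3, fun i hi => ?_⟩
    · have := h i (by omega)
      rw [if_pos hi, map_mul, norm_mul, norm_mul] at this
      exact le_of_mul_le_mul_right this (norm_pos_iff.2 h3)
    · have := h (r + i) (by omega)
      rw [if_neg (by omega), map_mul, norm_mul, norm_mul, Nat.add_sub_cancel_left, mul_comm] at this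
      exact le_of_mul_le_mul_left this (norm_pos_iff.2 h1)

/-- The indicator functions of the sets `domSet`. -/
def domMonoid (e : Ω → R →ₐ[K] K) : Submonoid (Ω → ℤ) where
  carrier := {g | ∃ r p q, g = (domSet e r p q).indicator 1}
  one_mem' := ⟨0, 0, 1, by funext z; simp [domSet]⟩
  mul_mem' := by
    rintro _ _ ⟨r, p, q, rfl⟩ ⟨r', p', q', rfl⟩
    exact ⟨_, _, _, by rw [← indicator_inter_one, domSet_inter]⟩

lemma domMonoid_le_rootGroup (h : R[X]) (d : ℕ) (hd : h.natDegree ≤ d) :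
    (domMonoid (extEv e) : Set (Ω × K → ℤ)) ⊆ rootGroup e h d := by
  classical
  rintro _ ⟨r, p, q, rfl⟩
  let ℓ : ℕ → R[X][X] := fun s => q.map C * C (X ^ s) +
    ∑ i ∈ Finset.range r, (p i).map C * C (X ^ i)
  have hC : ∀ ω, (mapRingHom (e ω : R →+* K)).comp C = (C : K →+* K[X]).comp (e ω : R →+* K) :=
    fun ω => by ext a; simp
  have h1 : ∀ (ω : Ω) (t : K) (f : R[X]), eval (C t) ((f.map C).map (mapRingHom (e ω : R →+* K))) =
      C (extEv e (ω, t) f) := fun ω t f => by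
    rw [Polynomial.map_map, hC, extEv_apply, ← Polynomial.map_map, eval_map, eval₂_at_apply]
  have h2 : ∀ (ω : Ω) (t : K) s, eval (C t) ((ℓ s).map (mapRingHom (e ω : R →+* K))) =
      C (extEv e (ω, t) q) * X ^ s +
        ∑ i ∈ Finset.range r, C (extEv e (ω, t) (p i)) * X ^ i := fun ω t s => by
    simp only [ℓ, Polynomial.map_add, eval_add, Polynomial.map_mul, eval_mul, h1,
      Polynomial.map_sum, eval_finsetSum, Polynomial.map_C, eval_C, coe_mapRingHom,
      Polynomial.map_pow, Polynomial.map_X]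
  have key := Det.map₂ (fun a b : ℕ => (a : ℤ) - b) (det_sum_peak (e := e) h d hd (ℓ (r + 1)))
    (det_sum_peak (e := e) h d hd (ℓ r))
  change Det e _
  convert key using 2 with ω
  rw [rootSum]
  split_ifs with h0
  · simp
  · simp only [h2]
    rw [Nat.cast_multiset_sum, Nat.cast_multiset_sum, Multiset.map_map, Multiset.map_map,
      ← Multiset.sum_map_sub]
    congr 1
    refine Multiset.map_congr rfl fun t _ => ?_
    simp only [Function.comp, peak_sub_peak, Set.indicator_apply, domSet, Set.mem_ofPred_eq,
      Pi.one_apply]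

lemma indicator_mem_closure {S : Ω → Prop} (hS : Det e S) :
    Set.indicator {ω | S ω} 1 ∈ Subring.closure (domMonoid e : Set (Ω → ℤ)) := by
  classical
  have hle : ∀ p q : R, Set.indicator {ω | ‖e ω p‖ ≤ ‖e ω q‖} 1 ∈
      Subring.closure (domMonoid e : Set (Ω → ℤ)) := fun p q => by
    have : Set.indicator {ω | ‖e ω p‖ ≤ ‖e ω q‖} (1 : Ω → ℤ) =
        (domSet e 1 (fun _ => p) q).indicator 1 + (1 - (domSet e 0 0 q).indicator 1) *
          (1 - (domSet e 0 0 p).indicator 1) := by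
      funext ω
      by_cases hp : e ω p = 0 <;> by_cases hq : e ω q = 0 <;>
        simp [domSet, hp, hq, Set.indicator_apply]
    have hm : ∀ r p q, (domSet e r p q).indicator 1 ∈
      Subring.closure (domMonoid e : Set (Ω → ℤ)) := fun r p q =>
        Subring.subset_closure ⟨r, p, q, rfl⟩
    rw [this]
    exact add_mem (hm _ _ _) (mul_mem (sub_mem (one_mem _) (hm _ _ _))
      (sub_mem (one_mem _) (hm _ _ _)))
  refine hS.induction (fun s => Set.indicator s 1 ∈ Subring.closure (domMonoid e : Set (Ω → ℤ)))
    ?_ ?_ (fun s t hs ht => ?_) (fun s t hs ht => ?_) hle fun p q => ?_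
  · rw [Set.indicator_empty]; exact zero_mem _
  · rw [Set.indicator_univ]; exact one_mem _
  · have : (s ∪ t).indicator (1 : Ω → ℤ) =
        s.indicator 1 + t.indicator 1 - s.indicator 1 * t.indicator 1 := by
      funext z
      by_cases hs : z ∈ s <;> by_cases ht : z ∈ t <;> simp [hs, ht]
    rw [this]
    exact sub_mem (add_mem hs ht) (mul_mem hs ht)
  · rw [indicator_inter_one]; exact mul_mem hs ht
  · have : Set.indicator {ω | ‖e ω p‖ < ‖e ω q‖} (1 : Ω → ℤ) =
        1 - Set.indicator {ω | ‖e ω q‖ ≤ ‖e ω p‖} 1 := by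
      funext z
      by_cases hz : ‖e z p‖ < ‖e z q‖
      · simp [hz, not_le.2 hz]
      · simp [hz, not_lt.1 hz]
    rw [this]
    exact sub_mem (one_mem _) (hle q p)

lemma det_rootSum {S : Ω × K → Prop} (hS : Det (extEv e) S) (h : R[X]) (d : ℕ)
    (hd : h.natDegree ≤ d) : Det e (rootSum e h d (Set.indicator {z | S z} 1)) := by
  have h1 := indicator_mem_closure hS
  rw [Subring.mem_closure_iff, Submonoid.closure_eq] at h1
  exact (AddSubgroup.closure_le (rootGroup e h d)).2 (domMonoid_le_rootGroup h d hd) h1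

/-- Elimination of an existential quantifier ranging over the roots of a polynomial. -/
lemma Det.exists_root {S : Ω × K → Prop} (hS : Det (extEv e) S) (f : R[X]) :
    Det e fun ω => ∃ t, f.map (e ω : R →+* K) ≠ 0 ∧ extEv e (ω, t) f = 0 ∧ S (ω, t) := by
  classical
  let F : ℕ → R[X] := fun d => ∑ i ∈ Finset.range (d + 1), monomial i (f.coeff i)
  have hFd : ∀ d, (F d).natDegree ≤ d := fun d =>
    natDegree_sum_le_of_forall_le _ _ fun i hi =>
      (natDegree_monomial_le _).trans (Nat.lt_succ_iff.1 (Finset.mem_range.1 hi))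
  have hFc : ∀ d i, (F d).coeff i = if i ≤ d then f.coeff i else 0 := fun d i => by
    simp [F, finsetSum_coeff, coeff_monomial]
  have key : ∀ d : Fin (f.natDegree + 1), Det e fun ω =>
      (∀ j : Fin (f.natDegree + 1), d < j → e ω (f.coeff j) = 0) ∧
      (e ω (f.coeff d) ≠ 0 ∧ rootSum e (F d) d (Set.indicator {z | S z} 1) ω ≠ 0) := fun d =>
    Det.and (Det.forall fun j => (det_eq_zero (f.coeff j)).comp fun P => d < j → P)
      ((det_eq_zero _).not.and ((det_rootSum hS _ _ (hFd d)).comp (· ≠ 0)))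
  convert Det.exists key using 2 with ω
  have hmap : ∀ d : Fin (f.natDegree + 1),
      (∀ j : Fin (f.natDegree + 1), d < j → e ω (f.coeff j) = 0) →
      (F d).map (e ω : R →+* K) = f.map (e ω : R →+* K) := by
    intro d hd
    ext i
    rw [coeff_map, coeff_map, hFc]
    split_ifs with hi
    · rfl
    · rw [map_zero]
      by_cases hi' : i < f.natDegree + 1
      · exact (hd ⟨i, hi'⟩ (by rw [Fin.lt_def]; simpa using hi)).symm
      · rw [coeff_eq_zero_of_natDegree_lt (by omega), map_zero]
  have hsum : ∀ s : Multiset K,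
      (s.map fun t => Set.indicator {z | S z} (1 : Ω × K → ℤ) (ω, t)).sum ≠ 0 ↔
      ∃ t ∈ s, S (ω, t) := by
    intro s
    have hnn : ∀ t, 0 ≤ Set.indicator {z | S z} (1 : Ω × K → ℤ) (ω, t) := fun t =>
      Set.indicator_nonneg (fun _ _ => by simp) _
    induction s using Multiset.induction_on with
    | empty => simp
    | cons t s ih =>
      have h0 : 0 ≤ (s.map fun t => Set.indicator {z | S z} (1 : Ω × K → ℤ) (ω, t)).sum :=
        Multiset.sum_nonneg fun a ha => by
          obtain ⟨t, -, rfl⟩ := Multiset.mem_map.1 ha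
          exact hnn t
      simp only [Multiset.map_cons, Multiset.sum_cons, Multiset.mem_cons, exists_eq_or_imp, ← ih]
      by_cases ht : S (ω, t)
      · simp only [Set.indicator_apply, Set.mem_ofPred_eq, ht, if_true, Pi.one_apply, true_or,
          iff_true] at h0 ⊢
        omega
      · simp [Set.indicator_apply, ht]
  constructor
  · rintro ⟨t, hf, hft, hSt⟩
    have hlt : (f.map (e ω : R →+* K)).natDegree < f.natDegree + 1 :=
      Nat.lt_succ_iff.2 natDegree_map_le
    have hd : ∀ j : Fin (f.natDegree + 1), (⟨_, hlt⟩ : Fin (f.natDegree + 1)) < j →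
        e ω (f.coeff j) = 0 := fun j hj => by
      have := coeff_eq_zero_of_natDegree_lt (p := f.map (e ω : R →+* K)) hj
      simpa using this
    have hne : e ω (f.coeff (f.map (e ω : R →+* K)).natDegree) ≠ 0 := by
      have := leadingCoeff_ne_zero.2 hf
      rwa [leadingCoeff, coeff_map] at this
    refine ⟨⟨_, hlt⟩, hd, hne, ?_⟩
    rw [rootSum, hmap _ hd, if_neg, hsum]
    · exact ⟨t, (mem_roots hf).2 (by simpa using hft), hSt⟩
    · rwa [hFc, if_pos le_rfl]
  · rintro ⟨d, hd, hne, hs⟩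
    have hf : f.map (e ω : R →+* K) ≠ 0 := fun h0 => hne (by
      simpa using congrArg (fun p => p.coeff d) h0)
    rw [rootSum, hmap _ hd, if_neg, hsum] at hs
    · obtain ⟨t, ht, hSt⟩ := hs
      exact ⟨t, hf, by simpa using (mem_roots hf).1 ht, hSt⟩
    · rwa [hFc, if_pos le_rfl]

end Elim

end RigidQE
end

noncomputable section
namespace RigidQE

set_option linter.unusedSectionVars false

open Polynomial

section Generic

lemma norm_sub_le_max' {E : Type*} [SeminormedAddCommGroup E] [IsUltrametricDist E] (x y : E) :
    ‖x - y‖ ≤ max ‖x‖ ‖y‖ := by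
  rw [sub_eq_add_neg, ← norm_neg y]
  exact IsUltrametricDist.norm_add_le_max _ _

variable {K : Type} [NormedField K] [IsAlgClosed K] [IsUltrametricDist K]

/-- `z` is generic for `H` if the norm of `H z` is the maximum of the norms of its terms. -/
def Gen (z : K) (H : K[X]) : Prop := ∀ k, ‖H.coeff k‖ * ‖z‖ ^ k ≤ ‖H.eval z‖

lemma Gen.mul {z : K} {G H : K[X]} (hG : Gen z G) (hH : Gen z H) : Gen z (G * H) := by
  intro k
  rw [coeff_mul, eval_mul, norm_mul, ← norm_pow, ← norm_mul, Finset.sum_mul]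
  refine IsUltrametricDist.norm_sum_le_of_forall_le_of_nonneg (by positivity) fun p hp => ?_
  rw [← Finset.HasAntidiagonal.mem_antidiagonal.1 hp]
  calc ‖G.coeff p.1 * H.coeff p.2 * z ^ (p.1 + p.2)‖
      = (‖G.coeff p.1‖ * ‖z‖ ^ p.1) * (‖H.coeff p.2‖ * ‖z‖ ^ p.2) := by
        simp only [norm_mul, norm_pow, pow_add]; ring
    _ ≤ _ := mul_le_mul (hG _) (hH _) (by positivity) (by positivity)

lemma gen_C (z a : K) : Gen z (C a) := fun k => by
  rcases k with _ | k <;> simp [coeff_C]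

lemma gen_X_sub_C {z r : K} (h : ‖z‖ ≤ ‖z - r‖) : Gen z (X - C r) := fun k => by
  rcases k with _ | _ | k
  · simp only [coeff_sub, coeff_X_zero, coeff_C_zero, zero_sub, norm_neg, pow_zero, mul_one,
      eval_sub, eval_X, eval_C]
    have := norm_sub_le_max' z (z - r)
    rw [sub_sub_cancel] at this
    exact this.trans (max_le h le_rfl)
  · simpa [coeff_X, coeff_C] using h
  · simp [coeff_X]

lemma gen_of_roots {z : K} {H : K[X]} (h : ∀ r ∈ H.roots, ‖z‖ ≤ ‖z - r‖) : Gen z H := by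
  rw [(IsAlgClosed.splits H).eq_prod_roots]
  refine (gen_C _ _).mul ?_
  generalize H.roots = s at h
  induction s using Multiset.induction_on with
  | empty => simpa using gen_C z 1
  | cons r s ih =>
    rw [Multiset.map_cons, Multiset.prod_cons]
    exact (gen_X_sub_C (h r (Multiset.mem_cons_self _ _))).mul
      (ih fun r' hr' => h r' (Multiset.mem_cons_of_mem hr'))

lemma norm_eval_le_norm_eval_iff {z : K} {G H : K[X]} (hG : Gen z G) (hH : Gen z H) {D : ℕ}
    (hGD : G.natDegree ≤ D) (hHD : H.natDegree ≤ D) : ‖G.eval z‖ ≤ ‖H.eval z‖ ↔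
      ∀ k ≤ D, ∃ l ≤ D, ‖G.coeff k‖ * ‖z‖ ^ k ≤ ‖H.coeff l‖ * ‖z‖ ^ l := by
  have key : ∀ F : K[X], F.natDegree ≤ D → ∃ l ≤ D, ‖F.eval z‖ ≤ ‖F.coeff l‖ * ‖z‖ ^ l := by
    intro F hF
    obtain ⟨l, hl, hle⟩ := IsUltrametricDist.exists_norm_finsetSum_le_of_nonempty
      (t := Finset.range (D + 1)) ⟨0, by simp⟩ (fun l => F.coeff l * z ^ l)
    refine ⟨l, by simpa [Nat.lt_succ_iff] using hl, ?_⟩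
    rw [eval_eq_sum_range' (Nat.lt_succ_iff.2 hF), ← norm_pow, ← norm_mul]
    exact hle
  constructor
  · intro h k _
    obtain ⟨l, hl, hle⟩ := key H hHD
    exact ⟨l, hl, (hG k).trans (h.trans hle)⟩
  · intro h
    obtain ⟨k, hk, hle⟩ := key G hGD
    obtain ⟨l, -, hle'⟩ := h k hk
    exact hle.trans (hle'.trans (hH l))

lemma exists_generic {E Z : Finset K} (hE : ∀ u ∈ E, ∀ v ∈ E, u ≠ v → 1 ≤ ‖u - v‖)
    (hcard : Z.card < E.card) {c : K} (hc : c ≠ 0) : ∃ u ∈ E, ∀ r ∈ Z, ‖c‖ ≤ ‖u * c - r‖ := by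
  by_contra! h
  choose! r hrZ hr using h
  obtain ⟨u, hu, v, hv, huv, he⟩ := Finset.exists_ne_map_eq_of_card_lt_of_maps_to hcard
    (f := r) (fun u hu => hrZ u hu)
  have h1 : ‖(u - v) * c‖ < ‖c‖ := by
    have h2 : (u - v) * c = (u * c - r u) - (v * c - r v) := by rw [he]; ring
    rw [h2]
    exact (norm_sub_le_max' _ _).trans_lt (max_lt (hr u hu) (hr v hv))
  rw [norm_mul] at h1
  have := norm_pos_iff.2 hc
  nlinarith [hE u hu v hv huv]

/-- `t` is a (scaled) threshold: an `n`-th root of `s * q / p`. -/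
def Thr (κ : Finset K) (D : ℕ) (s t : K) : Prop :=
  ∃ p ∈ κ, ∃ q ∈ κ, ∃ n, 1 ≤ n ∧ n ≤ D ∧ p ≠ 0 ∧ q ≠ 0 ∧ p * t ^ n = s * q

lemma Thr.exists_scale {κ : Finset K} {D : ℕ} {t : K} (h : Thr κ D 1 t) (s : K) (hs : s ≠ 0) :
    ∃ t', Thr κ D s t' ∧ (‖s‖ < 1 → ‖t'‖ < ‖t‖) ∧ (1 < ‖s‖ → ‖t‖ < ‖t'‖) := by
  obtain ⟨p, hp, q, hq, n, hn1, hn2, hp0, hq0, he⟩ := h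
  obtain ⟨t', ht'⟩ := IsAlgClosed.exists_pow_nat_eq (s * q / p) hn1
  have h1 : ‖t'‖ ^ n = ‖s‖ * ‖t‖ ^ n := by
    rw [← norm_pow, ← norm_pow, ← norm_mul, ht', mul_div_assoc, eq_div_of_mul_eq hp0
      ((mul_comm _ _).trans he), one_mul]
  have ht : 0 < ‖t‖ ^ n := by
    have : t ≠ 0 := by
      rintro rfl
      rw [zero_pow (by omega), mul_zero, one_mul] at he
      exact hq0 he.symm
    positivity
  refine ⟨t', ⟨p, hp, q, hq, n, hn1, hn2, hp0, hq0, by rw [ht']; field_simp⟩, fun h => ?_,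
    fun h => ?_⟩
  · exact lt_of_pow_lt_pow_left₀ n (norm_nonneg _) (by rw [h1]; nlinarith)
  · exact lt_of_pow_lt_pow_left₀ n (norm_nonneg _) (by rw [h1]; nlinarith)

lemma exists_thresholds {π : K} (hπ0 : π ≠ 0) (hπ : ‖π‖ < 1 ∨ ∀ x : K, x ≠ 0 → ‖x‖ = 1)
    {κ : Finset K} {D : ℕ} {z : K} (hz : z ≠ 0)
    {T : Finset K} (hT : ∀ t ∈ T, Thr κ D 1 t) (hT0 : ∀ t ∈ T, t ≠ 0) (hne : T.Nonempty) :
    ∃ s₁ s₂ c₁ c₂ : K, (s₁ = 1 ∨ s₁ = π ∨ s₁ = π⁻¹) ∧ (s₂ = 1 ∨ s₂ = π ∨ s₂ = π⁻¹) ∧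
      Thr κ D s₁ c₁ ∧ Thr κ D s₂ c₂ ∧ ((‖c₁‖ = ‖z‖ ∧ ‖c₂‖ = ‖z‖) ∨ (‖c₁‖ < ‖c₂‖ ∧
      ∀ t ∈ T, (‖t‖ < ‖z‖ ∧ ‖t‖ ≤ ‖c₁‖) ∨ (‖z‖ < ‖t‖ ∧ ‖c₂‖ ≤ ‖t‖))) := by
  classical
  by_cases h : ∃ t ∈ T, ‖t‖ = ‖z‖
  · obtain ⟨t, ht, htz⟩ := h
    exact ⟨1, 1, t, t, .inl rfl, .inl rfl, hT t ht, hT t ht, .inl ⟨htz, htz⟩⟩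
  push Not at h
  have hπ1 : ‖π‖ < 1 := by
    refine hπ.resolve_right fun h1 => ?_
    obtain ⟨t, ht⟩ := hne
    exact h t ht (by rw [h1 t (hT0 t ht), h1 z hz])
  have hlo : (∀ t ∈ T, ‖z‖ < ‖t‖) ∨ ∃ c ∈ T, ‖c‖ < ‖z‖ ∧ ∀ t ∈ T, ‖t‖ < ‖z‖ → ‖t‖ ≤ ‖c‖ := by
    rcases (T.filter fun t => ‖t‖ < ‖z‖).eq_empty_or_nonempty with h0 | h0
    · refine .inl fun t ht => lt_of_le_of_ne (not_lt.1 fun hlt => ?_) (h t ht).symm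
      exact Finset.notMem_empty t (h0 ▸ Finset.mem_filter.2 ⟨ht, hlt⟩)
    · obtain ⟨c, hc, hmax⟩ := Finset.exists_max_image _ (fun t => ‖t‖) h0
      rw [Finset.mem_filter] at hc
      exact .inr ⟨c, hc.1, hc.2, fun t ht h1 => hmax t (Finset.mem_filter.2 ⟨ht, h1⟩)⟩
  have hhi : (∀ t ∈ T, ‖t‖ < ‖z‖) ∨ ∃ c ∈ T, ‖z‖ < ‖c‖ ∧ ∀ t ∈ T, ‖z‖ < ‖t‖ → ‖c‖ ≤ ‖t‖ := by
    rcases (T.filter fun t => ‖z‖ < ‖t‖).eq_empty_or_nonempty with h0 | h0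
    · refine .inl fun t ht => lt_of_le_of_ne (not_lt.1 fun hlt => ?_) (h t ht)
      exact Finset.notMem_empty t (h0 ▸ Finset.mem_filter.2 ⟨ht, hlt⟩)
    · obtain ⟨c, hc, hmax⟩ := Finset.exists_min_image _ (fun t => ‖t‖) h0
      rw [Finset.mem_filter] at hc
      exact .inr ⟨c, hc.1, hc.2, fun t ht h1 => hmax t (Finset.mem_filter.2 ⟨ht, h1⟩)⟩
  rcases hlo with hlo | ⟨c₁, hc₁, hcz₁, hm₁⟩ <;> rcases hhi with hhi | ⟨c₂, hc₂, hcz₂, hm₂⟩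
  · obtain ⟨t, ht⟩ := hne
    exact absurd (hlo t ht) (hhi t ht).not_gt
  · obtain ⟨c₁, h1, h2, -⟩ := (hT c₂ hc₂).exists_scale π hπ0
    exact ⟨π, 1, c₁, c₂, .inr (.inl rfl), .inl rfl, h1, hT c₂ hc₂, .inr ⟨h2 hπ1,
      fun t ht => .inr ⟨hlo t ht, hm₂ t ht (hlo t ht)⟩⟩⟩
  · obtain ⟨c₂, h1, -, h2⟩ := (hT c₁ hc₁).exists_scale π⁻¹ (inv_ne_zero hπ0)
    refine ⟨1, π⁻¹, c₁, c₂, .inl rfl, .inr (.inr rfl), hT c₁ hc₁, h1, .inr ⟨h2 ?_,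
      fun t ht => .inl ⟨hhi t ht, hm₁ t ht (hhi t ht)⟩⟩⟩
    rw [norm_inv]
    exact (one_lt_inv₀ (norm_pos_iff.2 hπ0)).2 hπ1
  · refine ⟨1, 1, c₁, c₂, .inl rfl, .inl rfl, hT c₁ hc₁, hT c₂ hc₂, .inr ⟨hcz₁.trans hcz₂,
      fun t ht => ?_⟩⟩
    rcases lt_or_gt_of_ne (h t ht) with h1 | h1
    exacts [.inl ⟨h1, hm₁ t ht h1⟩, .inr ⟨h1, hm₂ t ht h1⟩]

lemma mul_pow_le_mul_pow_iff {a b γ γ' : ℝ} (hγ : 0 < γ) (hγ' : 0 < γ') (ha : 0 < a)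
    (hb : 0 < b) {k l : ℕ}
    (h : ∀ n, 1 ≤ n → n ≤ k + l → ∃ t, 0 ≤ t ∧ a * t ^ n = b ∧ (t ≤ γ ↔ t ≤ γ') ∧ (γ ≤ t ↔ γ' ≤ t))
    (h' : ∀ n, 1 ≤ n → n ≤ k + l → ∃ t, 0 ≤ t ∧ b * t ^ n = a ∧ (t ≤ γ ↔ t ≤ γ') ∧ (γ ≤ t ↔ γ' ≤ t)) :
    a * γ ^ k ≤ b * γ ^ l ↔ a * γ' ^ k ≤ b * γ' ^ l := by
  rcases lt_trichotomy k l with hkl | rfl | hkl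
  · obtain ⟨n, rfl⟩ := Nat.exists_eq_add_of_lt hkl
    obtain ⟨t, ht0, ht, h1, -⟩ := h' (n + 1) (by omega) (by omega)
    have key : ∀ x : ℝ, 0 < x → (a * x ^ k ≤ b * x ^ (k + n + 1) ↔ t ≤ x) := fun x hx => by
      rw [← ht, add_assoc, pow_add x, mul_assoc, mul_le_mul_iff_right₀ hb, mul_comm,
        mul_le_mul_iff_right₀ (pow_pos hx k), pow_le_pow_iff_left₀ ht0 hx.le (by omega)]
    rw [key γ hγ, key γ' hγ', h1]
  · rw [mul_le_mul_iff_left₀ (pow_pos hγ k), mul_le_mul_iff_left₀ (pow_pos hγ' k)]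
  · obtain ⟨n, rfl⟩ := Nat.exists_eq_add_of_lt hkl
    obtain ⟨t, ht0, ht, -, h1⟩ := h (n + 1) (by omega) (by omega)
    have key : ∀ x : ℝ, 0 < x → (a * x ^ (l + n + 1) ≤ b * x ^ l ↔ x ≤ t) := fun x hx => by
      rw [← ht, add_assoc, pow_add x, mul_assoc, mul_le_mul_iff_right₀ ha, mul_comm (t ^ _),
        mul_le_mul_iff_right₀ (pow_pos hx l), pow_le_pow_iff_left₀ hx.le ht0 (by omega)]
    rw [key γ hγ, key γ' hγ', h1]

/-- Every radius is equivalent, as far as comparisons of monomials with coefficients in `κ` are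
concerned, to the radius of a solution of one of finitely many binomial equations. -/
lemma exists_same_position {π : K} (hπ0 : π ≠ 0) (hπ : ‖π‖ < 1 ∨ ∀ x : K, x ≠ 0 → ‖x‖ = 1)
    {κ : Finset K} (h1 : 1 ∈ κ) {D : ℕ} (hD : 1 ≤ D) (z : K) :
    ∃ p₁ ∈ κ, ∃ q₁ ∈ κ, ∃ p₂ ∈ κ, ∃ q₂ ∈ κ, ∃ s₁ s₂ : K, ∃ n₁ n₂ : ℕ,
      (s₁ = 0 ∨ s₁ = 1 ∨ s₁ = π ∨ s₁ = π⁻¹) ∧ (s₂ = 0 ∨ s₂ = 1 ∨ s₂ = π ∨ s₂ = π⁻¹) ∧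
      1 ≤ n₁ ∧ n₁ ≤ 2 * D ∧ 1 ≤ n₂ ∧ n₂ ≤ 2 * D ∧ p₁ ≠ 0 ∧ p₂ ≠ 0 ∧ ∃ c : K,
      p₁ ^ n₂ * p₂ ^ n₁ * c ^ (2 * n₁ * n₂) = (s₁ * q₁) ^ n₂ * (s₂ * q₂) ^ n₁ ∧
      (c = 0 ↔ z = 0) ∧ ∀ a ∈ κ, ∀ b ∈ κ, ∀ k ≤ D, ∀ l ≤ D,
        (‖a‖ * ‖z‖ ^ k ≤ ‖b‖ * ‖z‖ ^ l ↔ ‖a‖ * ‖c‖ ^ k ≤ ‖b‖ * ‖c‖ ^ l) := by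
  classical
  by_cases hz : z = 0
  · exact ⟨1, h1, 1, h1, 1, h1, 1, h1, 0, 0, 1, 1, .inl rfl, .inl rfl, le_rfl, by omega, le_rfl,
      by omega, one_ne_zero, one_ne_zero, 0, by simp, by simp [hz], by simp [hz]⟩
  have hroot : ∀ p q : K, ∀ n : ℕ, ∃ t : K, p ≠ 0 → 1 ≤ n → p * t ^ n = 1 * q := fun p q n => by
    by_cases h : p ≠ 0 ∧ 1 ≤ n
    · obtain ⟨t, ht⟩ := IsAlgClosed.exists_pow_nat_eq (q / p) h.2
      exact ⟨t, fun _ _ => by rw [ht, one_mul, mul_div_cancel₀ _ h.1]⟩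
    · exact ⟨0, fun hp hn => absurd ⟨hp, hn⟩ h⟩
  choose ρ hρ using hroot
  let T : Finset K := ((κ ×ˢ κ ×ˢ Finset.Icc 1 (2 * D)).filter
    fun i => i.1 ≠ 0 ∧ i.2.1 ≠ 0).image fun i => ρ i.1 i.2.1 i.2.2
  have hmem : ∀ p ∈ κ, ∀ q ∈ κ, ∀ n, 1 ≤ n → n ≤ 2 * D → p ≠ 0 → q ≠ 0 → ρ p q n ∈ T :=
    fun p hp q hq n hn hn' hp0 hq0 => Finset.mem_image.2 ⟨(p, q, n), by simp [*], rfl⟩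
  have hT : ∀ t ∈ T, Thr κ (2 * D) 1 t := fun t ht => by
    obtain ⟨⟨p, q, n⟩, hi, rfl⟩ := Finset.mem_image.1 ht
    simp only [Finset.mem_filter, Finset.mem_product, Finset.mem_Icc] at hi
    exact ⟨p, hi.1.1, q, hi.1.2.1, n, hi.1.2.2.1, hi.1.2.2.2, hi.2.1, hi.2.2,
      hρ p q n hi.2.1 hi.1.2.2.1⟩
  have hT0 : ∀ t ∈ T, t ≠ 0 := fun t ht => by
    obtain ⟨p, hp, q, hq, n, hn1, hn2, hp0, hq0, he⟩ := hT t ht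
    rintro rfl
    rw [zero_pow (by omega), mul_zero, one_mul] at he
    exact hq0 he.symm
  obtain ⟨s₁, s₂, c₁, c₂, hs₁, hs₂, ⟨p₁, hp₁, q₁, hq₁, n₁, hn₁, hn₁', hp₁0, hq₁0, he₁⟩,
    ⟨p₂, hp₂, q₂, hq₂, n₂, hn₂, hn₂', hp₂0, hq₂0, he₂⟩, hpos⟩ :=
    exists_thresholds hπ0 hπ hz hT hT0
      ⟨ρ 1 1 1, hmem 1 h1 1 h1 1 le_rfl (by omega) one_ne_zero one_ne_zero⟩
  have hsne : ∀ s : K, (s = 1 ∨ s = π ∨ s = π⁻¹) → s ≠ 0 := by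
    rintro s (rfl | rfl | rfl)
    exacts [one_ne_zero, hπ0, inv_ne_zero hπ0]
  have hc₁ : c₁ ≠ 0 := by
    rintro rfl
    rw [zero_pow (by omega), mul_zero] at he₁
    exact mul_ne_zero (hsne _ hs₁) hq₁0 he₁.symm
  have hc₂ : c₂ ≠ 0 := by
    rintro rfl
    rw [zero_pow (by omega), mul_zero] at he₂
    exact mul_ne_zero (hsne _ hs₂) hq₂0 he₂.symm
  obtain ⟨c, hc⟩ := IsAlgClosed.exists_pow_nat_eq (c₁ * c₂) (n := 2) (by omega)
  have hc0 : c ≠ 0 := by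
    rintro rfl
    rw [zero_pow (by omega)] at hc
    exact mul_ne_zero hc₁ hc₂ hc.symm
  refine ⟨p₁, hp₁, q₁, hq₁, p₂, hp₂, q₂, hq₂, s₁, s₂, n₁, n₂, .inr hs₁, .inr hs₂, hn₁, hn₁', hn₂,
    hn₂', hp₁0, hp₂0, c, ?_, by simp [hc0, hz], ?_⟩
  · rw [← he₁, ← he₂, mul_assoc 2, pow_mul, hc]
    ring
  have hcn : ‖c‖ * ‖c‖ = ‖c₁‖ * ‖c₂‖ := by rw [← norm_mul, ← norm_mul, ← hc, pow_two]
  have hcp := norm_pos_iff.2 hc0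
  have hcp₁ := norm_pos_iff.2 hc₁
  have hcp₂ := norm_pos_iff.2 hc₂
  have hzp := norm_pos_iff.2 hz
  have hcmp : ∀ t ∈ T, (‖t‖ ≤ ‖z‖ ↔ ‖t‖ ≤ ‖c‖) ∧ (‖z‖ ≤ ‖t‖ ↔ ‖c‖ ≤ ‖t‖) := by
    intro t ht
    rcases hpos with ⟨h2, h3⟩ | ⟨h2, h3⟩
    · have : ‖c‖ = ‖z‖ := by rw [h2, h3] at hcn; nlinarith
      simp [this]
    · have h4 : ‖c₁‖ < ‖c‖ := by nlinarith
      have h5 : ‖c‖ < ‖c₂‖ := by nlinarith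
      rcases h3 t ht with ⟨h6, h7⟩ | ⟨h6, h7⟩
      · exact ⟨iff_of_true h6.le (h7.trans h4.le), iff_of_false (not_le.2 h6)
          (not_le.2 (h7.trans_lt h4))⟩
      · exact ⟨iff_of_false (not_le.2 h6) (not_le.2 (h5.trans_le h7)),
          iff_of_true h6.le (h5.le.trans h7)⟩
  intro a ha b hb k hk l hl
  by_cases ha0 : a = 0
  · simp only [ha0, norm_zero, zero_mul]
    exact iff_of_true (by positivity) (by positivity)
  by_cases hb0 : b = 0
  · simp only [hb0, norm_zero, zero_mul]
    have := norm_pos_iff.2 ha0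
    exact iff_of_false (not_le.2 (by positivity)) (not_le.2 (by positivity))
  refine mul_pow_le_mul_pow_iff hzp hcp (norm_pos_iff.2 ha0) (norm_pos_iff.2 hb0)
    (fun n hn hn' => ⟨‖ρ a b n‖, norm_nonneg _, ?_, hcmp _ (hmem a ha b hb n hn (by omega) ha0 hb0)⟩)
    (fun n hn hn' => ⟨‖ρ b a n‖, norm_nonneg _, ?_, hcmp _ (hmem b hb a ha n hn (by omega) hb0 ha0)⟩)
  · rw [← norm_pow, ← norm_mul, hρ a b n ha0 hn, one_mul]
  · rw [← norm_pow, ← norm_mul, hρ b a n hb0 hn, one_mul]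

end Generic

section Projection

variable {K : Type} [NormedField K] [CompleteSpace K] [IsAlgClosed K] [IsUltrametricDist K]
  {R : Type} [CommRing R] [Algebra K R] {Ω : Type} {e : Ω → R →ₐ[K] K}

variable (K) in
lemma exists_finset_units (M : ℕ) : ∃ E : Finset K, E.card = M ∧ (∀ u ∈ E, ‖u‖ = 1) ∧
    ∀ u ∈ E, ∀ v ∈ E, u ≠ v → 1 ≤ ‖u - v‖ := by
  classical
  obtain ⟨F, hF, hFM⟩ := ((Set.finite_singleton (0 : Ro K ⧸ RoMax
    K)).infinite_compl).exists_subset_card_eq M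
  let r : Ro K ⧸ RoMax K → Ro K := Quotient.out
  have hr : ∀ a, Ideal.Quotient.mk (RoMax K) (r a) = a := fun a => Quotient.out_eq a
  have hlt : ∀ x : Ro K, ‖(x : K)‖ < 1 ↔ Ideal.Quotient.mk (RoMax K) x = 0 := fun x =>
    (Ideal.Quotient.eq_zero_iff_mem (I := RoMax K)).symm
  have hinj : Function.Injective fun a => (r a : K) := fun a b h => by
    rw [← hr a, ← hr b, Subtype.ext h]
  refine ⟨F.image fun a => (r a : K), by rw [Finset.card_image_of_injective _ hinj, hFM], ?_, ?_⟩
  · simp only [Finset.mem_image, forall_exists_index, and_imp, forall_apply_eq_imp_iff₂]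
    intro a ha
    refine le_antisymm (r a).2 (not_lt.1 fun h => ?_)
    rw [hlt, hr] at h
    exact hF ha h
  · simp only [Finset.mem_image, forall_exists_index, and_imp, forall_apply_eq_imp_iff₂]
    intro a _ b _ hab
    by_contra! h
    have : ‖((r a - r b : Ro K) : K)‖ < 1 := h
    rw [hlt, map_sub, hr, hr, sub_eq_zero] at this
    exact hab (by rw [this])

variable (K) in
lemma exists_small : ∃ π : K, π ≠ 0 ∧ (‖π‖ < 1 ∨ ∀ x : K, x ≠ 0 → ‖x‖ = 1) := by
  by_cases h : ∃ π : K, π ≠ 0 ∧ ‖π‖ < 1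
  · obtain ⟨π, h0, h1⟩ := h
    exact ⟨π, h0, .inl h1⟩
  · push Not at h
    refine ⟨1, one_ne_zero, .inr fun x hx => le_antisymm ?_ (h x hx)⟩
    have := h x⁻¹ (inv_ne_zero hx)
    rw [norm_inv] at this
    exact (one_le_inv₀ (norm_pos_iff.2 hx)).1 this

lemma hasseDeriv_map {A B : Type*} [CommRing A] [CommRing B] (φ : A →+* B) (k : ℕ) (p : A[X]) :
    (hasseDeriv k p).map φ = hasseDeriv k (p.map φ) := by
  ext n
  simp [hasseDeriv_coeff]

/-- Quantifier elimination for one variable. -/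
lemma Det.exists_point {S : Ω × K → Prop} (hS : Det (extEv e) S) :
    Det e fun ω => ∃ y, S (ω, y) := by
  classical
  have hS' := hS
  obtain ⟨P₀, hP₀⟩ := hS
  let P : Finset R[X] := insert X P₀
  let D : ℕ := P.sup natDegree + 1
  have hDP : ∀ p ∈ P, p.natDegree ≤ D := fun p hp =>
    (Finset.le_sup (f := natDegree) hp).trans (Nat.le_succ _)
  let κ : Finset R[X] := insert 1 (P.biUnion fun p =>
    (Finset.range (D + 1)).image fun k => hasseDeriv k p)
  obtain ⟨E, hEM, hE1, hE⟩ := exists_finset_units K ((∑ p ∈ P, p.natDegree) + 1)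
  obtain ⟨π, hπ0, hπ⟩ := exists_small K
  let Sg : Finset K := {0, 1, π, π⁻¹}
  let eq : κ × κ × κ × κ × Sg × Sg × Fin (2 * D + 1) × Fin (2 * D + 1) → R[X][X] :=
    fun ⟨p₁, q₁, p₂, q₂, s₁, s₂, n₁, n₂⟩ =>
      C ((p₁ : R[X]) ^ (n₂ : ℕ) * (p₂ : R[X]) ^ (n₁ : ℕ)) * X ^ (2 * (n₁ : ℕ) * n₂) -
      C ((algebraMap K R[X] s₁ * q₁) ^ (n₂ : ℕ) * (algebraMap K R[X] s₂ * q₂) ^ (n₁ : ℕ))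
  have hpull : ∀ u : E, Det (extEv (extEv e)) fun z : (Ω × K) × K => S (z.1.1, z.1.2 + u * z.2) := by
    intro u
    refine hS'.pullback (eval₂RingHom ((C : R[X] →+* R[X][X]).comp C)
      (C X + C (algebraMap K R[X] u) * X))
      (fun z : (Ω × K) × K => (z.1.1, z.1.2 + u * z.2)) ?_
    intro z p
    have : ((extEv (extEv e) z : R[X][X] →+* K).comp (eval₂RingHom ((C : R[X] →+* R[X][X]).comp C)
        (C X + C (algebraMap K R[X] u) * X))) =
        (extEv e (z.1.1, z.1.2 + u * z.2) : R[X] →+* K) := by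
      refine Polynomial.ringHom_ext (fun a => ?_) ?_
      · simp
      · simp only [RingHom.comp_apply, coe_eval₂RingHom, eval₂_X, RingHom.coe_coe, map_add, map_mul]
        simp only [extEv_apply, Polynomial.map_C, Polynomial.map_X, eval_C, eval_X, RingHom.coe_coe,
          AlgHom.commutes, Algebra.algebraMap_self, RingHom.id_apply]
    exact RingHom.congr_fun this p
  have key := Det.exists (e := e) fun i : P × (κ × κ × κ × κ × Sg × Sg × Fin (2 * D + 1) ×
    Fin (2 * D + 1)) × E => ((hpull i.2.2).exists_root (eq i.2.1)).exists_root (i.1 : R[X])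
  convert key using 2 with ω
  constructor
  swap
  · rintro ⟨i, t, -, -, c, -, -, h⟩
    exact ⟨_, h⟩
  rintro ⟨y, hy⟩
  set φ : R →+* K := (e ω : R →+* K) with hφ
  let Zr : Finset K := P.biUnion fun p => (p.map φ).roots.toFinset
  have hZr : Zr.Nonempty := ⟨0, Finset.mem_biUnion.2 ⟨X, Finset.mem_insert_self _ _, by simp⟩⟩
  obtain ⟨t, ht, hmin⟩ := Finset.exists_min_image Zr (fun r => ‖y - r‖) hZr
  obtain ⟨p, hp, hpt⟩ := Finset.mem_biUnion.1 ht
  rw [Multiset.mem_toFinset] at hpt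
  have hpne : p.map φ ≠ 0 := by rintro h0; simp [h0] at hpt
  let ψ := extEv e (ω, t)
  have hcoef : ∀ p ∈ P, ∀ k ≤ D, (taylor t (p.map φ)).coeff k ∈ κ.image ψ := by
    intro p hp k hk
    refine Finset.mem_image.2 ⟨hasseDeriv k p, Finset.mem_insert_of_mem (Finset.mem_biUnion.2
      ⟨p, hp, Finset.mem_image.2 ⟨k, Finset.mem_range.2 (Nat.lt_succ_of_le hk), rfl⟩⟩), ?_⟩
    simp only [ψ, extEv_apply, taylor_coeff, hasseDeriv_map, hφ]
  obtain ⟨_, hp₁, _, hq₁, _, hp₂, _, hq₂, s₁, s₂, n₁, n₂, hs₁, hs₂, hn₁, hn₁', hn₂, hn₂',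
    hp₁0, hp₂0, c, hc, hc0, hcmp⟩ := exists_same_position hπ0 hπ (κ := κ.image ψ)
      (Finset.mem_image.2 ⟨1, Finset.mem_insert_self _ _, map_one ψ⟩)
      (Nat.le_add_left 1 (P.sup natDegree)) (y - t)
  obtain ⟨p₁, hp₁κ, rfl⟩ := Finset.mem_image.1 hp₁
  obtain ⟨q₁, hq₁κ, rfl⟩ := Finset.mem_image.1 hq₁
  obtain ⟨p₂, hp₂κ, rfl⟩ := Finset.mem_image.1 hp₂
  obtain ⟨q₂, hq₂κ, rfl⟩ := Finset.mem_image.1 hq₂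
  have hu : ∃ u ∈ E, S (ω, t + u * c) := by
    by_cases h0 : c = 0
    · have hne : E.Nonempty := by rw [← Finset.card_pos, hEM]; omega
      obtain ⟨u, hu⟩ := hne
      refine ⟨u, hu, ?_⟩
      rw [h0, mul_zero, add_zero, ← sub_eq_zero.1 (hc0.1 h0)]
      exact hy
    let Z : Finset K := P.biUnion fun p => (taylor t (p.map φ)).roots.toFinset
    have hZ : Z.card < E.card := by
      rw [hEM]
      refine Nat.lt_succ_of_le (Finset.card_biUnion_le.trans (Finset.sum_le_sum fun p _ => ?_))
      refine (Multiset.toFinset_card_le _).trans ((card_roots' _).trans ?_)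
      rw [natDegree_taylor]
      exact natDegree_map_le
    obtain ⟨u, hu, hgen⟩ := exists_generic hE hZ h0
    refine ⟨u, hu, ?_⟩
    have huc : ‖u * c‖ = ‖c‖ := by rw [norm_mul, hE1 u hu, one_mul]
    have hg1 : ∀ p ∈ P, Gen (u * c) (taylor t (p.map φ)) := fun p hp => gen_of_roots fun r hr => by
      rw [huc]
      exact hgen r (Finset.mem_biUnion.2 ⟨p, hp, Multiset.mem_toFinset.2 hr⟩)
    have hg2 : ∀ p ∈ P, Gen (y - t) (taylor t (p.map φ)) := fun p hp => gen_of_roots fun r hr => by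
      rw [sub_sub, add_comm t]
      refine hmin _ (Finset.mem_biUnion.2 ⟨p, hp, Multiset.mem_toFinset.2 ?_⟩)
      have h1 : taylor t (p.map φ) ≠ 0 := by rintro h; simp [h] at hr
      rw [mem_roots h1, IsRoot, taylor_eval] at hr
      refine (mem_roots ?_).2 hr
      rintro h; simp [h] at h1
    have hev : ∀ (p : R[X]) (z : K), extEv e (ω, t + z) p = (taylor t (p.map φ)).eval z :=
      fun p z => by rw [extEv_apply, taylor_eval, add_comm]
    have hdeg : ∀ p ∈ P, (taylor t (p.map φ)).natDegree ≤ D := fun p hp => by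
      rw [natDegree_taylor]
      exact natDegree_map_le.trans (hDP p hp)
    have h2 := hP₀ (ω, t + (y - t)) (ω, t + u * c) fun p hp q hq => by
      have hp := Finset.mem_insert_of_mem (b := X) hp
      have hq := Finset.mem_insert_of_mem (b := X) hq
      rw [hev, hev, hev, hev,
        norm_eval_le_norm_eval_iff (hg1 p hp) (hg1 q hq) (hdeg p hp) (hdeg q hq),
        norm_eval_le_norm_eval_iff (hg2 p hp) (hg2 q hq) (hdeg p hp) (hdeg q hq), huc]
      refine forall_congr' fun k => forall_congr' fun hk => exists_congr fun l =>
        and_congr_right fun hl => ?_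
      exact hcmp _ (hcoef p hp k hk) _ (hcoef q hq l hl) k hk l hl
    rw [← h2, add_sub_cancel]
    exact hy
  obtain ⟨u, hu, hSu⟩ := hu
  have hSg : ∀ s : K, (s = 0 ∨ s = 1 ∨ s = π ∨ s = π⁻¹) → s ∈ Sg := fun s hs => by
    simpa [Sg] using hs
  have hpt' : ψ p = 0 := by
    simpa [ψ, extEv_apply] using (mem_roots hpne).1 hpt
  refine ⟨⟨⟨p, hp⟩, ⟨⟨p₁, hp₁κ⟩, ⟨q₁, hq₁κ⟩, ⟨p₂, hp₂κ⟩, ⟨q₂, hq₂κ⟩, ⟨s₁, hSg s₁ hs₁⟩,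
    ⟨s₂, hSg s₂ hs₂⟩, ⟨n₁, by omega⟩, ⟨n₂, by omega⟩⟩, ⟨u, hu⟩⟩, t, hpne, hpt', c, ?_, ?_, hSu⟩
  · have hA : (ψ p₁ ^ n₂ * ψ p₂ ^ n₁) ≠ 0 := mul_ne_zero (pow_ne_zero _ hp₁0) (pow_ne_zero _ hp₂0)
    intro h0
    have h2 : 2 * n₁ * n₂ ≠ 0 := by positivity
    refine hA ?_
    have h1 := congrArg (fun f => f.coeff (2 * n₁ * n₂)) h0
    simp only [eq, Polynomial.map_sub, Polynomial.map_mul, Polynomial.map_pow,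
      Polynomial.map_X, ← C_mul, ← C_pow, Polynomial.map_C, coeff_sub, coeff_C_mul,
      coeff_X_pow_self, mul_one, coeff_C_of_ne_zero h2, sub_zero, coeff_zero] at h1
    simpa [ψ] using h1
  · simp only [eq, map_sub, map_mul, map_pow]
    simp only [extEv_apply, Polynomial.map_C, Polynomial.map_X, eval_C, eval_X, RingHom.coe_coe,
      AlgHom.commutes, Algebra.algebraMap_self, RingHom.id_apply] at hc ⊢
    rw [sub_eq_zero]
    exact hc

end Projection

end RigidQE
end

noncomputable section
namespace RigidQE

set_option linter.unusedSectionVars false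

section Projections

variable {K : Type} [NormedField K] [CompleteSpace K] [IsAlgClosed K] [IsUltrametricDist K]
  {R : Type} [CommRing R] [Algebra K R] {Ω : Type} {e : Ω → R →ₐ[K] K}

/-- Evaluation of polynomials in `n` variables over `R` at a point of `Ω × Kⁿ`. -/
def evN (n : ℕ) (e : Ω → R →ₐ[K] K) (z : Ω × (Fin n → K)) : MvPolynomial (Fin n) R →ₐ[K] K :=
  (MvPolynomial.aeval z.2).comp (MvPolynomial.mapAlgHom (e z.1))

@[simp] lemma evN_C (n : ℕ) (z : Ω × (Fin n → K)) (a : R) :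
    evN n e z (MvPolynomial.C a) = e z.1 a := by
  simp [evN]

@[simp] lemma evN_X (n : ℕ) (z : Ω × (Fin n → K)) (i : Fin n) :
    evN n e z (MvPolynomial.X i) = z.2 i := by
  simp [evN]

/-- Quantifier elimination for several variables. -/
lemma Det.exists_points {n : ℕ} {S : Ω × (Fin n → K) → Prop} (hS : Det (evN n e) S) :
    Det e fun ω => ∃ y, S (ω, y) := by
  induction n with
  | zero =>
    have h := hS.pullback (e := e) (MvPolynomial.eval₂Hom (RingHom.id R) Fin.elim0)
      (fun ω => (ω, Fin.elim0)) fun ω p => by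
        have : ((e ω : R →+* K).comp (MvPolynomial.eval₂Hom (RingHom.id R) Fin.elim0)) =
            (evN 0 e (ω, Fin.elim0) : MvPolynomial (Fin 0) R →+* K) :=
          MvPolynomial.ringHom_ext (fun a => by simp) (fun i => i.elim0)
        exact RingHom.congr_fun this p
    convert h using 2 with ω
    exact ⟨fun ⟨y, hy⟩ => by rwa [Subsingleton.elim Fin.elim0 y], fun h => ⟨_, h⟩⟩
  | succ n ih =>
    have h1 : Det (extEv (evN n e)) fun z : (Ω × (Fin n → K)) × K =>
        S (z.1.1, Fin.cons z.2 z.1.2) := by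
      refine hS.pullback (RingHomClass.toRingHom (MvPolynomial.finSuccEquiv R n))
        (fun z : (Ω × (Fin n → K)) × K => (z.1.1, Fin.cons z.2 z.1.2)) fun z p => ?_
      have : ((extEv (evN n e) z : Polynomial (MvPolynomial (Fin n) R) →+* K).comp
          (RingHomClass.toRingHom (MvPolynomial.finSuccEquiv R n))) =
          (evN (n + 1) e (z.1.1, Fin.cons z.2 z.1.2) : MvPolynomial (Fin (n + 1)) R →+* K) := by
        refine MvPolynomial.ringHom_ext (fun a => ?_) (fun i => ?_)
        · simp [MvPolynomial.finSuccEquiv_apply]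
        · refine Fin.cases ?_ (fun i => ?_) i
          · simp [MvPolynomial.finSuccEquiv_X_zero]
          · simp [MvPolynomial.finSuccEquiv_X_succ]
      exact RingHom.congr_fun this p
    convert ih h1.exists_point using 2 with ω
    constructor
    · rintro ⟨y, hy⟩
      exact ⟨Fin.tail y, y 0, by simpa using hy⟩
    · rintro ⟨y, t, h⟩
      exact ⟨_, h⟩

end Projections

section Semianalytic

variable {K : Type} [NormedField K] [CompleteSpace K] [IsAlgClosed K] [IsUltrametricDist K]
  {X : Affinoid K}

lemma isBasicSemianalytic_of_fintype {ι κ : Type*} [Fintype ι] [Fintype κ] (p q : ι → X.O)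
    (p' q' : κ → X.O) : IsBasicSemianalytic X {x |
      (∀ i, ‖(p i : X.carrier → K) x‖ ≤ ‖(q i : X.carrier → K) x‖) ∧
      ∀ i, ‖(p' i : X.carrier → K) x‖ < ‖(q' i : X.carrier → K) x‖} := by
  let e := Fintype.equivFin ι
  let e' := Fintype.equivFin κ
  refine ⟨Fintype.card ι + Fintype.card κ, Fintype.card ι,
    Fin.append (p ∘ e.symm) (p' ∘ e'.symm), Fin.append (q ∘ e.symm) (q' ∘ e'.symm),
    Nat.le_add_right _ _, ?_⟩
  ext x
  simp only [Set.mem_ofPred_eq, Fin.forall_fin_add, Fin.val_castAdd, Fin.val_natAdd, Fin.is_lt,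
    Fin.append_left, Fin.append_right, Function.comp_apply, forall_true_left]
  have h1 : ∀ i : Fin (Fintype.card ι), ¬ Fintype.card ι ≤ i := fun i => not_le.2 i.2
  simp only [h1, IsEmpty.forall_iff, not_lt.2 (Nat.le_add_right _ _), Nat.le_add_right, implies_true,
    and_true, true_and, forall_true_left]
  rw [e.symm.forall_congr_left, e'.symm.forall_congr_left]
  simp

lemma IsBasicSemianalytic.exists_fintype {S : Set X.carrier} (hS : IsBasicSemianalytic X S) :
    ∃ (ι κ : Type) (_ : Fintype ι) (_ : Fintype κ) (p q : ι → X.O) (p' q' : κ → X.O), S = {x |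
      (∀ i, ‖(p i : X.carrier → K) x‖ ≤ ‖(q i : X.carrier → K) x‖) ∧
      ∀ i, ‖(p' i : X.carrier → K) x‖ < ‖(q' i : X.carrier → K) x‖} := by
  obtain ⟨mm, n, p, q, -, rfl⟩ := hS
  exact ⟨{i : Fin mm // (i : ℕ) < n}, {i : Fin mm // n ≤ (i : ℕ)}, inferInstance, inferInstance,
    fun i => p i, fun i => q i, fun i => p i, fun i => q i, by simp [Subtype.forall]⟩

lemma IsBasicSemianalytic.inter {S T : Set X.carrier} (hS : IsBasicSemianalytic X S)
    (hT : IsBasicSemianalytic X T) : IsBasicSemianalytic X (S ∩ T) := by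
  obtain ⟨ι, κ, _, _, p, q, p', q', rfl⟩ := hS.exists_fintype
  obtain ⟨ι', κ', _, _, a, b, a', b', rfl⟩ := hT.exists_fintype
  convert isBasicSemianalytic_of_fintype (Sum.elim p a) (Sum.elim q b) (Sum.elim p' a')
    (Sum.elim q' b') using 1
  ext x
  simp only [Set.mem_inter_iff, Set.mem_ofPred_eq, Sum.forall, Sum.elim_inl, Sum.elim_inr]
  tauto

lemma isSemianalytic_of_finite {ι : Type*} [Finite ι] {B : ι → Set X.carrier}
    (hB : ∀ i, IsBasicSemianalytic X (B i)) : IsSemianalytic X (⋃ i, B i) := by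
  obtain ⟨n, ⟨e⟩⟩ := Finite.exists_equiv_fin ι
  exact ⟨n, fun j => B (e.symm j), fun j => hB _, (e.symm.surjective.iUnion_comp B).symm⟩

lemma IsBasicSemianalytic.isSemianalytic {S : Set X.carrier} (hS : IsBasicSemianalytic X S) :
    IsSemianalytic X S := by
  simpa [Set.iUnion_const] using isSemianalytic_of_finite (ι := Unit) fun _ => hS

lemma IsSemianalytic.union {S T : Set X.carrier} (hS : IsSemianalytic X S)
    (hT : IsSemianalytic X T) : IsSemianalytic X (S ∪ T) := by
  obtain ⟨k, B, hB, rfl⟩ := hS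
  obtain ⟨l, D, hD, rfl⟩ := hT
  have := isSemianalytic_of_finite (B := Sum.elim B D) (by rintro (i | i); exacts [hB i, hD i])
  simpa [Set.iUnion_sum] using this

lemma IsSemianalytic.inter {S T : Set X.carrier} (hS : IsSemianalytic X S)
    (hT : IsSemianalytic X T) : IsSemianalytic X (S ∩ T) := by
  obtain ⟨k, B, hB, rfl⟩ := hS
  obtain ⟨l, D, hD, rfl⟩ := hT
  have := isSemianalytic_of_finite (B := fun ij : Fin k × Fin l => B ij.1 ∩ D ij.2)
    fun ij => (hB ij.1).inter (hD ij.2)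
  rwa [Set.iUnion_prod', ← Set.iUnion_inter_iUnion] at this

/-- Evaluation of affinoid functions at a point. -/
def Affinoid.ev (X : Affinoid K) (x : X.carrier) : X.O →ₐ[K] K :=
  (Pi.evalAlgHom K (fun _ => K) x).comp X.O.val

@[simp] lemma Affinoid.ev_apply (x : X.carrier) (p : X.O) :
    X.ev x p = (p : X.carrier → K) x := rfl

lemma Det.isSemianalytic {S : X.carrier → Prop} (hS : Det X.ev S) :
    IsSemianalytic X {x | S x} := by
  refine hS.induction (IsSemianalytic X) ?_ ?_ (fun _ _ => .union) (fun _ _ => .inter) ?_ ?_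
  · simpa using isSemianalytic_of_finite (X := X) (B := Empty.elim) fun i => i.elim
  · simpa using (isBasicSemianalytic_of_fintype (X := X) (ι := Empty) (κ := Empty)
      Empty.elim Empty.elim Empty.elim Empty.elim).isSemianalytic
  · intro p q
    simpa using (isBasicSemianalytic_of_fintype (X := X) (ι := Unit) (κ := Empty)
      (fun _ => p) (fun _ => q) Empty.elim Empty.elim).isSemianalytic
  · intro p q
    simpa using (isBasicSemianalytic_of_fintype (X := X) (ι := Empty) (κ := Unit)
      Empty.elim Empty.elim (fun _ => p) (fun _ => q)).isSemianalytic

end Semianalytic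

end RigidQE
end

noncomputable section
namespace RigidQE

set_option linter.unusedSectionVars false

open Filter Topology Matrix

namespace Tate

section Lipschitz

variable {A : Type} [NormedCommRing A] [IsUltrametricDist A] [CompleteSpace A] [NormOneClass A]
  {σ : Type} [Finite σ]

lemma norm_pt_sub_pt_le {x y : Bl A σ} {d : ℝ} (hd : 0 ≤ d) (h : ∀ i, ‖y i - x i‖ ≤ d)
    (f : Tate A σ) : ‖pt y f - pt x f‖ ≤ d * ‖f‖ := by
  have := Fintype.ofFinite σ
  have e := congrArg (pt y) (sub_pt_eq_sum x f)
  rw [map_sub, pt_C, map_sum] at e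
  rw [e]
  refine IsUltrametricDist.norm_sum_le_of_forall_le_of_nonneg (by positivity) fun i _ => ?_
  rw [map_mul, map_sub, pt_X, pt_C]
  exact (norm_mul_le _ _).trans (mul_le_mul (h i) ((CHom.bound _ _).trans (norm_taylorQuot_le _ _ _))
    (norm_nonneg _) hd)

end Lipschitz

section Unimodular

variable {K : Type} [NormedField K] [CompleteSpace K] [IsAlgClosed K] [IsUltrametricDist K]
  {τ s : Type} [Finite τ] [Fintype s]

lemma exists_sum_mul_eq_one {F : s → Tate K τ} (h : ∀ z, ∃ i, pt z (F i) ≠ 0) :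
    ∃ c : s → Tate K τ, ∑ i, F i * c i = 1 := by
  have h1 : Ideal.span (Set.range F) = ⊤ := by
    by_contra hne
    obtain ⟨M, hM, hle⟩ := Ideal.exists_le_maximal _ hne
    obtain ⟨y, hy⟩ := exists_mem_iff M hM
    obtain ⟨i, hi⟩ := h y
    exact hi ((hy _).1 (hle (Ideal.subset_span ⟨i, rfl⟩)))
  obtain ⟨c, hc⟩ := Ideal.mem_span_range_iff_exists_fun.1 ((Ideal.eq_top_iff_one _).1 h1)
  exact ⟨c, by simpa only [mul_comm] using hc⟩

lemma one_le_mul_norm {F : s → Tate K τ} {c : s → Tate K τ} (hc : ∑ i, F i * c i = 1) (z : Bl K τ)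
    {N : ℝ} (hN : 0 ≤ N) (h : ∀ i, ‖pt z (F i)‖ ≤ N) : 1 ≤ N * ‖c‖ := by
  have e := congrArg (fun f => ‖pt z f‖) hc
  simp only [map_sum, map_mul, map_one, norm_one] at e
  rw [← e]
  refine IsUltrametricDist.norm_sum_le_of_forall_le_of_nonneg (by positivity) fun i _ => ?_
  rw [norm_mul]
  exact mul_le_mul (h i) ((CHom.bound _ _).trans (norm_le_pi_norm c i)) (norm_nonneg _) hN

lemma exists_le_two_mul {E : Type*} [SeminormedAddCommGroup E] {S : Set E} (hS : S.Nonempty) {m : ℝ}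
    (hm : 0 < m) (h : ∀ c ∈ S, m ≤ ‖c‖) : ∃ c ∈ S, ∀ c' ∈ S, ‖c‖ ≤ 2 * ‖c'‖ := by
  have hne : ((‖·‖) '' S).Nonempty := hS.image _
  have hb : BddBelow ((‖·‖) '' S) := ⟨m, by rintro _ ⟨c, hc, rfl⟩; exact h c hc⟩
  have h0 : m ≤ sInf ((‖·‖) '' S) := le_csInf hne (by rintro _ ⟨c, hc, rfl⟩; exact h c hc)
  obtain ⟨_, ⟨c, hc, rfl⟩, hlt⟩ := exists_lt_of_csInf_lt hne
    (show sInf ((‖·‖) '' S) < 2 * sInf ((‖·‖) '' S) by linarith)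
  refine ⟨c, hc, fun c' hc' => hlt.le.trans ?_⟩
  have := csInf_le hb ⟨c', hc', rfl⟩
  simp only at this
  linarith

lemma exists_norm_eq_norm_pi (c : s → Tate K τ) : ∃ a : K, ‖a‖ = ‖c‖ := by
  rcases isEmpty_or_nonempty s with hs | hs
  · exact ⟨0, by rw [norm_zero, Subsingleton.elim c 0, norm_zero]⟩
  · obtain ⟨i, -, hi⟩ := Finset.exists_max_image Finset.univ (fun i => ‖c i‖) Finset.univ_nonempty
    obtain ⟨ν, hν⟩ := (c i).exists_norm_eq
    refine ⟨(c i).coeff ν, le_antisymm (hν.trans_le (norm_le_pi_norm c i)) ?_⟩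
    rw [hν]
    exact (pi_norm_le_iff_of_nonneg (norm_nonneg _)).2 fun j => hi j (Finset.mem_univ _)

/-- Rows of power series over the polydisc which become exact in the limit cannot be unimodular
and tend to zero at a point. -/
lemma exists_common_zero {U : Ultrafilter ℕ} {t : Type} [Fintype t] (F : ℕ → s → Tate K τ)
    (S : ℕ → Matrix s t (Tate K τ)) (hFS : ∀ k j, ∑ i, F k i * S k i j = 0)
    (hex : ∀ w : s → bddSeq (Tate K τ),
      Tendsto (fun k => ‖∑ i, F k i * (w i).1 k‖) U (𝓝 0) →
      ∃ v : t → bddSeq (Tate K τ), ∀ i,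
        Tendsto (fun k => ‖(w i).1 k - ∑ j, S k i j * (v j).1 k‖) U (𝓝 0))
    (z : Bl K τ) (ρ : ℕ → ℝ) (hρ0 : ∀ k, 0 < ρ k) (hρ : Tendsto ρ U (𝓝 0))
    (hz : ∀ k i, ‖pt z (F k i)‖ ≤ ρ k) : ∃ k, ∃ y, ∀ i, pt y (F k i) = 0 := by
  by_contra! hno
  have hsol : ∀ k, ∃ c : s → Tate K τ, ∑ i, F k i * c i = 1 ∧
      ∀ c' : s → Tate K τ, ∑ i, F k i * c' i = 1 → ‖c‖ ≤ 2 * ‖c'‖ := fun k => by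
    have h1 : ∀ c : s → Tate K τ, ∑ i, F k i * c i = 1 → (ρ k)⁻¹ ≤ ‖c‖ := fun c hc =>
      (inv_le_iff_one_le_mul₀' (hρ0 k)).2 (one_le_mul_norm hc z (hρ0 k).le (hz k))
    obtain ⟨c, hc, hmin⟩ := exists_le_two_mul (S := {c : s → Tate K τ | ∑ i, F k i * c i = 1})
      (exists_sum_mul_eq_one (hno k)) (inv_pos.2 (hρ0 k)) h1
    exact ⟨c, hc, hmin⟩
  choose c hc hmin using hsol
  choose a ha using fun k => exists_norm_eq_norm_pi (c k)
  have hlow : ∀ k, 1 ≤ ρ k * ‖a k‖ := fun k => by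
    rw [ha]; exact one_le_mul_norm (hc k) z (hρ0 k).le (hz k)
  have ha0 : ∀ k, a k ≠ 0 := fun k h => by
    have := hlow k
    rw [h, norm_zero, mul_zero] at this
    exact absurd this (by norm_num)
  have hinv : ∀ k, ‖(a k)⁻¹‖ ≤ ρ k := fun k => by
    rw [norm_inv]
    exact (inv_le_iff_one_le_mul₀ (norm_pos_iff.2 (ha0 k))).2 (hlow k)
  let w : s → bddSeq (Tate K τ) := fun i => ⟨fun k => C (a k)⁻¹ * c k i, 1, fun k => by
    refine (norm_C_mul_le _ _).trans ?_
    rw [norm_inv, ha]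
    exact inv_mul_le_one_of_le₀ (norm_le_pi_norm (c k) i) (norm_nonneg _)⟩
  have hFw : ∀ k, ∑ i, F k i * (w i).1 k = C (a k)⁻¹ := fun k => by
    have : ∀ i, F k i * (w i).1 k = C (a k)⁻¹ * (F k i * c k i) := fun i => by
      change F k i * (C (a k)⁻¹ * c k i) = _
      ring
    simp only [this, ← Finset.mul_sum, hc, mul_one]
  obtain ⟨v, hv⟩ := hex w (by
    simp only [hFw, norm_C]
    exact squeeze_zero (fun _ => norm_nonneg _) hinv hρ)
  have hall : ∀ᶠ k in (U : Filter ℕ), ∀ i, ‖(w i).1 k - ∑ j, S k i j * (v j).1 k‖ < 1 / 4 :=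
    eventually_all.2 fun i => (hv i).eventually_lt_const (by norm_num)
  obtain ⟨k, hk⟩ := hall.exists
  have hsol' : ∑ i, F k i * (C (a k) * ((w i).1 k - ∑ j, S k i j * (v j).1 k)) = 1 := by
    have h2 : ∑ i, F k i * ∑ j, S k i j * (v j).1 k = 0 := by
      simp only [Finset.mul_sum]
      rw [Finset.sum_comm]
      refine Finset.sum_eq_zero fun j _ => ?_
      simp only [← mul_assoc, ← Finset.sum_mul, hFS, zero_mul]
    have h3 : ∀ i, F k i * (C (a k) * ((w i).1 k - ∑ j, S k i j * (v j).1 k)) =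
        C (a k) * (F k i * (w i).1 k - F k i * ∑ j, S k i j * (v j).1 k) := fun i => by ring
    simp only [h3, ← Finset.mul_sum, Finset.sum_sub_distrib, hFw, h2, sub_zero]
    rw [← map_mul, mul_inv_cancel₀ (ha0 k), map_one]
  have h4 := hmin k _ hsol'
  have h5 : ‖fun i => C (a k) * ((w i).1 k - ∑ j, S k i j * (v j).1 k)‖ ≤ ‖a k‖ * (1 / 4) :=
    (pi_norm_le_iff_of_nonneg (by positivity)).2 fun i => (norm_C_mul_le _ _).trans
      (mul_le_mul_of_nonneg_left (hk i).le (norm_nonneg _))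
  have h6 : 0 < ‖a k‖ := norm_pos_iff.2 (ha0 k)
  rw [← ha] at h4
  linarith

end Unimodular

section Openness

variable {K : Type} [NormedField K] [CompleteSpace K] [IsAlgClosed K] [IsUltrametricDist K]
  {σ : Type} [Finite σ] {s t : Type} [Fintype s] [Fintype t] {n : ℕ}

/-- Shrinking a polydisc around a varying centre. -/
def centreBl (σ : Type) (n : ℕ) {δ : K} (hδ : ‖δ‖ ≤ 1) :
    Bl (Tate (Tate K (σ ⊕ Fin n)) (Fin n)) (Fin n) :=
  ⟨fun j => C (X (Sum.inr j)) + C (C δ) * X j, fun j => (norm_add_le_max' _ _).trans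
    (max_le ((norm_C _).trans_le (norm_X_le _)) ((norm_C_mul_le _ _).trans
      (mul_le_one₀ ((norm_C _).trans_le hδ) (norm_nonneg _) (norm_X_le _))))⟩

@[simp] lemma centreBl_apply {δ : K} (hδ : ‖δ‖ ≤ 1) (j : Fin n) :
    centreBl σ n hδ j = C (X (Sum.inr j)) + C (C δ) * X j := rfl

def scalarMat (n : ℕ) (δ : K) (i j : Fin n) : K := if i = j then δ else 0

lemma norm_scalarMat_le {δ : K} (hδ : ‖δ‖ ≤ 1) (i j : Fin n) : ‖scalarMat n δ i j‖ ≤ 1 := by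
  unfold scalarMat
  split_ifs
  · exact hδ
  · simp

def inrBl (y : Bl K (σ ⊕ Fin n)) : Bl K (Fin n) := ⟨fun j => y (Sum.inr j), fun j => y.2 _⟩
def inlBl (y : Bl K (σ ⊕ Fin n)) : Bl K σ := ⟨fun j => y (Sum.inl j), fun j => y.2 _⟩

@[simp] lemma inrBl_apply (y : Bl K (σ ⊕ Fin n)) (j : Fin n) : inrBl y j = y (Sum.inr j) := rfl
@[simp] lemma inlBl_apply (y : Bl K (σ ⊕ Fin n)) (j : σ) : inlBl y j = y (Sum.inl j) := rfl

/-- Near an approximate zero of a flat family of equations there is a zero. -/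
theorem FibExact.exists_zero_near (hK : ∃ c : K, c ≠ 0 ∧ ‖c‖ < 1) {I : Ideal (Tate K σ)}
    {Φ : Matrix Unit s (Tate (Tate K σ) (Fin n))} {Sg : Matrix s t (Tate (Tate K σ) (Fin n))}
    (h : FibExact I Φ Sg) {δ : K} (hδ0 : δ ≠ 0) (hδ : ‖δ‖ ≤ 1) :
    ∃ ρ : K, ρ ≠ 0 ∧ ∀ x, I ≤ mI x → ∀ y : Bl K (Fin n),
      (∀ i, ‖pt y (spec _ x (Φ () i))‖ ≤ ‖ρ‖) →
      ∃ z : Bl K (Fin n), (∀ j, ‖z j - y j‖ ≤ ‖δ‖) ∧ ∀ i, pt z (spec _ x (Φ () i)) = 0 := by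
  by_contra! hcon
  obtain ⟨π, hπ0, hπ1⟩ := hK
  choose x hxI y hy hz using fun k : ℕ => hcon (π ^ k) (pow_ne_zero _ hπ0)
  let U : Ultrafilter ℕ := hyperfilter ℕ
  let x' : ℕ → Bl K (σ ⊕ Fin n) := fun k => ⟨Sum.elim (x k) (y k), by
    rintro (i | i)
    exacts [(x k).2 i, (y k).2 i]⟩
  let ι : CHom (Tate K σ) (Tate K (σ ⊕ Fin n)) := eval CC (renBl Sum.inl)
  have hι : ∀ y f, pt y (ι f) = pt (inlBl y) f := fun y f => by
    have : (pt y).comp ι = pt (inlBl y) := chom_ext (fun a => by simp [ι]) fun i => by simp [ι]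
    exact congrArg (fun φ => φ f) this
  have hx'l : ∀ k, inlBl (x' k) = x k := fun k => Subtype.ext (funext fun i => rfl)
  have hx'r : ∀ k, inrBl (x' k) = y k := fun k => Subtype.ext (funext fun i => rfl)
  have hιI : ∀ f ∈ I, ι f ∈ pI U x' := fun f hf => mem_pI.2 (by
    simp only [hι, hx'l, mem_mI_iff.1 (hxI _ hf), norm_zero]
    exact tendsto_const_nhds)
  have hIle : ∀ z, pI U x' ≤ mI z → I ≤ mI (inlBl z) := fun z hz f hf => by
    rw [mem_mI_iff, ← hι]
    exact mem_mI_iff.1 (hz (hιI f hf))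
  have h1 : FibExact (pI U x') (Φ.map (map ι)) (Sg.map (map ι)) :=
    fibExact_map hιI h.1 fun z hz => ⟨inlBl z, hι z, h.2 _ (hIle z hz)⟩
  have haff : ∀ (z : Bl K (σ ⊕ Fin n)) i, spec (Fin n) z (centreBl σ n hδ i) =
      affBl (inrBl z) (scalarMat n δ) (norm_scalarMat_le hδ) i := fun z i => by
    simp [scalarMat, apply_ite (C (A := K) (τ := Fin n)), ite_mul]
  have h2 : FibExact (pI U x') ((Φ.map (map ι)).map (sub (centreBl σ n hδ)))
      ((Sg.map (map ι)).map (sub (centreBl σ n hδ))) := by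
    refine h1.substitute haff fun z hz => ?_
    exact Ex.restrict (h1.2 z hz) _ (N := scalarMat n 1) (norm_scalarMat_le (by simp)) hδ0
      (fun i j => by simp [scalarMat]) (fun i j => by simp [scalarMat])
  obtain ⟨b, hb0, hex⟩ := eLoc (U := U) ⟨π, hπ0, hπ1⟩ n _ _ _ _ _ _ x' h2
  let θ : ℕ → CHom (Tate (Tate K σ) (Fin n)) (Tate K (Fin n)) := fun k =>
    (sub b).comp ((spec (Fin n) (x' k)).comp ((sub (centreBl σ n hδ)).comp (map ι)))
  let yb : ℕ → Bl (Tate K (Fin n)) (Fin n) := fun k =>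
    (sub b).mapBl (affBl (y k) (scalarMat n δ) (norm_scalarMat_le hδ))
  have hyb : ∀ k j, yb k j = C (y k j) + C δ * b j := fun k j => by
    simp [yb, scalarMat, apply_ite (C (A := K) (τ := Fin n)), ite_mul]
  have hθ : ∀ k f, θ k f = sub (yb k) (spec _ (x k) f) := fun k f => by
    have : θ k = (sub (yb k)).comp (spec _ (x k)) := by
      refine chom_ext (fun a => ?_) fun i => ?_
      · have := hι (x' k) a
        rw [hx'l] at this
        simp [θ, this]
      · simp only [θ, CHom.comp_apply, map_X, sub_X, haff, hx'r, spec_X]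
        rfl
    exact congrArg (fun φ => φ f) this
  let Θ : Tate (Tate K σ) (Fin n) → bddSeq (Tate K (Fin n)) := fun f =>
    ⟨fun k => θ k f, ‖f‖, fun k => (θ k).bound f⟩
  have hsum : ∀ {r : Type} [Fintype r] (f : r → Tate (Tate K σ) (Fin n))
      (w : r → bddSeq (Tate K (Fin n))) k,
      (∑ i, Θ (f i) * w i).1 k = ∑ i, θ k (f i) * (w i).1 k := fun f w k =>
    map_sum ((Pi.evalRingHom (fun _ => Tate K (Fin n)) k).comp (bddSeq (Tate K (Fin n))).subtype)
      (fun i => Θ (f i) * w i) Finset.univ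
  have hzero : ∃ k, ∃ z, ∀ i, pt z (θ k (Φ () i)) = 0 := by
    refine exists_common_zero (U := U) (fun k i => θ k (Φ () i)) (fun k => Sg.map (θ k)) ?_ ?_
      zeroBl (fun k => ‖π‖ ^ k) (fun k => pow_pos (norm_pos_iff.2 hπ0) k) ?_ ?_
    · intro k j
      have e : spec (Fin n) (x k) ((Φ * Sg) () j) = 0 := spec_eq_zero_of_mem_map (hxI k) (h.1 _ _)
      have e' := congrArg (sub (yb k)) e
      rw [map_zero, ← hθ, Matrix.mul_apply, map_sum] at e'
      simpa only [map_mul, Matrix.map_apply] using e'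
    · intro w hw
      obtain ⟨v, hv⟩ := hex (fun i => UP.mk U (w i)) (by
        funext u
        simp only [mulVec, dotProduct]
        have : ∑ i, ((Φ.map (map ι)).map (sub (centreBl σ n hδ))).map (thetaHom U x' b) u i *
            UP.mk U (w i) = UP.mk U (∑ i, Θ (Φ () i) * w i) := by
          rw [map_sum]
          exact Finset.sum_congr rfl fun i _ => (map_mul (UP.mk U) (Θ (Φ () i)) (w i)).symm
        rw [this]
        refine UP.mk_eq_zero.2 ?_
        simpa only [hsum] using hw)
      choose v' hv' using fun j => UP.mk_surjective (U := U) (v j)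
      refine ⟨v', fun i => ?_⟩
      have hvi := congrFun hv i
      simp only [mulVec, dotProduct] at hvi
      have : ∑ j, ((Sg.map (map ι)).map (sub (centreBl σ n hδ))).map (thetaHom U x' b) i j *
            v j = UP.mk U (∑ j, Θ (Sg i j) * v' j) := by
        rw [map_sum]
        refine Finset.sum_congr rfl fun j _ => ?_
        rw [← hv' j]
        exact (map_mul (UP.mk U) (Θ (Sg i j)) (v' j)).symm
      rw [this, ← sub_eq_zero, ← map_sub, UP.mk_eq_zero] at hvi
      refine hvi.congr fun k => ?_
      rw [norm_sub_rev]
      exact congrArg (fun a => ‖a - (w i).1 k‖) (hsum (Sg i) v' k)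
    · exact (tendsto_pow_atTop_nhds_zero_of_lt_one (norm_nonneg _) hπ1).mono_left
        (Nat.hyperfilter_le_atTop)
    · intro k i
      rw [← norm_pow]
      have : (pt zeroBl).comp (sub (yb k)) = pt (y k) :=
        chom_ext (fun a => by simp) fun j => by
          rw [CHom.comp_apply, sub_X, hyb, map_add, pt_C, map_mul, pt_zero (b j), hb0, mul_zero,
            add_zero, pt_X]
      rw [hθ, ← CHom.comp_apply, this]
      exact hy k i
  obtain ⟨k, z, hkz⟩ := hzero
  obtain ⟨i, hi⟩ := hz k ((pt z).mapBl (yb k)) fun j => by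
    simp only [CHom.mapBl_apply, hyb, map_add, map_mul, pt_C, add_sub_cancel_left, norm_mul]
    exact mul_le_of_le_one_right (norm_nonneg _) ((CHom.bound _ _).trans (b.2 j))
  refine hi ?_
  rw [← hkz i, hθ]
  have : (pt z).comp (sub (yb k)) = pt ((pt z).mapBl (yb k)) :=
    chom_ext (fun a => by simp) fun j => by simp
  exact congrArg (fun φ => φ (spec _ (x k) (Φ () i))) this.symm

end Openness

end Tate
end RigidQE
end

noncomputable section
namespace RigidQE

set_option linter.unusedSectionVars false

open Filter Topology Tate
open scoped BoundedContinuousFunction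

section Functions

variable {K : Type} [NormedField K] [CompleteSpace K] [IsAlgClosed K] [IsUltrametricDist K]

/-- A point of the unit polydisc as a family of power-bounded elements. -/
def UnitBall.toBl {m : ℕ} (x : UnitBall K m) : Bl K (Fin m) := ⟨x.1, x.2⟩

@[simp] lemma UnitBall.toBl_apply {m : ℕ} (x : UnitBall K m) (i : Fin m) :
    UnitBall.toBl x i = x.1 i := rfl

lemma UnitBall.toBl_surjective {m : ℕ} (x : Bl K (Fin m)) : ∃ y, UnitBall.toBl y = x :=
  ⟨⟨x.1, x.2⟩, rfl⟩

/-- A strictly convergent power series as a function on the unit polydisc. -/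
def toBCF (m : ℕ) : Tate K (Fin m) →+* (UnitBall K m →ᵇ K) where
  toFun f := BoundedContinuousFunction.ofNormedAddCommGroup
    (fun x => pt (UnitBall.toBl x) f)
    (LipschitzWith.of_dist_le_mul (K := ‖f‖₊) fun x y => by
      rw [dist_eq_norm, mul_comm]
      refine norm_pt_sub_pt_le dist_nonneg (fun i => ?_) f
      rw [Subtype.dist_eq, dist_eq_norm]
      exact norm_le_pi_norm (x.1 - y.1) i).continuous
    ‖f‖ (fun x => (pt _).bound f)
  map_one' := by ext; simp
  map_mul' f g := by ext; simp
  map_zero' := by ext; simp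
  map_add' f g := by ext; simp

lemma isometry_toBCF (m : ℕ) : Isometry (toBCF (K := K) m) := by
  refine AddMonoidHomClass.isometry_of_norm _ fun f => le_antisymm ?_ ?_
  · exact (BoundedContinuousFunction.norm_le (norm_nonneg _)).2 fun x => (pt _).bound f
  · obtain ⟨z, hz⟩ := exists_norm_pt_eq f
    obtain ⟨y, rfl⟩ := UnitBall.toBl_surjective z
    rw [← hz]
    exact (toBCF m f).norm_coe_le_norm y

lemma toBCF_ofPoly_mem (m : ℕ) (p : MvPolynomial (Fin m) K) :
    toBCF m (ofPoly K _ p) ∈ Algebra.adjoin K (Set.range (coordFn K m)) := by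
  induction p using MvPolynomial.induction_on with
  | C a =>
    convert Subalgebra.algebraMap_mem (Algebra.adjoin K (Set.range (coordFn K m))) a
    ext x
    exact pt_C _ a
  | add p q hp hq => simpa using add_mem hp hq
  | mul_X p i hp =>
    rw [map_mul, map_mul]
    refine mul_mem hp (Algebra.subset_adjoin ⟨i, ?_⟩)
    ext x
    exact (pt_X (UnitBall.toBl x) i).symm

/-- Strictly convergent functions are the functions given by strictly convergent power series. -/
lemma mem_tateAlg_iff {m : ℕ} {φ : UnitBall K m →ᵇ K} :
    φ ∈ TateAlg K m ↔ ∃ f, toBCF m f = φ := by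
  constructor
  · intro h
    let A : Subalgebra K (UnitBall K m →ᵇ K) :=
      { (toBCF m).range with
        algebraMap_mem' := fun a => ⟨C a, by ext x; exact pt_C _ a⟩ }
    have hA : IsClosed (A : Set (UnitBall K m →ᵇ K)) := by
      have := (isometry_toBCF (K := K) m).isClosedEmbedding.isClosed_range
      convert this
      ext; rfl
    refine Subalgebra.topologicalClosure_minimal (t := A) (Algebra.adjoin_le ?_) hA h
    rintro _ ⟨i, rfl⟩
    exact ⟨Tate.X i, by ext x; exact pt_X (UnitBall.toBl x) i⟩
  · rintro ⟨f, rfl⟩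
    refine map_mem_closure (isometry_toBCF m).continuous (denseRange_ofPoly f) ?_
    rintro _ ⟨p, rfl⟩
    exact toBCF_ofPoly_mem m p

namespace Affinoid

variable (V : Affinoid K)

/-- A point of an affinoid variety as a family of power-bounded elements. -/
def bl (x : V.carrier) : Bl K (Fin V.m) := UnitBall.toBl x.1

lemma bl_injective : Function.Injective V.bl := fun _ _ h =>
  Subtype.ext (Subtype.ext (congrArg Subtype.val h))

/-- Strictly convergent power series as functions on an affinoid variety. -/
def ofTate : Tate K (Fin V.m) →+* V.O where
  toFun f := ⟨fun x => pt (V.bl x) f, toBCF V.m f, mem_tateAlg_iff.2 ⟨f, rfl⟩, rfl⟩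
  map_one' := by ext; simp
  map_mul' f g := by ext; simp
  map_zero' := by ext; simp
  map_add' f g := by ext; simp

@[simp] lemma ofTate_apply (f : Tate K (Fin V.m)) (x : V.carrier) :
    (V.ofTate f : V.carrier → K) x = pt (V.bl x) f := rfl

lemma ofTate_surjective : Function.Surjective V.ofTate := by
  rintro ⟨_, φ, hφ, rfl⟩
  obtain ⟨f, rfl⟩ := mem_tateAlg_iff.1 hφ
  exact ⟨f, rfl⟩

/-- The power series vanishing on an affinoid variety. -/
def ideal : Ideal (Tate K (Fin V.m)) := RingHom.ker V.ofTate

variable {V}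

lemma mem_ideal {f : Tate K (Fin V.m)} : f ∈ V.ideal ↔ ∀ x, pt (V.bl x) f = 0 := by
  rw [ideal, RingHom.mem_ker, Subtype.ext_iff, funext_iff]
  rfl

lemma exists_bl_eq {x : Bl K (Fin V.m)} (h : ∀ f ∈ V.ideal, pt x f = 0) :
    ∃ x', V.bl x' = x := by
  obtain ⟨y, rfl⟩ := UnitBall.toBl_surjective x
  obtain ⟨S, hS, hV⟩ := V.isZeroLocus
  have hy : y ∈ V.carrier := by
    rw [hV]
    intro φ hφ
    obtain ⟨f, rfl⟩ := mem_tateAlg_iff.1 (hS φ hφ)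
    refine h f (mem_ideal.2 fun x' => ?_)
    exact hV.subset x'.2 _ hφ
  exact ⟨⟨y, hy⟩, rfl⟩

lemma exists_bl_eq_of_le {x : Bl K (Fin V.m)} (h : V.ideal ≤ mI x) : ∃ x', V.bl x' = x :=
  exists_bl_eq fun _ hf => mem_mI_iff.1 (h hf)

end Affinoid

end Functions

end RigidQE
end

noncomputable section
namespace RigidQE

set_option linter.unusedSectionVars false

open Filter Topology Tate

section Lifting

variable {K : Type} [NormedField K] [CompleteSpace K] [IsAlgClosed K] [IsUltrametricDist K]

lemma Tate.norm_eq_one_of_trivial (hK : ∀ c : K, c ≠ 0 → 1 ≤ ‖c‖) {τ : Type} {f : Tate K τ}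
    (hf : f ≠ 0) : ‖f‖ = 1 := by
  obtain ⟨ν, hν⟩ := f.exists_norm_eq
  have hc : f.coeff ν ≠ 0 := fun h => hf (by rwa [h, norm_zero, eq_comm, norm_eq_zero] at hν)
  rw [← hν]
  refine le_antisymm ?_ (hK _ hc)
  have := hK _ (inv_ne_zero hc)
  rw [norm_inv] at this
  exact (one_le_inv₀ (norm_pos_iff.2 hc)).1 this

/-- The Tate algebra as a normed space. -/
@[reducible] def Tate.normedSpace (τ : Type) : NormedSpace K (Tate K τ) where
  __ := (C : K →+* Tate K τ).toModule
  norm_smul_le a f := norm_C_mul_le a f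

variable {V W : Affinoid K} (f : AffinoidMap W V)

/-- Pairs of power series on the source and the target of a map of affinoid varieties inducing the
same function on the source. -/
def AffinoidMap.Compat (q : Tate K (Fin W.m)) (p : Tate K (Fin V.m)) : Prop :=
  ∀ y, pt (W.bl y) q = pt (V.bl (f.toFun y)) p

lemma AffinoidMap.exists_compat (p : Tate K (Fin V.m)) : ∃ q, f.Compat q p := by
  obtain ⟨q, hq⟩ := W.ofTate_surjective (f.algHom (V.ofTate p))
  exact ⟨q, fun y => congrFun (congrArg Subtype.val hq) y⟩

lemma AffinoidMap.exists_compat_bound :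
    ∃ M : ℝ, ∀ p, ∃ q, f.Compat q p ∧ ‖q‖ ≤ M * ‖p‖ := by
  by_cases hK : ∀ c : K, c ≠ 0 → 1 ≤ ‖c‖
  · refine ⟨1, fun p => ?_⟩
    by_cases hp : p = 0
    · exact ⟨0, fun y => by simp [hp], by simp [hp]⟩
    obtain ⟨q, hq⟩ := f.exists_compat p
    refine ⟨q, hq, ?_⟩
    rw [norm_eq_one_of_trivial hK hp, one_mul]
    by_cases hq0 : q = 0
    · simp [hq0]
    · exact (norm_eq_one_of_trivial hK hq0).le
  · push Not at hK
    obtain ⟨c, hc0, hc1⟩ := hK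
    let _ : NontriviallyNormedField K :=
      { ‹NormedField K› with
        non_trivial := ⟨c⁻¹, by
          rw [norm_inv]; exact (one_lt_inv₀ (norm_pos_iff.2 hc0)).2 hc1⟩ }
    let _ := Tate.normedSpace (K := K) (Fin V.m)
    let _ := Tate.normedSpace (K := K) (Fin W.m)
    have hs1 : ∀ (a : K) (p : Tate K (Fin V.m)), a • p = C a * p := fun _ _ => rfl
    have hs2 : ∀ (a : K) (p : Tate K (Fin W.m)), a • p = C a * p := fun _ _ => rfl
    let G : Submodule K (Tate K (Fin W.m) × Tate K (Fin V.m)) :=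
      { carrier := {z | f.Compat z.1 z.2}
        add_mem' := fun {a b} ha hb y => by simp [ha y, hb y]
        zero_mem' := fun y => by simp
        smul_mem' := fun a z hz y => by
          rw [Prod.smul_fst, Prod.smul_snd, hs1, hs2]
          simp [hz y] }
    have hG : IsClosed (G : Set (Tate K (Fin W.m) × Tate K (Fin V.m))) := by
      have : (G : Set (Tate K (Fin W.m) × Tate K (Fin V.m))) =
          ⋂ y, {z | pt (W.bl y) z.1 = pt (V.bl (f.toFun y)) z.2} := by
        ext z
        simp [G, AffinoidMap.Compat]
      rw [this]
      exact isClosed_iInter fun y => isClosed_eq ((pt _).continuous.comp continuous_fst)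
        ((pt _).continuous.comp continuous_snd)
    have : CompleteSpace G := hG.completeSpace_coe
    let φ : G →L[K] Tate K (Fin V.m) := (ContinuousLinearMap.snd K _ _).comp G.subtypeL
    obtain ⟨M, -, hM⟩ := φ.exists_preimage_norm_le fun p => by
      obtain ⟨q, hq⟩ := f.exists_compat p
      exact ⟨⟨(q, p), hq⟩, rfl⟩
    refine ⟨M, fun p => ?_⟩
    obtain ⟨z, hz, hb⟩ := hM p
    refine ⟨z.1.1, ?_, (norm_fst_le z.1).trans hb⟩
    rw [← hz]
    exact z.2

/-- Evaluation at the points of the graph of a map of affinoid varieties. -/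
def AffinoidMap.evGraph (y : W.carrier) : CHom (Tate (Tate K (Fin V.m)) (Fin W.m)) K :=
  (pt (W.bl y)).comp (spec _ (V.bl (f.toFun y)))

lemma AffinoidMap.evGraph_apply (y : W.carrier) (s) :
    f.evGraph y s = pt (W.bl y) (spec _ (V.bl (f.toFun y)) s) := rfl

@[simp] lemma AffinoidMap.evGraph_C (y : W.carrier) (p) :
    f.evGraph y (C p) = pt (V.bl (f.toFun y)) p := by
  rw [evGraph_apply, spec_C, pt_C]

@[simp] lemma AffinoidMap.evGraph_map_CC (y : W.carrier) (q) :
    f.evGraph y (map CC q) = pt (W.bl y) q := by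
  rw [evGraph_apply, spec_map_CC]

lemma AffinoidMap.exists_pt_eq_evGraph (s : Tate (Tate K (Fin V.m)) (Fin W.m)) :
    ∃ q, ∀ y, pt (W.bl y) q = f.evGraph y s := by
  obtain ⟨M, hM⟩ := f.exists_compat_bound
  choose L hL hLb using hM
  have hs : Summable fun ν => L (s.coeff ν) * mono ν :=
    summable_of_norm_tendsto (squeeze_zero (fun _ => norm_nonneg _)
      (fun ν => (norm_mul_le _ _).trans ((mul_le_of_le_one_right (norm_nonneg _)
        (norm_mono_le ν)).trans (hLb _)))
      (by simpa using s.tendsto_coeff.const_mul M))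
  refine ⟨∑' ν, L (s.coeff ν) * mono ν, fun y => ?_⟩
  have h1 := (hs.hasSum.map (pt (W.bl y)).toRingHom (pt (W.bl y)).continuous).tsum_eq
  refine h1.symm.trans ?_
  rw [evGraph_apply]
  change _ = eval _ _ _
  rw [eval_apply]
  refine tsum_congr fun ν => ?_
  change pt (W.bl y) (L (s.coeff ν) * mono ν) = _
  rw [map_mul, hL]
  congr 1
  exact eval_mono _ _ ν

/-- Power series on the product, restricted to the graph. -/
def AffinoidMap.toGraph : Tate (Tate K (Fin V.m)) (Fin W.m) →+* W.O where
  toFun s := ⟨fun y => f.evGraph y s, by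
    obtain ⟨q, hq⟩ := f.exists_pt_eq_evGraph s
    have := (W.ofTate q).2
    rwa [show (W.ofTate q : W.carrier → K) = fun y => f.evGraph y s from funext hq] at this⟩
  map_one' := by ext; simp
  map_mul' f g := by ext; simp
  map_zero' := by ext; simp
  map_add' f g := by ext; simp

@[simp] lemma AffinoidMap.toGraph_apply (s) (y : W.carrier) :
    (f.toGraph s : W.carrier → K) y = f.evGraph y s := rfl

lemma AffinoidMap.toGraph_C (p) : f.toGraph (C p) = f.algHom (V.ofTate p) := by
  ext y
  rw [toGraph_apply, evGraph_C]
  rfl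

lemma AffinoidMap.toGraph_map_CC (q) : f.toGraph (map CC q) = W.ofTate q := by
  ext y
  rw [toGraph_apply, evGraph_map_CC]
  rfl

lemma AffinoidMap.toGraph_eq_zero {s} : f.toGraph s = 0 ↔ ∀ y, f.evGraph y s = 0 := by
  rw [Subtype.ext_iff, funext_iff]
  rfl

/-- Common zeros of the equations of the graph. -/
lemma AffinoidMap.exists_of_common_zero {x : V.carrier} {y : Bl K (Fin W.m)}
    (h : ∀ s, f.toGraph s = 0 → pt y (spec _ (V.bl x) s) = 0) :
    ∃ y', W.bl y' = y ∧ f.toFun y' = x := by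
  obtain ⟨y', rfl⟩ := Affinoid.exists_bl_eq (V := W) (x := y) fun q hq => by
    have := h (map CC q) (by rw [f.toGraph_map_CC]; exact hq)
    rwa [spec_map_CC] at this
  refine ⟨y', rfl, V.bl_injective (Subtype.ext (funext fun i => ?_))⟩
  obtain ⟨q, hq⟩ := f.exists_compat (Tate.X i)
  have := h (map CC q - C (Tate.X i)) (f.toGraph_eq_zero.2 fun y => by
    rw [map_sub, evGraph_map_CC, evGraph_C, hq, sub_self])
  rw [map_sub, map_sub, spec_map_CC, spec_C, pt_C, hq, pt_X, pt_X, sub_eq_zero] at this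
  exact this

end Lifting

end RigidQE
end

noncomputable section
namespace RigidQE

set_option linter.unusedSectionVars false

open Filter Topology Tate Matrix

/-- The equational criterion for flat ring homomorphisms. -/
lemma exists_of_flat_of_sum_mul_eq_zero {R S : Type} [CommRing R] [CommRing S] {φ : R →+* S}
    (hφ : φ.Flat) {ι : Type} [Fintype ι] {a : ι → R} {x : ι → S} (h : ∑ i, φ (a i) * x i = 0) :
    ∃ (k : ℕ) (b : ι → Fin k → R) (z : Fin k → S),
      (∀ i, x i = ∑ j, φ (b i j) * z j) ∧ ∀ j, ∑ i, a i * b i j = 0 := by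
  let _ := φ.toAlgebra
  have : Module.Flat R S := hφ
  exact Module.Flat.isTrivialRelation_of_sum_smul_eq_zero (R := R) (M := S) h

lemma sum_mul_sub_sum_mul_sub {R ι κ : Type} [CommRing R] [Fintype ι] [Fintype κ] (a s : ι → R)
    (b : ι → κ → R) (z : κ → R) :
    ∑ i, s i * a i - ∑ i, a i * (s i - ∑ j, b i j * z j) = ∑ j, z j * ∑ i, a i * b i j := by
  simp only [mul_sub, Finset.sum_sub_distrib, Finset.mul_sum, mul_comm (a _) (s _),
    sub_sub_cancel]
  rw [Finset.sum_comm]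
  exact Finset.sum_congr rfl fun j _ => Finset.sum_congr rfl fun i _ => by ring

section FlatGraph

variable {K : Type} [NormedField K] [CompleteSpace K] [IsAlgClosed K] [IsUltrametricDist K]
  {V W : Affinoid K} {f : AffinoidMap W V}

/-- Equations of the graph vanishing on a fibre are combinations of equations of the graph with
coefficients vanishing at the base point. -/
lemma AffinoidMap.Flat.exists_sum (hf : f.Flat) {x : V.carrier}
    {F : Tate (Tate K (Fin V.m)) (Fin W.m)} (hF : f.toGraph F = 0)
    (hx : spec _ (V.bl x) F = 0) :
    ∃ h : Fin V.m → Tate (Tate K (Fin V.m)) (Fin W.m), (∀ i, f.toGraph (h i) = 0) ∧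
      F - ∑ i, C (Tate.X i - C (V.bl x i)) * h i ∈ exI (Fin W.m) V.ideal := by
  have h1 := mem_map_mI_of_spec hx
  rw [mI, Ideal.map_span, ← Set.range_comp, Ideal.mem_span_range_iff_exists_fun] at h1
  obtain ⟨s, rfl⟩ := h1
  have hsum : ∑ i, f.algHom.toRingHom (V.ofTate (Tate.X i - C (V.bl x i))) * f.toGraph (s i) =
      0 := by
    rw [map_sum] at hF
    refine Eq.trans (Finset.sum_congr rfl fun i _ => ?_) hF
    rw [map_mul, Function.comp_apply, f.toGraph_C, mul_comm]
    rfl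
  obtain ⟨k, a, z, hs, ha⟩ := exists_of_flat_of_sum_mul_eq_zero hf hsum
  choose A hA using fun i j => V.ofTate_surjective (a i j)
  choose Z hZ using fun j => W.ofTate_surjective (z j)
  refine ⟨fun i => s i - ∑ j, C (A i j) * map CC (Z j), fun i => ?_, ?_⟩
  · rw [map_sub, map_sum, hs, sub_eq_zero]
    refine Finset.sum_congr rfl fun j _ => ?_
    rw [map_mul, f.toGraph_C, f.toGraph_map_CC, hA, hZ]
    rfl
  · have : ∑ i, s i * (C ∘ fun i => Tate.X i - C (V.bl x i)) i -
        ∑ i, C (Tate.X i - C (V.bl x i)) * (s i - ∑ j, C (A i j) * map CC (Z j)) =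
        ∑ j, map CC (Z j) * C (∑ i, (Tate.X i - C (V.bl x i)) * A i j) := by
      simp only [map_sum, map_mul]
      exact sum_mul_sub_sum_mul_sub _ s _ _
    rw [this]
    refine sum_mem fun j _ => Ideal.mul_mem_left _ _ (Ideal.mem_map_of_mem _ ?_)
    rw [Affinoid.ideal, RingHom.mem_ker, map_sum, ← ha j]
    exact Finset.sum_congr rfl fun i _ => by rw [map_mul, hA]

/-- Flatness of a map of affinoid varieties in terms of the equations of its graph. -/
lemma AffinoidMap.Flat.exists_fibExact (hf : f.Flat) :
    ∃ (s t : ℕ) (F : Fin s → Tate (Tate K (Fin V.m)) (Fin W.m))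
      (Sg : Matrix (Fin s) (Fin t) (Tate (Tate K (Fin V.m)) (Fin W.m))),
      Ideal.span (Set.range F) = RingHom.ker f.toGraph ∧
      FibExact V.ideal (Matrix.of fun _ : Unit => F) Sg := by
  obtain ⟨s, F, hF⟩ := Submodule.fg_iff_exists_fin_generating_family.1
    (IsNoetherian.noetherian (RingHom.ker f.toGraph))
  have hFm : ∀ i, f.toGraph (F i) = 0 := fun i => by
    rw [← RingHom.mem_ker, ← hF]
    exact Submodule.subset_span ⟨i, rfl⟩
  let N : Submodule (Tate (Tate K (Fin V.m)) (Fin W.m))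
      (Fin s → Tate (Tate K (Fin V.m)) (Fin W.m)) :=
    Submodule.comap (Fintype.linearCombination _ F) (exI (Fin W.m) V.ideal)
  have hN : ∀ v, v ∈ N ↔ ∑ i, F i * v i ∈ exI (Fin W.m) V.ideal := fun v => by
    simp [N, Fintype.linearCombination_apply, mul_comm]
  obtain ⟨t, S, hS⟩ := Submodule.fg_iff_exists_fin_generating_family.1 (IsNoetherian.noetherian N)
  refine ⟨s, t, F, Matrix.of fun i j => S j i, hF, fun _ j => ?_, fun x hx w hw => ?_⟩
  · rw [Matrix.mul_apply]
    exact (hN (S j)).1 (by rw [← hS]; exact Submodule.subset_span ⟨j, rfl⟩)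
  obtain ⟨x, rfl⟩ := Affinoid.exists_bl_eq_of_le hx
  obtain ⟨h, hh, hmem⟩ := hf.exists_sum (x := x) (F := ∑ i, F i * map CC (w i))
    (by simp [hFm]) (by
      have := congrFun hw ()
      simp only [mulVec, dotProduct, Matrix.map_apply, Matrix.of_apply] at this
      rw [map_sum]
      refine Eq.trans (Finset.sum_congr rfl fun i _ => ?_) this
      rw [map_mul, spec_map_CC])
  have hc : ∀ i, ∃ c : Fin s → Tate (Tate K (Fin V.m)) (Fin W.m), ∑ k, c k * F k = h i :=
    fun i => Ideal.mem_span_range_iff_exists_fun.1 (by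
      have := RingHom.mem_ker.2 (hh i)
      rwa [← hF] at this)
  choose c hc using hc
  have hu : (fun k => map CC (w k) - ∑ i, C (Tate.X i - C (V.bl x i)) * c i k) ∈ N := by
    rw [hN]
    convert hmem using 1
    simp only [← hc, mul_sub, Finset.sum_sub_distrib, Finset.mul_sum]
    congr 1
    rw [Finset.sum_comm]
    exact Finset.sum_congr rfl fun i _ => Finset.sum_congr rfl fun j _ => by ring
  rw [← hS, Submodule.mem_span_range_iff_exists_fun] at hu
  obtain ⟨v, hv⟩ := hu
  refine ⟨fun j => spec _ (V.bl x) (v j), funext fun k => ?_⟩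
  have := congrArg (spec _ (V.bl x)) (congrFun hv k)
  have h0 : spec (Fin W.m) (V.bl x) (∑ i, C (Tate.X i - C (V.bl x i)) * c i k) = 0 := by
    rw [map_sum]
    refine Finset.sum_eq_zero fun i _ => ?_
    rw [map_mul, spec_C, map_sub, pt_X, pt_C, sub_self, map_zero, zero_mul]
  rw [map_sub, spec_map_CC, h0, sub_zero, Finset.sum_apply, map_sum] at this
  rw [← this]
  simp only [mulVec, dotProduct, Matrix.map_apply, Matrix.of_apply]
  refine Finset.sum_congr rfl fun j _ => ?_
  rw [Pi.smul_apply, smul_eq_mul, map_mul, mul_comm]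

end FlatGraph

end RigidQE
end

noncomputable section
namespace RigidQE

set_option linter.unusedSectionVars false

open Filter Topology Tate Matrix

section Image

variable {K : Type} [NormedField K] [CompleteSpace K] [IsAlgClosed K] [IsUltrametricDist K]
  {V W : Affinoid K} {f : AffinoidMap W V}

lemma norm_lt_one_iff_of_norm_sub_lt_one {a b : K} (h : ‖a - b‖ < 1) : ‖a‖ < 1 ↔ ‖b‖ < 1 := by
  constructor <;> intro h'
  · have := IsUltrametricDist.norm_add_le_max (b - a) a
    rw [sub_add_cancel, norm_sub_rev] at this
    exact this.trans_lt (max_lt h h')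
  · have := IsUltrametricDist.norm_add_le_max (a - b) b
    rw [sub_add_cancel] at this
    exact this.trans_lt (max_lt h h')

lemma norm_sub_lt_of_norm_sub_lt {E : Type} [SeminormedAddCommGroup E] [IsUltrametricDist E]
    {a b c : E} {r : ℝ} (h : ‖a - b‖ < r) (h' : ‖b - c‖ < r) : ‖a - c‖ < r := by
  rw [← sub_add_sub_cancel a b c]
  exact (IsUltrametricDist.norm_add_le_max _ _).trans_lt (max_lt h h')

lemma Tate.eq_of_norm_sub_lt_one_of_trivial (hK : ∀ c : K, c ≠ 0 → 1 ≤ ‖c‖) {σ τ : Type}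
    {F G : Tate (Tate K σ) τ} (h : ‖F - G‖ < 1) : F = G := by
  rw [← sub_eq_zero]
  obtain ⟨ν, hν⟩ := (F - G).exists_norm_eq
  by_contra h0
  have hc : (F - G).coeff ν ≠ 0 := fun h => h0 (by rwa [h, norm_zero, eq_comm, norm_eq_zero] at hν)
  rw [← hν, norm_eq_one_of_trivial hK hc] at h
  exact lt_irrefl _ h

/-- The graph of a flat map is described by polynomial inequalities up to small perturbations in
the fibres. -/
lemma AffinoidMap.Flat.exists_polynomials (hf : f.Flat) {ι : Type} [Finite ι]
    (H : ι → Tate K (Fin W.m)) :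
    ∃ (s : ℕ) (P : Fin s → MvPolynomial (Fin W.m) (Tate K (Fin V.m))) (ρ : K),
      (∀ y i, ‖f.evGraph y (ofPoly _ _ (P i))‖ ≤ ‖ρ‖) ∧
      ∀ (x : V.carrier) (y : Bl K (Fin W.m)),
        (∀ i, ‖pt y (spec _ (V.bl x) (ofPoly _ _ (P i)))‖ ≤ ‖ρ‖) →
        ∃ y', f.toFun y' = x ∧ ∀ k, ‖pt (W.bl y') (H k) - pt y (H k)‖ < 1 := by
  obtain ⟨s, t, F, Sg, hF, hex⟩ := hf.exists_fibExact
  have hFm : ∀ y i, f.evGraph y (F i) = 0 := fun y i => f.toGraph_eq_zero.1 (by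
    rw [← RingHom.mem_ker, ← hF]
    exact Ideal.subset_span ⟨i, rfl⟩) y
  have hzero : ∀ (x : V.carrier) (y : Bl K (Fin W.m)),
      (∀ i, pt y (spec _ (V.bl x) (F i)) = 0) → ∃ y', W.bl y' = y ∧ f.toFun y' = x :=
    fun x y h => f.exists_of_common_zero fun s hs => by
      rw [← RingHom.mem_ker, ← hF, Ideal.mem_span_range_iff_exists_fun] at hs
      obtain ⟨c, rfl⟩ := hs
      rw [map_sum, map_sum]
      exact Finset.sum_eq_zero fun i _ => by rw [map_mul, map_mul, h, mul_zero]
  by_cases hK : ∀ c : K, c ≠ 0 → 1 ≤ ‖c‖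
  · choose P hP using fun i => exists_poly_norm_sub_lt (F i) one_pos
    have hPF : ∀ i, ofPoly _ _ (P i) = F i := fun i =>
      (eq_of_norm_sub_lt_one_of_trivial hK (hP i).1).symm
    refine ⟨s, P, 0, fun y i => by rw [hPF, hFm], fun x y h => ?_⟩
    obtain ⟨y', rfl, hy'⟩ := hzero x y fun i => by simpa [hPF] using h i
    exact ⟨y', hy', fun k => by simp⟩
  · push Not at hK
    cases nonempty_fintype ι
    have hpos : 0 < (∑ k, ‖H k‖ + 1)⁻¹ := by positivity
    obtain ⟨δ, hδ0, hδ, hδ1⟩ := exists_norm_lt hK hpos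
    obtain ⟨ρ, hρ0, hρ⟩ := hex.exists_zero_near hK hδ0 hδ1.le
    choose P hP using fun i => exists_poly_norm_sub_lt (F i) (norm_pos_iff.2 hρ0)
    have hdist : ∀ (φ : CHom (Tate (Tate K (Fin V.m)) (Fin W.m)) K) i,
        ‖φ (F i) - φ (ofPoly _ _ (P i))‖ ≤ ‖ρ‖ := fun φ i => by
      rw [← map_sub]
      exact (φ.bound _).trans (hP i).1.le
    refine ⟨s, P, ρ, fun y i => ?_, fun x y h => ?_⟩
    · have := hdist (f.evGraph y) i
      rwa [hFm, zero_sub, norm_neg] at this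
    · obtain ⟨z, hzy, hz⟩ := hρ (V.bl x) (fun q hq => mem_mI_iff.2 (Affinoid.mem_ideal.1 hq x)) y
        fun i => by
          have h1 := hdist ((pt y).comp (spec _ (V.bl x))) i
          have h2 := IsUltrametricDist.norm_add_le_max (pt y (spec _ (V.bl x) (F i)) -
            pt y (spec _ (V.bl x) (ofPoly _ _ (P i)))) (pt y (spec _ (V.bl x) (ofPoly _ _ (P i))))
          rw [sub_add_cancel] at h2
          exact h2.trans (max_le h1 (h i))
      obtain ⟨y', rfl, hy'⟩ := hzero x z hz
      refine ⟨y', hy', fun k => (norm_pt_sub_pt_le (norm_nonneg δ) hzy (H k)).trans_lt ?_⟩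
      have hk : ‖H k‖ < ∑ k, ‖H k‖ + 1 := lt_add_of_le_of_pos
        (Finset.single_le_sum (f := fun k => ‖H k‖) (fun _ _ => norm_nonneg _)
          (Finset.mem_univ k)) one_pos
      calc ‖δ‖ * ‖H k‖ ≤ ‖δ‖ * (∑ k, ‖H k‖ + 1) :=
            mul_le_mul_of_nonneg_left hk.le (norm_nonneg _)
        _ < 1 := (lt_inv_mul_iff₀' ((norm_nonneg _).trans_lt hk)).1 (by simpa using hδ)

/-- Values of polynomials over the affinoid algebra. -/
lemma evN_map_ofTate (x : V.carrier) {n : ℕ} (y : Bl K (Fin n))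
    (P : MvPolynomial (Fin n) (Tate K (Fin V.m))) :
    evN n V.ev (x, y.1) (MvPolynomial.map V.ofTate P) = pt y (spec _ (V.bl x) (ofPoly _ _ P)) := by
  have : (evN n V.ev (x, y.1)).toRingHom.comp (MvPolynomial.map V.ofTate) =
      ((pt y).comp (spec _ (V.bl x))).toRingHom.comp (ofPoly _ _) := by
    refine MvPolynomial.ringHom_ext (fun a => ?_) fun i => ?_
    · change evN n V.ev (x, y.1) (MvPolynomial.map V.ofTate (MvPolynomial.C a)) =
        pt y (spec _ (V.bl x) (C a))
      rw [MvPolynomial.map_C, evN_C, spec_C, pt_C]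
      rfl
    · change evN n V.ev (x, y.1) (MvPolynomial.map V.ofTate (MvPolynomial.X i)) =
        pt y (spec _ (V.bl x) (Tate.X i))
      rw [MvPolynomial.map_X, evN_X, spec_X, pt_X]
  exact RingHom.congr_fun this P

theorem AffinoidMap.Flat.isSemianalytic_image (hf : f.Flat) {ι κ : Type} [Finite ι] [Finite κ]
    (h : ι → W.O) (g : κ → W.O) : IsSemianalytic V (f.toFun ''
      {y | (∀ i, ‖(h i : W.carrier → K) y‖ < 1) ∧ ∀ j, 1 ≤ ‖(g j : W.carrier → K) y‖}) := by
  choose H hH using fun k : ι ⊕ κ => W.ofTate_surjective (Sum.elim h g k)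
  obtain ⟨s, P, ρ, hP, hPz⟩ := hf.exists_polynomials H
  choose Q hQ using fun k => exists_poly_norm_sub_lt (map CC (H k) : Tate (Tate K (Fin V.m)) _)
    one_pos
  have hval : ∀ k y, ((Sum.elim h g k : W.O) : W.carrier → K) y = pt (W.bl y) (H k) := fun k y => by
    rw [← hH]; rfl
  have hclose : ∀ k (x : V.carrier) (y : Bl K (Fin W.m)),
      ‖pt y (H k) - pt y (spec _ (V.bl x) (ofPoly _ _ (Q k)))‖ < 1 := fun k x y => by
    have := (((pt y).comp (spec _ (V.bl x))).bound _).trans_lt (hQ k).1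
    rwa [map_sub, CHom.comp_apply, CHom.comp_apply, spec_map_CC] at this
  let E := evN W.m V.ev
  let p : MvPolynomial (Fin W.m) (Tate K (Fin V.m)) →+* MvPolynomial (Fin W.m) V.O :=
    MvPolynomial.map V.ofTate
  have hdet : Det V.ev fun x => ∃ y, (∀ j, ‖E (x, y) (MvPolynomial.X j)‖ ≤ ‖E (x, y) 1‖) ∧
      (∀ i, ‖E (x, y) (p (P i))‖ ≤ ‖E (x, y) (algebraMap K _ ρ)‖) ∧
      (∀ i, ‖E (x, y) (p (Q (Sum.inl i)))‖ < ‖E (x, y) 1‖) ∧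
      ∀ j, ‖E (x, y) 1‖ ≤ ‖E (x, y) (p (Q (Sum.inr j)))‖ :=
    Det.exists_points (S := fun z => (∀ j, ‖E z (MvPolynomial.X j)‖ ≤ ‖E z 1‖) ∧
      (∀ i, ‖E z (p (P i))‖ ≤ ‖E z (algebraMap K _ ρ)‖) ∧
      (∀ i, ‖E z (p (Q (Sum.inl i)))‖ < ‖E z 1‖) ∧
      ∀ j, ‖E z 1‖ ≤ ‖E z (p (Q (Sum.inr j)))‖)
    ((Det.forall fun _ => det_le _ _).and ((Det.forall fun _ => det_le _ _).and
      ((Det.forall fun _ => det_lt _ _).and (Det.forall fun _ => det_le _ _))))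
  convert hdet.isSemianalytic using 1
  ext x
  simp only [Set.mem_image, Set.mem_ofPred_eq, map_one, norm_one, E, evN_X, AlgHom.commutes,
    Algebra.algebraMap_self, RingHom.id_apply, p]
  constructor
  · rintro ⟨y, ⟨hy1, hy2⟩, rfl⟩
    refine ⟨(W.bl y).1, (W.bl y).2, fun i => ?_, fun i => ?_, fun j => ?_⟩
    · rw [evN_map_ofTate]
      exact hP y i
    · rw [evN_map_ofTate, ← norm_lt_one_iff_of_norm_sub_lt_one (hclose _ _ _), ← hval]
      exact hy1 i
    · rw [evN_map_ofTate, ← not_lt, ← norm_lt_one_iff_of_norm_sub_lt_one (hclose _ _ _), ← hval,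
        not_lt]
      exact hy2 j
  · rintro ⟨y, hy, h1, h2, h3⟩
    obtain ⟨y, rfl⟩ : ∃ y' : Bl K (Fin W.m), y = y'.1 := ⟨⟨y, hy⟩, rfl⟩
    simp only [evN_map_ofTate] at h1 h2 h3
    obtain ⟨y', rfl, hy'⟩ := hPz x y h1
    have hc : ∀ k, ‖pt (W.bl y') (H k) -
        pt y (spec _ (V.bl (f.toFun y')) (ofPoly _ _ (Q k)))‖ < 1 := fun k =>
      norm_sub_lt_of_norm_sub_lt (hy' k) (hclose k _ y)
    refine ⟨y', ⟨fun i => ?_, fun j => ?_⟩, rfl⟩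
    · have := hval (Sum.inl i) y'
      rw [Sum.elim_inl] at this
      rw [this, norm_lt_one_iff_of_norm_sub_lt_one (hc _)]
      exact h2 i
    · have := hval (Sum.inr j) y'
      rw [Sum.elim_inr] at this
      rw [this, ← not_lt, norm_lt_one_iff_of_norm_sub_lt_one (hc _), not_lt]
      exact h3 j

end Image

end RigidQE
end

noncomputable section
namespace RigidQE

/-- **Raynaud–Gruson–Mehlmann.**  Let `f : Y → X` be a flat map of affinoid varieties and
let `Σ = {y ∈ Y : ‖hᵢ(y)‖ < 1 and ‖gⱼ(y)‖ ≥ 1, for i ∈ I and j ∈ J}`, where the `hᵢ` and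
`gⱼ` are finitely many functions in the affinoid algebra of `Y`, each of supremum norm at
most one.  Then `f(Σ)` is semianalytic in `X`. -/
theorem raynaud_gruson_mehlmann
    (K : Type) [NormedField K] [CompleteSpace K] [IsAlgClosed K] [IsUltrametricDist K]
    (Y X : Affinoid K) (f : AffinoidMap Y X) (hf : f.Flat)
    (I J : ℕ) (h : Fin I → Y.O) (g : Fin J → Y.O)
    (hh : ∀ i (y : Y.carrier), ‖(h i : Y.carrier → K) y‖ ≤ 1)
    (hg : ∀ j (y : Y.carrier), ‖(g j : Y.carrier → K) y‖ ≤ 1) :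
    IsSemianalytic X (f.toFun ''
      {y | (∀ i, ‖(h i : Y.carrier → K) y‖ < 1) ∧ (∀ j, 1 ≤ ‖(g j : Y.carrier → K) y‖)}) :=
  hf.isSemianalytic_image h g

end RigidQE
end
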